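/- Let n ≥ 2, s ∈ (0,1), α > 0, and let K : ℝⁿ → [0,∞) be radially symmetric with non-increasing radial profile and 0 ≤ K(x) ≤ |x|^{−(n+s)} for all x ≠ 0. Let m > 0 and r₀ > 0 with |B_{r₀}| = m. There exists γ₀ > 0 depending only on n such that if α·m^{(1−s)/n} ≤ γ₀ and F is a set of finite perimeter with |F| = m and J_α(F) ≤ J_α(B_{r₀}), then there exists a set F̃ with F̃ ⊆ B_{2r₀} (up to translation), |F̃| = m, and J_α(F̃) ≤ J_α(F). -/

import Mathlib

open MeasureTheory Metric Set Filter
open scoped ENNReal Pointwise symmDiff Classical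

noncomputable section

abbrev Euc (n : ℕ) := EuclideanSpace ℝ (Fin n)

/-- Divergence of a vector field on ℝⁿ. -/
def divg {n : ℕ} (g : Euc n → Euc n) (x : Euc n) : ℝ :=
  ∑ i : Fin n, fderiv ℝ g x (EuclideanSpace.single i 1) i

/-- The admissible values in the variational definition of the perimeter:
values `∫_E div g` over C¹ compactly supported vector fields with `‖g‖ ≤ 1`. -/
def perimVals {n : ℕ} (E : Set (Euc n)) : Set ℝ :=
  {r | ∃ g : Euc n → Euc n, ContDiff ℝ 1 g ∧ HasCompactSupport g ∧
        (∀ x, ‖g x‖ ≤ 1) ∧ r = ∫ x in E, divg g x}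

/-- Perimeter: total variation of the characteristic function. -/
def perim {n : ℕ} (E : Set (Euc n)) : ℝ := sSup (perimVals E)

/-- A set has finite perimeter if the variational quantities are bounded above. -/
def HasFinitePerim {n : ℕ} (E : Set (Euc n)) : Prop := BddAbove (perimVals E)

/-- Characteristic function of a set. -/
def chi {n : ℕ} (E : Set (Euc n)) : Euc n → ℝ := E.indicator 1

/-- Nonlocal perimeter associated with a kernel `K`. -/
def PK {n : ℕ} (K : Euc n → ℝ) (E : Set (Euc n)) : ℝ :=
  ∫ x, ∫ y, K (x - y) * |chi E x - chi E y|

/-- Fractional `s`-perimeter. -/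
def Ps (n : ℕ) (s : ℝ) (E : Set (Euc n)) : ℝ :=
  ∫ x : Euc n, ∫ y : Euc n, |chi E x - chi E y| / ‖x - y‖ ^ ((n : ℝ) + s)

/-- The energy `J_α(E) = P(E) - α s (1-s) P_K(E)`. -/
def Jen {n : ℕ} (K : Euc n → ℝ) (s α : ℝ) (E : Set (Euc n)) : ℝ :=
  perim E - α * s * (1 - s) * PK K E

/-- The energy `F_{s,α}(E) = P(E) - α s (1-s) P_s(E)`. -/
def Fen (n : ℕ) (s α : ℝ) (E : Set (Euc n)) : ℝ :=
  perim E - α * s * (1 - s) * Ps n s E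

/-- ω_n : volume of the unit ball of ℝⁿ. -/
def ballVol (n : ℕ) : ℝ := (volume (ball (0 : Euc n) 1)).toReal

/-- Volume-constrained global minimizer of `J_α` (volume `m`). -/
def IsJMin {n : ℕ} (K : Euc n → ℝ) (s α m : ℝ) (E : Set (Euc n)) : Prop :=
  MeasurableSet E ∧ HasFinitePerim E ∧ volume E = ENNReal.ofReal m ∧
    ∀ F : Set (Euc n), MeasurableSet F → HasFinitePerim F →
      volume F = ENNReal.ofReal m → Jen K s α E ≤ Jen K s α F

/-- Volume-constrained global minimizer of `F_{s,α}` (volume `m`). -/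
def IsFMin (n : ℕ) (s α m : ℝ) (E : Set (Euc n)) : Prop :=
  MeasurableSet E ∧ HasFinitePerim E ∧ volume E = ENNReal.ofReal m ∧
    ∀ F : Set (Euc n), MeasurableSet F → HasFinitePerim F →
      volume F = ENNReal.ofReal m → Fen n s α E ≤ Fen n s α F

open Topology

lemma zero_mem_perimVals {n : ℕ} (E : Set (Euc n)) : (0:ℝ) ∈ perimVals E := by
  refine ⟨fun _ => 0, contDiff_const, HasCompactSupport.zero, by simp, ?_⟩
  have : ∀ x : Euc n, divg (fun _ => (0 : Euc n)) x = 0 := by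
    intro x; simp [divg]
  simp [this]

lemma perim_nonneg {n : ℕ} {E : Set (Euc n)} (h : HasFinitePerim E) : 0 ≤ perim E :=
  le_csSup h (zero_mem_perimVals E)

lemma le_perim {n : ℕ} {E : Set (Euc n)} (h : HasFinitePerim E) {g : Euc n → Euc n}
    (hg : ContDiff ℝ 1 g) (hc : HasCompactSupport g) (h1 : ∀ x, ‖g x‖ ≤ 1) :
    ∫ x in E, divg g x ≤ perim E :=
  le_csSup h ⟨g, hg, hc, h1, rfl⟩

lemma perim_le_of {n : ℕ} {E : Set (Euc n)} {C : ℝ}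
    (h : ∀ g : Euc n → Euc n, ContDiff ℝ 1 g → HasCompactSupport g → (∀ x, ‖g x‖ ≤ 1) →
      ∫ x in E, divg g x ≤ C) : HasFinitePerim E ∧ perim E ≤ C := by
  have : ∀ r ∈ perimVals E, r ≤ C := by
    rintro r ⟨g, hg, hc, h1, rfl⟩; exact h g hg hc h1
  exact ⟨⟨C, this⟩, csSup_le ⟨0, zero_mem_perimVals E⟩ this⟩

lemma divg_continuous {n : ℕ} {g : Euc n → Euc n} (hg : ContDiff ℝ 1 g) :
    Continuous (divg g) := by
  unfold divg
  have h := hg.continuous_fderiv (by norm_num)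
  refine continuous_finsetSum _ fun i _ => ?_
  have : Continuous fun x => fderiv ℝ g x (EuclideanSpace.single i 1) :=
    h.clm_apply continuous_const
  exact (EuclideanSpace.proj (𝕜 := ℝ) i).continuous.comp this

lemma divg_hasCompactSupport {n : ℕ} {g : Euc n → Euc n} (hg : HasCompactSupport g) :
    HasCompactSupport (divg g) := by
  have h := hg.fderiv (𝕜 := ℝ)
  refine h.mono' ?_
  refine fun x hx => subset_closure ?_
  intro h0
  apply hx
  simp [divg, h0]

lemma divg_integrable {n : ℕ} {g : Euc n → Euc n} (hg : ContDiff ℝ 1 g)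
    (hc : HasCompactSupport g) : Integrable (divg g) :=
  (divg_continuous hg).integrable_of_hasCompactSupport (divg_hasCompactSupport hc)

lemma sum_single_eq {n : ℕ} (v : Euc n) :
    ∑ i : Fin n, v i • (EuclideanSpace.single i (1:ℝ) : Euc n) = v := by
  ext j
  simp [Pi.single_apply]

lemma divg_smul {n : ℕ} {η : Euc n → ℝ} {g : Euc n → Euc n} {x : Euc n}
    (hη : DifferentiableAt ℝ η x) (hg : DifferentiableAt ℝ g x) :
    divg (fun y => η y • g y) x = η x * divg g x + fderiv ℝ η x (g x) := by
  have h1 : fderiv ℝ η x (g x) = ∑ i : Fin n, g x i * fderiv ℝ η x (EuclideanSpace.single i 1) := by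
    conv_lhs => rw [← sum_single_eq (g x)]
    rw [map_sum]; simp
  rw [h1]
  unfold divg
  rw [fderiv_fun_smul hη hg, Finset.mul_sum, ← Finset.sum_add_distrib]
  refine Finset.sum_congr rfl fun i _ => ?_
  simp [ContinuousLinearMap.smulRight_apply]; ring

lemma divg_add {n : ℕ} {f g : Euc n → Euc n} {x : Euc n}
    (hf : DifferentiableAt ℝ f x) (hg : DifferentiableAt ℝ g x) :
    divg (fun y => f y + g y) x = divg f x + divg g x := by
  unfold divg
  rw [fderiv_fun_add hf hg, ← Finset.sum_add_distrib]
  simp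

lemma divg_eq_trace {n : ℕ} (g : Euc n → Euc n) (x : Euc n) (b : OrthonormalBasis (Fin n) ℝ (Euc n)) :
    divg g x = ∑ i, inner ℝ (b i) (fderiv ℝ g x (b i)) := by
  have h1 := LinearMap.trace_eq_sum_inner (fderiv ℝ g x : Euc n →ₗ[ℝ] Euc n) b
  have h2 := LinearMap.trace_eq_sum_inner (fderiv ℝ g x : Euc n →ₗ[ℝ] Euc n)
    (EuclideanSpace.basisFun (Fin n) ℝ)
  rw [h1] at h2
  simp only [ContinuousLinearMap.coe_coe] at h2
  rw [h2]
  unfold divg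
  refine Finset.sum_congr rfl fun i _ => ?_
  simp [EuclideanSpace.basisFun_apply, EuclideanSpace.inner_single_left]

lemma perim_affine {n : ℕ} {E : Set (Euc n)} (hE : HasFinitePerim E) (hm : MeasurableSet E)
    (U : Euc n ≃ₗᵢ[ℝ] Euc n) {c : ℝ} (hc : 0 < c) (v : Euc n) :
    HasFinitePerim ((fun x => c • U x + v) ⁻¹' E) ∧
    perim ((fun x => c • U x + v) ⁻¹' E) ≤ c * (c ^ n)⁻¹ * perim E := by
  apply perim_le_of
  intro g hg hgc h1
  set φ : Euc n → Euc n := fun x => c • U x + v with hφ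
  set ψ : Euc n → Euc n := fun z => U.symm (c⁻¹ • (z - v)) with hψ
  have hψφ : ∀ x, ψ (φ x) = x := by
    intro x; simp [hφ, hψ, smul_smul, inv_mul_cancel₀ hc.ne']
  have hφψ : ∀ x, φ (ψ x) = x := by
    intro x; simp [hφ, hψ, smul_smul, mul_inv_cancel₀ hc.ne']
  have hψd : ∀ z, HasFDerivAt ψ ((U.symm : Euc n →L[ℝ] Euc n).comp (c⁻¹ • ContinuousLinearMap.id ℝ (Euc n))) z := by
    intro z
    have h2 : HasFDerivAt (fun z : Euc n => c⁻¹ • (z - v)) (c⁻¹ • ContinuousLinearMap.id ℝ (Euc n)) z :=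
      ((hasFDerivAt_id z).sub_const v).const_smul c⁻¹
    exact (U.symm : Euc n →L[ℝ] Euc n).hasFDerivAt.comp z h2
  set gt : Euc n → Euc n := fun z => U (g (ψ z)) with hgt
  have hψc : ContDiff ℝ 1 ψ := by
    have h2 : ContDiff ℝ 1 (fun z : Euc n => c⁻¹ • (z - v)) := by fun_prop
    exact U.symm.contDiff.comp h2
  have hgtc : ContDiff ℝ 1 gt := U.contDiff.comp (hg.comp hψc)
  let Φ : Euc n ≃ₜ Euc n :=
    { toFun := ψ, invFun := φ, left_inv := hφψ, right_inv := hψφ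
      continuous_toFun := hψc.continuous
      continuous_invFun := by simp only [hφ]; fun_prop }
  have hgts : HasCompactSupport gt := by
    have := (hgc.comp_homeomorph Φ)
    exact this.comp_left (g := U) (by simp)
  have hdiv : ∀ z, divg gt z = c⁻¹ * divg g (ψ z) := by
    intro z
    have hgd : HasFDerivAt g (fderiv ℝ g (ψ z)) (ψ z) := (hg.differentiable (by norm_num) _).hasFDerivAt
    have h3 : HasFDerivAt gt _ z := (U : Euc n →L[ℝ] Euc n).hasFDerivAt.comp z (hgd.comp z (hψd z))
    rw [divg_eq_trace g (ψ z) ((EuclideanSpace.basisFun (Fin n) ℝ).map U.symm), Finset.mul_sum]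
    unfold divg
    rw [h3.fderiv]
    refine Finset.sum_congr rfl fun i _ => ?_
    have h4 : ∀ w : Euc n, inner ℝ (U.symm (EuclideanSpace.single i (1:ℝ))) w = (U w) i := by
      intro w
      rw [← U.inner_map_map]; simp [EuclideanSpace.inner_single_left]
    simp [EuclideanSpace.basisFun_apply, h4]
  have hmain := le_perim hE hgtc hgts (by intro x; simp [hgt, h1])
  -- change of variables
  have hcv : ∫ x in φ ⁻¹' E, divg g x = c * (c ^ n)⁻¹ * ∫ z in E, divg gt z := by
    have hint : ∀ f : Euc n → ℝ, ∫ x, f (φ x) = (c ^ n)⁻¹ * ∫ z, f z := by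
      intro f
      have e1 : ∫ x, f (φ x) = ∫ x, f (c • x + v) :=
        U.measurePreserving.integral_comp U.toHomeomorph.measurableEmbedding (fun y => f (c • y + v))
      rw [e1, Measure.integral_comp_smul volume (fun y => f (y + v)) c,
        integral_add_right_eq_self (fun y => f y) v]
      simp [abs_of_pos, hc]
    have hmφ : MeasurableSet (φ ⁻¹' E) := Φ.symm.continuous.measurable hm
    rw [← integral_indicator hmφ, ← integral_indicator hm]
    have e2 : (φ ⁻¹' E).indicator (divg g) = fun x => c * (E.indicator (divg gt)) (φ x) := by
      ext x
      by_cases hx : φ x ∈ E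
      · rw [indicator_of_mem (by exact hx), indicator_of_mem hx, hdiv, hψφ]
        field_simp
      · rw [indicator_of_notMem (by exact hx), indicator_of_notMem hx]; simp
    rw [e2, integral_const_mul, hint]; ring
  rw [hcv]
  gcongr

lemma divg_const_dir {n : ℕ} {φ : Euc n → ℝ} {x : Euc n} (hφ : DifferentiableAt ℝ φ x) (w : Euc n) :
    divg (fun y => φ y • w) x = fderiv ℝ φ x w := by
  rw [divg_smul hφ (differentiableAt_const w)]
  simp [divg]

lemma transl_test {n : ℕ} {E : Set (Euc n)} (hE : HasFinitePerim E)
    (hv : volume E ≠ ∞) {φ : Euc n → ℝ} (hφ : ContDiff ℝ 1 φ) (hc : HasCompactSupport φ)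
    (h1 : ∀ x, |φ x| ≤ 1) (h : Euc n) :
    (∫ x in E, φ x) - ∫ x in E, φ (x + h) ≤ ‖h‖ * perim E := by
  rcases eq_or_ne h 0 with rfl | hh
  · simp
  have hpos : 0 < ‖h‖ := norm_pos_iff.mpr hh
  have : IsFiniteMeasure (volume.restrict E) := ⟨by simpa using hv.lt_top⟩
  obtain ⟨C, hC⟩ := (hφ.continuous_fderiv (by norm_num)).bounded_above_of_compact_support
    (hc.fderiv (𝕜 := ℝ))
  have hder : ∀ t : ℝ, HasDerivAt (fun t : ℝ => ∫ x in E, φ (x + t • h))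
      (∫ x in E, fderiv ℝ φ (x + t • h) h) t := by
    intro t
    refine (hasDerivAt_integral_of_dominated_loc_of_deriv_le (F := fun t x => φ (x + t • h))
      (F' := fun t x => fderiv ℝ φ (x + t • h) h) (bound := fun _ => C * ‖h‖) (univ_mem) ?_ ?_ ?_ ?_ ?_ ?_).2
    · refine Eventually.of_forall fun t => ?_
      exact (hφ.continuous.comp (by fun_prop)).aestronglyMeasurable
    · refine Integrable.of_bound (C := 1) ((hφ.continuous.comp (by fun_prop)).aestronglyMeasurable) ?_
      exact Eventually.of_forall fun x => by simpa using h1 _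
    · refine Continuous.aestronglyMeasurable ?_
      exact ((hφ.continuous_fderiv (by norm_num)).comp (by fun_prop)).clm_apply continuous_const
    · refine Eventually.of_forall fun x t _ => ?_
      exact (ContinuousLinearMap.le_opNorm _ _).trans (by gcongr; exact hC _)
    · exact integrable_const _
    · refine Eventually.of_forall fun x t _ => ?_
      have h2 : HasDerivAt (fun t : ℝ => x + t • h) h t := by
        simpa using ((hasDerivAt_id t).smul_const h).const_add x
      exact ((hφ.differentiable (by norm_num) _).hasFDerivAt).comp_hasDerivAt t h2
  have hbd : ∀ t : ℝ, - (∫ x in E, fderiv ℝ φ (x + t • h) h) ≤ ‖h‖ * perim E := by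
    intro t
    set g : Euc n → Euc n := fun x => φ (x + t • h) • (-(‖h‖⁻¹ • h)) with hg
    have hφt : ContDiff ℝ 1 (fun x => φ (x + t • h)) := hφ.comp (by fun_prop)
    have hgc : ContDiff ℝ 1 g := hφt.smul contDiff_const
    have hgs : HasCompactSupport g := by
      have h3 : HasCompactSupport (fun x => φ (x + t • h)) := hc.comp_homeomorph (Homeomorph.addRight (t • h))
      exact h3.smul_right
    have h4 := le_perim hE hgc hgs (by
      intro x
      simp only [hg, norm_smul, norm_neg, norm_inv, norm_norm, inv_mul_cancel₀ hpos.ne', mul_one]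
      exact h1 _)
    have h5 : ∀ x, divg g x = - ‖h‖⁻¹ * fderiv ℝ φ (x + t • h) h := by
      intro x
      rw [hg, divg_const_dir (hφt.differentiable (by norm_num) x), fderiv_comp_add_right]
      simp
    simp_rw [h5] at h4
    rw [integral_const_mul] at h4
    rw [← div_le_iff₀' hpos]
    calc _ = _ := by ring
      _ ≤ _ := h4
  have hmono : MonotoneOn (fun t : ℝ => (∫ x in E, φ (x + t • h)) + t * (‖h‖ * perim E)) (Icc 0 1) := by
    have hd : ∀ t : ℝ, HasDerivAt (fun t : ℝ => (∫ x in E, φ (x + t • h)) + t * (‖h‖ * perim E))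
      ((∫ x in E, fderiv ℝ φ (x + t • h) h) + 1 * (‖h‖ * perim E)) t := fun t =>
        (hder t).add ((hasDerivAt_id t).mul_const _)
    refine (monotone_of_deriv_nonneg (fun t => (hd t).differentiableAt) fun t => ?_).monotoneOn _
    rw [(hd t).deriv]; linarith [hbd t]
  have h6 := hmono (by simp) (by simp) (zero_le_one (α := ℝ))
  simp at h6
  linarith

/-- translation defect -/
def tr {n : ℕ} (E : Set (Euc n)) (h : Euc n) : ℝ≥0∞ :=
  ∫⁻ x, ENNReal.ofReal |chi E x - chi E (x - h)|

lemma tr_eq {n : ℕ} {E : Set (Euc n)} (hm : MeasurableSet E) (h : Euc n) :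
    tr E h = volume (E \ {x | x - h ∈ E}) + volume ({x | x - h ∈ E} \ E) := by
  have hm2 : MeasurableSet {x : Euc n | x - h ∈ E} := by
    exact (measurable_sub_const h) hm
  rw [← measure_union (by
    rw [Set.disjoint_left]; rintro x ⟨h1, h2⟩ ⟨h3, h4⟩; exact h2 h3) (hm2.diff hm)]
  rw [← lintegral_indicator_one ((hm.diff hm2).union (hm2.diff hm))]
  unfold tr
  congr 1; ext x
  simp only [chi, indicator]
  by_cases h1 : x ∈ E <;> by_cases h2 : x - h ∈ E <;> simp [h1, h2]

lemma exists_test {n : ℕ} {A B : Set (Euc n)} (hA : IsCompact A) (hB : IsCompact B)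
    (hAB : Disjoint A B) : ∃ φ : Euc n → ℝ, ContDiff ℝ 1 φ ∧ HasCompactSupport φ ∧
      (∀ x, |φ x| ≤ 1) ∧ (∀ x ∈ A, φ x = 1) ∧ (∀ x ∈ B, φ x = -1) := by
  obtain ⟨R, hR⟩ := ((hA.union hB).isBounded).subset_ball (0 : Euc n)
  have key : ∀ A B : Set (Euc n), IsCompact A → IsCompact B → Disjoint A B → A ⊆ ball 0 R →
      ∃ f : Euc n → ℝ, ContDiff ℝ 1 f ∧ (∀ x ∈ B, f x = 0) ∧ (∀ x ∈ A, f x = 1) ∧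
        (∀ x, x ∉ ball (0 : Euc n) R → f x = 0) ∧ ∀ x, f x ∈ Icc (0:ℝ) 1 := by
    intro A B hA hB hAB hAR
    obtain ⟨f, hf0, hf1, hf⟩ := exists_contMDiffMap_zero_one_of_isClosed (n := 1)
      (modelWithCornersSelf ℝ (Euc n)) (s := B ∪ (ball (0 : Euc n) R)ᶜ) (t := A)
      (hB.isClosed.union isOpen_ball.isClosed_compl) hA.isClosed
      (by
        rw [Set.disjoint_left]
        rintro x (hx | hx) h2
        · exact Set.disjoint_left.1 hAB h2 hx
        · exact hx (hAR h2))
    exact ⟨f, f.contMDiff.contDiff, fun x hx => hf0 (Or.inl hx), fun x hx => hf1 hx,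
      fun x hx => hf0 (Or.inr hx), hf⟩
  obtain ⟨f, f1, f2, f3, f4, f5⟩ := key A B hA hB hAB (subset_union_left.trans hR)
  obtain ⟨g, g1, g2, g3, g4, g5⟩ := key B A hB hA hAB.symm (subset_union_right.trans hR)
  refine ⟨fun x => f x - g x, f1.sub g1, ?_, ?_, ?_, ?_⟩
  · refine HasCompactSupport.intro (isCompact_closedBall (0 : Euc n) R) fun x hx => ?_
    have hx' : x ∉ ball (0 : Euc n) R := fun h => hx (ball_subset_closedBall h)
    simp [f4 x hx', g4 x hx']
  · intro x
    have := f5 x; have := g5 x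
    rw [abs_le]; constructor <;> linarith [(f5 x).1, (f5 x).2, (g5 x).1, (g5 x).2]
  · intro x hx; simp [f3 x hx, g2 x hx]
  · intro x hx; simp [f2 x hx, g3 x hx]

lemma tr_le {n : ℕ} {E : Set (Euc n)} (hE : HasFinitePerim E) (hm : MeasurableSet E)
    (hv : volume E ≠ ∞) (h : Euc n) : tr E h ≤ ENNReal.ofReal (‖h‖ * perim E) := by
  set E' : Set (Euc n) := {x | x - h ∈ E} with hE'
  have hm2 : MeasurableSet E' := (measurable_sub_const h) hm
  have hv2 : volume E' ≠ ∞ := by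
    have : volume E' = volume E := by
      have h0 := measure_preimage_add_right volume (-h) E
      rw [← h0]; congr 1
    rwa [this]
  rw [tr_eq hm]
  set A := E \ E' with hA
  set B := E' \ E with hB
  have hvA : volume A ≠ ∞ := measure_ne_top_of_subset sdiff_subset hv
  have hvB : volume B ≠ ∞ := measure_ne_top_of_subset sdiff_subset hv2
  have hmA : MeasurableSet A := hm.diff hm2
  have hmB : MeasurableSet B := hm2.diff hm
  have key : ∀ ε : ℝ, 0 < ε → volume.real A + volume.real B ≤ ‖h‖ * perim E + 4 * ε := by
    intro ε hε
    have hε' : ENNReal.ofReal ε ≠ 0 := by simpa using hε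
    obtain ⟨KA, hKA, hKAc, hKA2⟩ := hmA.exists_isCompact_sdiff_lt hvA hε'
    obtain ⟨KB, hKB, hKBc, hKB2⟩ := hmB.exists_isCompact_sdiff_lt hvB hε'
    have hdAB : Disjoint A B := by
      rw [Set.disjoint_left]; rintro x ⟨h1, h2⟩ ⟨h3, h4⟩; exact h2 h3
    obtain ⟨φ, p1, p2, p3, p4, p5⟩ := exists_test hKAc hKBc (hdAB.mono hKA hKB)
    have hint : Integrable φ := p1.continuous.integrable_of_hasCompactSupport p2
    have hrA : volume.real (A \ KA) ≤ ε := by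
      rw [Measure.real]; exact ENNReal.toReal_le_of_le_ofReal hε.le hKA2.le
    have hrB : volume.real (B \ KB) ≤ ε := by
      rw [Measure.real]; exact ENNReal.toReal_le_of_le_ofReal hε.le hKB2.le
    have low : ∀ A KA : Set (Euc n), MeasurableSet A → IsCompact KA → KA ⊆ A → volume A ≠ ∞ →
        ∀ φ : Euc n → ℝ, Integrable φ → (∀ x, |φ x| ≤ 1) →
        (∀ x ∈ KA, φ x = 1) → volume.real (A \ KA) ≤ ε → volume.real A - 2 * ε ≤ ∫ x in A, φ x := by
      intro A KA hmA hKc hKA hvA φ hint p3 p4 hr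
      have hmK := hKc.measurableSet
      have e1 : ∫ x in A, φ x = (∫ x in KA, φ x) + ∫ x in A \ KA, φ x := by
        rw [← setIntegral_union disjoint_sdiff_right (hmA.diff hmK) hint.integrableOn hint.integrableOn,
          union_sdiff_cancel hKA]
      have e2 : ∫ x in KA, φ x = volume.real KA := by
        rw [setIntegral_congr_fun hmK (g := fun _ => (1:ℝ)) (fun x hx => p4 x hx)]
        simp
      have e3 : volume.real A = volume.real KA + volume.real (A \ KA) := by
        rw [measureReal_sdiff hKA hmK hvA]; ring
      have e4 : ‖∫ x in A \ KA, φ x‖ ≤ 1 * volume.real (A \ KA) :=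
        norm_setIntegral_le_of_norm_le_const (measure_ne_top_of_subset sdiff_subset hvA).lt_top
          (fun x _ => p3 x)
      rw [Real.norm_eq_abs, abs_le] at e4
      linarith [e4.1]
    have l1 := low A KA hmA hKAc hKA hvA φ hint p3 p4 hrA
    have l2 := low B KB hmB hKBc hKB hvB (fun x => - φ x) hint.neg (by simpa using p3)
      (fun x hx => by simp [p5 x hx]) hrB
    rw [integral_neg] at l2
    have l3 := transl_test hE hv p1 p2 p3 h
    have e5 : ∫ x in E, φ x = (∫ x in E ∩ E', φ x) + ∫ x in A, φ x := by
      rw [← integral_inter_add_sdiff hm2 hint.integrableOn]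
    have e6 : ∫ x in E', φ x = (∫ x in E ∩ E', φ x) + ∫ x in B, φ x := by
      rw [← integral_inter_add_sdiff hm hint.integrableOn, inter_comm]
    have e7 : ∫ x in E, φ (x + h) = ∫ x in E', φ x := by
      rw [← integral_indicator hm, ← integral_indicator hm2,
        ← integral_add_right_eq_self (fun x => E'.indicator φ x) h]
      congr 1; ext x
      simp only [indicator, hE', mem_ofPred_eq, add_sub_cancel_right]
    rw [e7, e5, e6] at l3
    linarith
  have key2 : volume.real A + volume.real B ≤ ‖h‖ * perim E := by
    refine le_of_forall_pos_le_add fun ε hε => ?_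
    have := key (ε / 4) (by positivity)
    linarith
  rw [← ENNReal.ofReal_toReal hvA, ← ENNReal.ofReal_toReal hvB, ← ENNReal.ofReal_add (by positivity) (by positivity)]
  exact ENNReal.ofReal_le_ofReal key2

lemma ballVol_pos (n : ℕ) : 0 < ballVol n := by
  unfold ballVol
  exact ENNReal.toReal_pos (measure_ball_pos volume _ one_pos).ne' measure_ball_lt_top.ne

lemma lint_radial {n : ℕ} (hn : 1 ≤ n) {f : ℝ → ℝ} (hf : ∀ y, 0 ≤ f y)
    (hi : IntegrableOn (fun y : ℝ => y ^ (n - 1) * f y) (Ioi 0)) :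
    ∫⁻ h : Euc n, ENNReal.ofReal (f ‖h‖) =
      ENNReal.ofReal (n * ballVol n * ∫ y in Ioi (0:ℝ), y ^ (n - 1) * f y) := by
  have : Nonempty (Fin n) := ⟨⟨0, hn⟩⟩
  have hfin : Module.finrank ℝ (Euc n) = n := by simp
  have h1 := (integrable_fun_norm_addHaar (E := Euc n) volume (f := f)).2 (by
    rw [hfin]; exact hi)
  rw [← ofReal_integral_eq_lintegral_ofReal h1 (Eventually.of_forall fun x => hf _),
    integral_fun_norm_addHaar, hfin]
  simp only [smul_eq_mul, nsmul_eq_mul, ← mul_assoc]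
  rfl

lemma radial_near {n : ℕ} (hn : 1 ≤ n) {s R : ℝ} (hs : s < 1) (hR : 0 < R) :
    ∫⁻ h : Euc n, ENNReal.ofReal ((Iic R).indicator (fun y => |y| ^ (1 - (n:ℝ) - s)) ‖h‖) =
      ENNReal.ofReal (n * ballVol n * (R ^ (1 - s) / (1 - s))) := by
  have key : ∀ y ∈ Ioi (0:ℝ), (Ioc 0 R).indicator (fun y : ℝ => y ^ (-s)) y =
      y ^ (n - 1) * (Iic R).indicator (fun y => |y| ^ (1 - (n:ℝ) - s)) y := by
    intro y hy
    have hy' : 0 < y := hy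
    by_cases h : y ≤ R
    · rw [indicator_of_mem (show y ∈ Ioc 0 R from ⟨hy, h⟩), indicator_of_mem (show y ∈ Iic R from h),
        abs_of_pos hy', ← Real.rpow_natCast, ← Real.rpow_add hy', Nat.cast_sub hn]
      congr 1; push_cast; ring
    · rw [indicator_of_notMem (fun h' => h h'.2), indicator_of_notMem (show y ∉ Iic R from h), mul_zero]
  have h2 : IntegrableOn (fun y : ℝ => y ^ (-s)) (Ioc 0 R) := by
    have := intervalIntegral.intervalIntegrable_rpow' (a := 0) (b := R) (r := -s) (by linarith)
    exact (intervalIntegrable_iff_integrableOn_Ioc_of_le hR.le).1 this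
  rw [lint_radial hn]
  · rw [← setIntegral_congr_fun measurableSet_Ioi key, setIntegral_indicator measurableSet_Ioc,
      inter_eq_right.2 Ioc_subset_Ioi_self, ← intervalIntegral.integral_of_le hR.le,
      integral_rpow (Or.inl (by linarith)), Real.zero_rpow (by linarith)]
    rw [show -s + 1 = 1 - s by ring]; simp
  · intro y
    refine indicator_nonneg (fun y _ => by positivity) y
  · refine IntegrableOn.congr_fun ?_ key measurableSet_Ioi
    exact (integrable_indicator_iff measurableSet_Ioc).2 h2 |>.integrableOn

lemma radial_far {n : ℕ} (hn : 1 ≤ n) {s : ℝ} (hs : 0 < s) :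
    ∫⁻ h : Euc n, ENNReal.ofReal ((Ioi 1).indicator (fun y => |y| ^ (- (n:ℝ) - s)) ‖h‖) =
      ENNReal.ofReal (n * ballVol n * (1 / s)) := by
  have key : ∀ y ∈ Ioi (0:ℝ), (Ioi 1).indicator (fun y : ℝ => y ^ (-s-1)) y =
      y ^ (n - 1) * (Ioi 1).indicator (fun y => |y| ^ (- (n:ℝ) - s)) y := by
    intro y hy
    have hy' : 0 < y := hy
    by_cases h : 1 < y
    · rw [indicator_of_mem (show y ∈ Ioi 1 from h), indicator_of_mem (show y ∈ Ioi 1 from h),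
        abs_of_pos hy', ← Real.rpow_natCast, ← Real.rpow_add hy', Nat.cast_sub hn]
      congr 1; push_cast; ring
    · rw [indicator_of_notMem (show y ∉ Ioi 1 from h), indicator_of_notMem (show y ∉ Ioi 1 from h), mul_zero]
  have h2 : IntegrableOn (fun y : ℝ => y ^ (-s-1)) (Ioi 1) := 
    integrableOn_Ioi_rpow_of_lt (by linarith) one_pos
  rw [lint_radial hn]
  · rw [← setIntegral_congr_fun measurableSet_Ioi key, setIntegral_indicator measurableSet_Ioi,
      inter_eq_right.2 (Ioi_subset_Ioi zero_le_one),
      integral_Ioi_rpow_of_lt (by linarith) one_pos]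
    congr 2
    simp [neg_div_neg_eq]
  · intro y
    refine indicator_nonneg (fun y _ => by positivity) y
  · refine IntegrableOn.congr_fun ?_ key measurableSet_Ioi
    exact (integrable_indicator_iff measurableSet_Ioi).2 h2 |>.integrableOn

def PKl {n : ℕ} (K : Euc n → ℝ) (E : Set (Euc n)) : ℝ≥0∞ := ∫⁻ h, ENNReal.ofReal (K h) * tr E h

lemma chi_measurable {n : ℕ} {E : Set (Euc n)} (hm : MeasurableSet E) : Measurable (chi E) :=
  measurable_one.indicator hm

lemma tr_measurable {n : ℕ} {E : Set (Euc n)} (hm : MeasurableSet E) : Measurable (tr E) := by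
  unfold tr
  have := chi_measurable hm
  refine Measurable.lintegral_prod_right' (f := fun z : Euc n × Euc n =>
    ENNReal.ofReal |chi E z.2 - chi E (z.2 - z.1)|) ?_
  fun_prop

lemma tr_zero {n : ℕ} (E : Set (Euc n)) : tr E 0 = 0 := by simp [tr]

lemma tr_le_two {n : ℕ} {E : Set (Euc n)} (hm : MeasurableSet E) (h : Euc n) :
    tr E h ≤ 2 * volume E := by
  rw [tr_eq hm, two_mul]
  have : volume {x | x - h ∈ E} = volume E := by
    have h0 := measure_preimage_add_right volume (-h) E
    rw [← h0]; congr 1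
  exact add_le_add (measure_mono sdiff_subset) (this ▸ measure_mono sdiff_subset)

lemma PK_eq {n : ℕ} {K : Euc n → ℝ} (hK : Measurable K) (hK0 : ∀ x, 0 ≤ K x) {E : Set (Euc n)}
    (hm : MeasurableSet E) (hfin : PKl K E ≠ ∞) : PK K E = (PKl K E).toReal := by
  have hc := chi_measurable hm
  set f : Euc n × Euc n → ℝ := fun z => K z.2 * |chi E z.1 - chi E (z.1 - z.2)| with hf
  have hfm : Measurable f := by fun_prop
  have h1 : PK K E = ∫ x, ∫ h, f (x, h) := by
    unfold PK
    congr 1; ext x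
    rw [← integral_sub_left_eq_self (fun y => K (x - y) * |chi E x - chi E y|) volume x]
    simp [hf]
  have h2 : ∫⁻ z, ENNReal.ofReal (f z) ∂(volume.prod volume) = PKl K E := by
    rw [lintegral_prod_symm' _ (by fun_prop)]
    unfold PKl tr
    congr 1; ext h
    rw [← lintegral_const_mul _ (by fun_prop)]
    congr 1; ext x
    rw [← ENNReal.ofReal_mul (hK0 h)]
  have h0 : ∀ z, 0 ≤ f z := fun z => mul_nonneg (hK0 _) (abs_nonneg _)
  have h3 : Integrable f (volume.prod volume) := by
    refine ⟨hfm.aestronglyMeasurable, ?_⟩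
    rw [hasFiniteIntegral_iff_ofReal (Eventually.of_forall h0), h2]
    exact hfin.lt_top
  rw [h1, ← integral_prod f h3, integral_eq_lintegral_of_nonneg_ae (Eventually.of_forall h0)
    hfm.aestronglyMeasurable, h2]

lemma PKl_le {n : ℕ} (hn : 1 ≤ n) {s : ℝ} (hs : s ∈ Ioo (0:ℝ) 1) {K : Euc n → ℝ}
    (hK : ∀ x : Euc n, x ≠ 0 → K x ≤ ‖x‖ ^ (-((n : ℝ) + s))) {E : Set (Euc n)}
    (hE : HasFinitePerim E) (hm : MeasurableSet E) (hv : volume E ≠ ∞) :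
    PKl K E ≤ ENNReal.ofReal (n * ballVol n * (perim E / (1 - s) + 2 * volume.real E / s)) := by
  have hb : ∀ h, ENNReal.ofReal (K h) * tr E h ≤
      ENNReal.ofReal ((Iic 1).indicator (fun y => |y| ^ (1 - (n:ℝ) - s)) ‖h‖) * ENNReal.ofReal (perim E)
      + ENNReal.ofReal ((Ioi 1).indicator (fun y => |y| ^ (- (n:ℝ) - s)) ‖h‖) * (2 * volume E) := by
    intro h
    rcases eq_or_ne h 0 with rfl | hh
    · simp [tr_zero]
    have hp : 0 < ‖h‖ := norm_pos_iff.2 hh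
    by_cases h1 : ‖h‖ ≤ 1
    · refine le_trans ?_ le_self_add
      rw [indicator_of_mem (show ‖h‖ ∈ Iic 1 from h1), abs_of_pos hp]
      calc _ ≤ ENNReal.ofReal (‖h‖ ^ (-((n : ℝ) + s))) * ENNReal.ofReal (‖h‖ * perim E) := by
            gcongr; exacts [hK h hh, tr_le hE hm hv h]
        _ = _ := by
            rw [ENNReal.ofReal_mul hp.le, ← mul_assoc, ← ENNReal.ofReal_mul (by positivity)]
            congr 2
            nth_rw 2 [← Real.rpow_one ‖h‖]
            rw [← Real.rpow_add hp]; congr 1; ring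
    · refine le_trans ?_ le_add_self
      push Not at h1
      rw [indicator_of_mem (show ‖h‖ ∈ Ioi 1 from h1), abs_of_pos hp]
      gcongr
      · exact (hK h hh).trans_eq (by congr 1; ring)
      · exact tr_le_two hm h
  have hP := perim_nonneg hE
  have hm1 : Measurable fun h : Euc n => ENNReal.ofReal ((Iic 1).indicator (fun y => |y| ^ (1 - (n:ℝ) - s)) ‖h‖) := by
    have : Measurable ((Iic (1:ℝ)).indicator (fun y => |y| ^ (1 - (n:ℝ) - s))) :=
      Measurable.indicator (by fun_prop) measurableSet_Iic
    fun_prop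
  have hm2 : Measurable fun h : Euc n => ENNReal.ofReal ((Ioi 1).indicator (fun y => |y| ^ (- (n:ℝ) - s)) ‖h‖) := by
    have : Measurable ((Ioi (1:ℝ)).indicator (fun y => |y| ^ (- (n:ℝ) - s))) :=
      Measurable.indicator (by fun_prop) measurableSet_Ioi
    fun_prop
  have hω := ballVol_pos n
  calc PKl K E ≤ _ := lintegral_mono hb
    _ = _ := by
      rw [lintegral_add_left (hm1.mul_const _), lintegral_mul_const _ hm1, lintegral_mul_const _ hm2,
        radial_near hn hs.2 one_pos, radial_far hn hs.1]
      have h2v : 2 * volume E = ENNReal.ofReal (2 * (volume E).toReal) := by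
        rw [ENNReal.ofReal_mul (by norm_num), ENNReal.ofReal_toReal hv]; simp
      rw [h2v, ← ENNReal.ofReal_mul, ← ENNReal.ofReal_mul, ← ENNReal.ofReal_add]
      · congr 1
        rw [Real.one_rpow, Measure.real]; ring
      all_goals have := hs.1; have : 0 < 1 - s := by linarith [hs.2]
      all_goals positivity

lemma tr_union_le {n : ℕ} {E G : Set (Euc n)} (hE : MeasurableSet E) (h : Euc n) :
    tr (E ∪ G) h ≤ tr E h + tr G h := by
  unfold tr
  have := chi_measurable hE
  rw [← lintegral_add_left (by fun_prop)]
  refine lintegral_mono fun x => ?_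
  rw [← ENNReal.ofReal_add (abs_nonneg _) (abs_nonneg _)]
  refine ENNReal.ofReal_le_ofReal ?_
  simp only [chi, indicator, mem_union]
  by_cases h1 : x ∈ E <;> by_cases h2 : x - h ∈ E <;> by_cases h3 : x ∈ G <;>
    by_cases h4 : x - h ∈ G <;> simp [h1, h2, h3, h4]

lemma PKl_union_le {n : ℕ} {K : Euc n → ℝ} (hK : Measurable K) {E G : Set (Euc n)}
    (hE : MeasurableSet E) : PKl K (E ∪ G) ≤ PKl K E + PKl K G := by
  unfold PKl
  have := tr_measurable hE
  rw [← lintegral_add_left (by fun_prop)]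
  refine lintegral_mono fun h => ?_
  rw [← mul_add]
  gcongr
  exact tr_union_le hE h

lemma tr_add_le {n : ℕ} {E : Set (Euc n)} (hE : MeasurableSet E) (a b : Euc n) :
    tr E (a + b) ≤ tr E a + tr E b := by
  have hc := chi_measurable hE
  have h1 : tr E b = ∫⁻ x, ENNReal.ofReal |chi E (x - a) - chi E (x - (a + b))| := by
    unfold tr
    rw [← lintegral_sub_right_eq_self _ a]
    congr 1; ext x; congr 4; abel_nf
  rw [h1]
  unfold tr
  rw [← lintegral_add_left (by fun_prop)]
  refine lintegral_mono fun x => ?_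
  rw [← ENNReal.ofReal_add (abs_nonneg _) (abs_nonneg _)]
  exact ENNReal.ofReal_le_ofReal (abs_sub_le _ _ _)

lemma tr_transl {n : ℕ} (E : Set (Euc n)) (v h : Euc n) :
    tr ((fun x => x + v) ⁻¹' E) h = tr E h := by
  unfold tr
  rw [← lintegral_add_right_eq_self (fun x => ENNReal.ofReal |chi E x - chi E (x - h)|) v]
  congr 1; ext x
  have : x - h + v = x + v - h := by abel
  simp [chi, indicator, this]

lemma PKl_transl {n : ℕ} (K : Euc n → ℝ) (E : Set (Euc n)) (v : Euc n) :
    PKl K ((fun x => x + v) ⁻¹' E) = PKl K E := by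
  unfold PKl; simp_rw [tr_transl]

lemma tr_dil {n : ℕ} {E : Set (Euc n)} (hE : MeasurableSet E) {c : ℝ} (hc : 0 < c) (h : Euc n) :
    tr ((fun x => c • x) ⁻¹' E) h = ENNReal.ofReal ((c ^ n)⁻¹) * tr E (c • h) := by
  have hm : MeasurableSet ((fun x : Euc n => c • x) ⁻¹' E) := (measurable_const_smul c) hE
  have h1 : ∀ s : Set (Euc n), volume ((fun x : Euc n => c • x) ⁻¹' s) = ENNReal.ofReal ((c ^ n)⁻¹) * volume s := by
    intro s
    have := Measure.addHaar_preimage_smul (volume : Measure (Euc n)) hc.ne' s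
    rw [this]
    congr 2
    rw [finrank_euclideanSpace_fin, abs_of_pos (by positivity)]
  rw [tr_eq hm, tr_eq hE, mul_add, ← h1, ← h1]
  have e : {x : Euc n | x - h ∈ (fun x => c • x) ⁻¹' E} = (fun x => c • x) ⁻¹' {x | x - c • h ∈ E} := by
    ext x
    show c • (x - h) ∈ E ↔ c • x - c • h ∈ E
    rw [smul_sub]
  rw [e, preimage_sdiff, preimage_sdiff]

lemma tr_far {n : ℕ} {E : Set (Euc n)} (hm : MeasurableSet E) (hE : E ⊆ ball 0 2) {h : Euc n} (hh : 4 ≤ ‖h‖) :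
    tr E h = 2 * volume E := by
  rw [tr_eq hm]
  have hd : ∀ x ∈ E, x - h ∉ E := by
    intro x hx hx'
    have h1 := hE hx; have h2 := hE hx'
    rw [mem_ball_zero_iff] at h1 h2
    have : ‖h‖ ≤ ‖x‖ + ‖x - h‖ := by
      calc ‖h‖ = ‖x - (x - h)‖ := by congr 1; abel
        _ ≤ _ := norm_sub_le _ _
    linarith
  have e1 : E \ {x | x - h ∈ E} = E := by
    ext x; exact ⟨fun h => h.1, fun h => ⟨h, hd x h⟩⟩
  have e2 : {x | x - h ∈ E} \ E = {x | x - h ∈ E} := by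
    ext x; exact ⟨fun h => h.1, fun h1 => ⟨h1, fun h2 => hd x h2 h1⟩⟩
  rw [e1, e2, two_mul]
  congr 1
  have h0 := measure_preimage_add_right volume (-h) E
  rw [← h0]; congr 1

lemma PKl_dil {n : ℕ} (hn : 1 ≤ n) {s : ℝ} (hs : s ∈ Ioo (0:ℝ) 1) {K : Euc n → ℝ} (hKm : Measurable K)
    (hK : ∀ x : Euc n, x ≠ 0 → K x ≤ ‖x‖ ^ (-((n : ℝ) + s))) {E : Set (Euc n)}
    (hE : HasFinitePerim E) (hm : MeasurableSet E) (hsub : E ⊆ ball 0 2) {l : ℝ} (hl : 1 ≤ l)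
    (hl2 : l ≤ 2) :
    PKl K E ≤ PKl K ((fun x => l⁻¹ • x) ⁻¹' E) +
      ENNReal.ofReal (n * ballVol n * (8 / (1 - s)) * ((l - 1) * perim E)) := by
  have hv : volume E ≠ ∞ := measure_ne_top_of_subset hsub measure_ball_lt_top.ne
  have hP := perim_nonneg hE
  have hl0 : 0 < l := by linarith
  have hb : ∀ h, ENNReal.ofReal (K h) * tr E h ≤ ENNReal.ofReal (K h) * tr ((fun x => l⁻¹ • x) ⁻¹' E) h +
      ENNReal.ofReal ((Iic 8).indicator (fun y => |y| ^ (1 - (n:ℝ) - s)) ‖h‖) *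
        ENNReal.ofReal ((l - 1) * perim E) := by
    intro h
    rcases eq_or_ne h 0 with rfl | hh
    · simp [tr_zero]
    have hp : 0 < ‖h‖ := norm_pos_iff.2 hh
    have hlow : tr E (l⁻¹ • h) ≤ tr ((fun x => l⁻¹ • x) ⁻¹' E) h := by
      rw [tr_dil hm (by positivity)]
      refine le_mul_of_one_le_left (zero_le) ?_
      rw [← ENNReal.ofReal_one]
      refine ENNReal.ofReal_le_ofReal ?_
      rw [inv_pow, inv_inv]
      exact one_le_pow₀ hl
    by_cases h1 : ‖h‖ ≤ 8
    · rw [indicator_of_mem (show ‖h‖ ∈ Iic 8 from h1), abs_of_pos hp]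
      have h3 : tr E h ≤ tr E (l⁻¹ • h) + tr E (h - l⁻¹ • h) := by
        have := tr_add_le hm (l⁻¹ • h) (h - l⁻¹ • h)
        simpa using this
      have h4 : tr E (h - l⁻¹ • h) ≤ ENNReal.ofReal (‖h‖ * ((l - 1) * perim E)) := by
        refine (tr_le hE hm hv _).trans (ENNReal.ofReal_le_ofReal ?_)
        rw [← mul_assoc]
        gcongr
        rw [show h - l⁻¹ • h = (1 - l⁻¹) • h by rw [sub_smul, one_smul], norm_smul, mul_comm]
        gcongr
        have : l⁻¹ ≤ 1 := inv_le_one_of_one_le₀ hl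
        rw [Real.norm_of_nonneg (by linarith)]
        have : (1 - l⁻¹) = (l - 1) * l⁻¹ := by field_simp
        rw [this]
        exact mul_le_of_le_one_right (by linarith) ‹_›
      calc ENNReal.ofReal (K h) * tr E h 
          ≤ ENNReal.ofReal (K h) * (tr ((fun x => l⁻¹ • x) ⁻¹' E) h + 
            ENNReal.ofReal (‖h‖ * ((l - 1) * perim E))) := by
            gcongr; exact h3.trans (add_le_add hlow h4)
        _ ≤ _ := by
            rw [mul_add]
            refine add_le_add le_rfl ?_
            rw [ENNReal.ofReal_mul hp.le, ← mul_assoc]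
            gcongr
            rw [← ENNReal.ofReal_mul' hp.le]
            refine ENNReal.ofReal_le_ofReal ?_
            calc K h * ‖h‖ ≤ ‖h‖ ^ (-((n : ℝ) + s)) * ‖h‖ ^ (1:ℝ) := by
                  rw [Real.rpow_one]; gcongr; exact hK h hh
              _ = _ := by rw [← Real.rpow_add hp]; congr 1; ring
    · refine le_trans ?_ le_self_add
      push Not at h1
      gcongr
      refine le_trans (tr_le_two hm h) ?_
      rw [← tr_far hm hsub (h := l⁻¹ • h)]
      · exact hlow
      · rw [norm_smul, Real.norm_of_nonneg (by positivity), inv_mul_eq_div, le_div_iff₀ hl0]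
        nlinarith
  have hm1 : Measurable fun h : Euc n => ENNReal.ofReal ((Iic 8).indicator (fun y => |y| ^ (1 - (n:ℝ) - s)) ‖h‖) := by
    have : Measurable ((Iic (8:ℝ)).indicator (fun y => |y| ^ (1 - (n:ℝ) - s))) :=
      Measurable.indicator (by fun_prop) measurableSet_Iic
    fun_prop
  have hω := ballVol_pos n
  have hs0 : 0 < 1 - s := by linarith [hs.2]
  calc PKl K E ≤ _ := lintegral_mono hb
    _ ≤ _ := by
      rw [lintegral_add_right _ (hm1.mul_const _), lintegral_mul_const _ hm1, radial_near hn hs.2 (by norm_num)]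
      unfold PKl
      gcongr
      rw [← ENNReal.ofReal_mul (by positivity)]
      refine ENNReal.ofReal_le_ofReal ?_
      have : 0 ≤ (l - 1) * perim E := mul_nonneg (by linarith) hP
      gcongr
      calc (8:ℝ) ^ (1 - s) ≤ 8 ^ (1:ℝ) := Real.rpow_le_rpow_of_exponent_le (by norm_num) (by linarith [hs.1])
        _ = 8 := by norm_num

lemma PK_scale {n : ℕ} (K : Euc n → ℝ) (E : Set (Euc n)) {c A : ℝ} (hc : 0 < c) :
    PK (fun x => A * K (c • x)) ((fun x => c • x) ⁻¹' E) = A * (c ^ n)⁻¹ * (c ^ n)⁻¹ * PK K E := by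
  unfold PK
  have h1 : ∀ x y : Euc n, A * K (c • (x - y)) * |chi ((fun x => c • x) ⁻¹' E) x - chi ((fun x => c • x) ⁻¹' E) y|
    = A * (fun x y => K (x - y) * |chi E x - chi E y|) (c • x) (c • y) := by
    intro x y
    rw [smul_sub]; simp only [mul_assoc]; rfl
  have h2 : |(c ^ n)⁻¹| = (c ^ n)⁻¹ := abs_of_pos (by positivity)
  simp_rw [h1, integral_const_mul]
  have h3 : ∀ x : Euc n, ∫ y, (fun x y => K (x - y) * |chi E x - chi E y|) (c • x) (c • y) =
      (c ^ n)⁻¹ * (fun x => ∫ y, K (x - y) * |chi E x - chi E y|) (c • x) := by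
    intro x
    rw [Measure.integral_comp_smul volume (fun y => K (c • x - y) * |chi E (c • x) - chi E y|) c]
    rw [finrank_euclideanSpace_fin, h2, smul_eq_mul]
  simp_rw [h3, integral_const_mul]
  rw [Measure.integral_comp_smul volume (fun x => ∫ y, K (x - y) * |chi E x - chi E y|) c]
  rw [finrank_euclideanSpace_fin, h2, smul_eq_mul]
  ring

def bet (k : ℕ) : ℝ := ∫ x in (0:ℝ)..Real.pi, Real.sin x ^ k

lemma bet_pos (k : ℕ) : 0 < bet k := integral_sin_pow_pos k

lemma bet_formula (k : ℕ) : bet k = Real.sqrt Real.pi * Real.Gamma (((k:ℝ) + 1) / 2) / Real.Gamma ((k:ℝ) / 2 + 1) := by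
  have hpi := Real.pi_pos
  have key : ∀ k : ℕ, bet (k + 2) = ((k:ℝ) + 1) / (k + 2) * bet k := by
    intro k; unfold bet; rw [integral_sin_pow]; simp
  induction k using Nat.twoStepInduction with
  | zero =>
    have h := Real.Gamma_one_half_eq
    rw [one_div] at h
    simp [bet, h, Real.mul_self_sqrt hpi.le]
  | one =>
    have : (1:ℝ)/2 + 1 = 1/2 + 1 := rfl
    simp only [bet, pow_one, integral_sin, Real.cos_zero, Real.cos_pi, Nat.cast_one]
    rw [Real.Gamma_add_one (by norm_num), Real.Gamma_one_half_eq]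
    norm_num
    field_simp
  | more k ih _ =>
    rw [key, ih]
    have e1 : (((k + 2 : ℕ) : ℝ) + 1) / 2 = ((k:ℝ) + 1) / 2 + 1 := by push_cast; ring
    have e2 : ((k + 2 : ℕ) : ℝ) / 2 + 1 = ((k:ℝ) / 2 + 1) + 1 := by push_cast; ring
    rw [e1, e2, Real.Gamma_add_one (s := ((k:ℝ) + 1) / 2) (by positivity),
      Real.Gamma_add_one (s := (k:ℝ) / 2 + 1) (by positivity)]
    have : Real.Gamma ((k:ℝ) / 2 + 1) ≠ 0 := (Real.Gamma_pos_of_pos (by positivity)).ne'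
    generalize Real.Gamma ((k:ℝ) / 2 + 1) = a at *
    generalize Real.Gamma (((k:ℝ) + 1) / 2) = b at *
    field_simp

lemma prod_bet (n : ℕ) (hn : 1 ≤ n) : ∏ k ∈ Finset.range n, bet (n - k) = ballVol n := by
  have : Nonempty (Fin n) := ⟨⟨0, hn⟩⟩
  have h1 : ballVol n = Real.sqrt Real.pi ^ n / Real.Gamma ((n:ℝ) / 2 + 1) := by
    unfold ballVol
    rw [EuclideanSpace.volume_ball]
    simp only [ENNReal.ofReal_one, one_pow, one_mul, Fintype.card_fin]
    rw [ENNReal.toReal_ofReal]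
    have := Real.Gamma_pos_of_pos (show 0 < (n:ℝ)/2+1 by positivity)
    positivity
  have h2 : ∀ n : ℕ, ∏ k ∈ Finset.range n, bet (k + 1) = Real.sqrt Real.pi ^ n / Real.Gamma ((n:ℝ) / 2 + 1) := by
    intro n
    induction n with
    | zero => simp
    | succ n ih =>
      rw [Finset.prod_range_succ, ih, bet_formula]
      have e1 : (((n + 1 : ℕ) : ℝ) + 1) / 2 = (n:ℝ)/2 + 1 := by push_cast; ring
      rw [e1]
      have : Real.Gamma ((n:ℝ) / 2 + 1) ≠ 0 := (Real.Gamma_pos_of_pos (by positivity)).ne'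
      have : Real.Gamma (((n+1:ℕ):ℝ) / 2 + 1) ≠ 0 := (Real.Gamma_pos_of_pos (by positivity)).ne'
      rw [pow_succ]
      field_simp
  rw [h1, ← h2, ← Finset.prod_range_reflect]
  refine Finset.prod_congr rfl fun k hk => ?_
  rw [Finset.mem_range] at hk
  congr 1; omega

lemma exists_Theta (k : ℕ) : ∃ Θ : ℝ → ℝ, (∀ y ∈ Ioo (0:ℝ) 1, Θ y ∈ Ioo 0 Real.pi) ∧
    (∀ y ∈ Ioo (0:ℝ) 1, HasDerivAt Θ (bet k / Real.sin (Θ y) ^ k) y) ∧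
    ContDiffOn ℝ 1 Θ (Ioo 0 1) := by
  set S : ℝ → ℝ := fun θ => (∫ x in (0:ℝ)..θ, Real.sin x ^ k) / bet k with hS
  have hb := bet_pos k
  have hd : ∀ θ, HasDerivAt S (Real.sin θ ^ k / bet k) θ := by
    intro θ
    refine HasDerivAt.div_const ?_ _
    refine intervalIntegral.integral_hasDerivAt_right ?_ ?_ ?_
    · exact Continuous.intervalIntegrable (by fun_prop) _ _
    · exact Continuous.stronglyMeasurableAtFilter (by fun_prop) _ _
    · fun_prop
  have hc : Continuous S := continuous_iff_continuousAt.2 fun θ => (hd θ).continuousAt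
  have hmono : StrictMonoOn S (Icc 0 Real.pi) := by
    refine strictMonoOn_of_deriv_pos (convex_Icc _ _) hc.continuousOn fun x hx => ?_
    rw [interior_Icc] at hx
    rw [(hd x).deriv]
    have := Real.sin_pos_of_mem_Ioo hx
    positivity
  have S0 : S 0 = 0 := by simp [hS]
  have S1 : S Real.pi = 1 := by simp only [hS]; exact div_self hb.ne'
  have hex : ∀ y : ℝ, ∃ θ, y ∈ Ioo (0:ℝ) 1 → θ ∈ Ioo 0 Real.pi ∧ S θ = y := by
    intro y
    by_cases hy : y ∈ Ioo (0:ℝ) 1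
    · have := intermediate_value_Ioo Real.pi_pos.le hc.continuousOn
      rw [S0, S1] at this
      obtain ⟨θ, h1, h2⟩ := this hy
      exact ⟨θ, fun _ => ⟨h1, h2⟩⟩
    · exact ⟨0, fun h => absurd h hy⟩
  choose Θ hΘ using hex
  have hmem : ∀ y ∈ Ioo (0:ℝ) 1, Θ y ∈ Ioo 0 Real.pi := fun y hy => (hΘ y hy).1
  have hinv : ∀ y ∈ Ioo (0:ℝ) 1, S (Θ y) = y := fun y hy => (hΘ y hy).2
  have hSm : ∀ θ ∈ Ioo 0 Real.pi, S θ ∈ Ioo (0:ℝ) 1 := by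
    intro θ hθ
    rw [← S0, ← S1]
    exact ⟨hmono ⟨le_rfl, Real.pi_pos.le⟩ ⟨hθ.1.le, hθ.2.le⟩ hθ.1, hmono ⟨hθ.1.le, hθ.2.le⟩ ⟨Real.pi_pos.le, le_rfl⟩ hθ.2⟩
  have hsm : StrictMonoOn Θ (Ioo 0 1) := by
    intro a ha b hb hab
    rw [← hmono.lt_iff_lt (Ioo_subset_Icc_self (hmem a ha)) (Ioo_subset_Icc_self (hmem b hb)), hinv a ha, hinv b hb]
    exact hab
  have himg : Θ '' (Ioo 0 1) = Ioo 0 Real.pi := by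
    ext θ; constructor
    · rintro ⟨y, hy, rfl⟩; exact hmem y hy
    · intro hθ
      refine ⟨S θ, hSm θ hθ, ?_⟩
      exact hmono.injOn (Ioo_subset_Icc_self (hmem _ (hSm θ hθ))) (Ioo_subset_Icc_self hθ) (hinv _ (hSm θ hθ))
  have hcont : ∀ y ∈ Ioo (0:ℝ) 1, ContinuousAt Θ y := by
    intro y hy
    refine hsm.continuousAt_of_image_mem_nhds (isOpen_Ioo.mem_nhds hy) ?_
    rw [himg]; exact isOpen_Ioo.mem_nhds (hmem y hy)
  have hsin : ∀ y ∈ Ioo (0:ℝ) 1, 0 < Real.sin (Θ y) := fun y hy => Real.sin_pos_of_mem_Ioo (hmem y hy)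
  have hder : ∀ y ∈ Ioo (0:ℝ) 1, HasDerivAt Θ (bet k / Real.sin (Θ y) ^ k) y := by
    intro y hy
    have := hsin y hy
    have h := HasDerivAt.of_local_left_inverse (hcont y hy) (hd (Θ y)) (by positivity)
      (by filter_upwards [isOpen_Ioo.mem_nhds hy] with z hz using hinv z hz)
    rwa [inv_div] at h
  refine ⟨Θ, hmem, hder, ?_⟩
  rw [show (1 : WithTop ℕ∞) = 0 + 1 by simp, contDiffOn_succ_iff_deriv_of_isOpen isOpen_Ioo]
  refine ⟨fun y hy => (hder y hy).differentiableAt.differentiableWithinAt, by simp, ?_⟩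
  rw [contDiffOn_zero]
  refine ContinuousOn.congr (f := fun y => bet k / Real.sin (Θ y) ^ k) ?_ fun y hy => (hder y hy).deriv
  intro y hy
  refine ContinuousAt.continuousWithinAt ?_
  have h1 := hcont y hy
  have h2 := hsin y hy
  refine ContinuousAt.div continuousAt_const ?_ (by positivity)
  exact (Real.continuous_sin.continuousAt.comp h1).pow k

def BC1 {n : ℕ} (f : Euc n → ℝ) : Prop :=
  ContDiff ℝ 1 f ∧ ∃ C : ℝ, 0 ≤ C ∧ ∀ x, |f x| ≤ C ∧ ‖fderiv ℝ f x‖ ≤ C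

lemma BC1.mul {n : ℕ} {f g : Euc n → ℝ} (hf : BC1 f) (hg : BC1 g) : BC1 (fun x => f x * g x) := by
  obtain ⟨hf1, C, hC0, hC⟩ := hf
  obtain ⟨hg1, D, hD0, hD⟩ := hg
  refine ⟨hf1.mul hg1, 2 * C * D, by positivity, fun x => ⟨?_, ?_⟩⟩
  · rw [abs_mul]
    calc |f x| * |g x| ≤ C * D := by gcongr; exacts [(hC x).1, (hD x).1]
      _ ≤ _ := by nlinarith [mul_nonneg hC0 hD0]
  · rw [fderiv_fun_mul (hf1.differentiable (by norm_num) x) (hg1.differentiable (by norm_num) x)]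
    refine (norm_add_le _ _).trans ?_
    rw [norm_smul, norm_smul, Real.norm_eq_abs, Real.norm_eq_abs]
    calc |f x| * ‖fderiv ℝ g x‖ + |g x| * ‖fderiv ℝ f x‖ ≤ C * D + D * C := by
          gcongr; exacts [(hC x).1, (hD x).2, (hD x).1, (hC x).2]
      _ = _ := by ring

lemma BC1.one {n : ℕ} : BC1 (fun _ : Euc n => (1:ℝ)) :=
  ⟨contDiff_const, 1, by norm_num, fun x => by simp⟩

lemma BC1.prod {n : ℕ} {f : ℕ → Euc n → ℝ} (hf : ∀ i, BC1 (f i)) (k : ℕ) :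
    BC1 (fun x => ∏ i ∈ Finset.range k, f i x) := by
  induction k with
  | zero => simpa using BC1.one
  | succ k ih => simpa only [Finset.prod_range_succ] using ih.mul (hf k)

lemma BC1.comp_lin {n : ℕ} {φ : ℝ → ℝ} (hφ : ContDiff ℝ 1 φ) {C : ℝ} (h1 : ∀ t, |φ t| ≤ C)
    (h2 : ∀ t, |deriv φ t| ≤ C) (L : Euc n →L[ℝ] ℝ) : BC1 (fun x => φ (L x)) := by
  have hC : 0 ≤ C := (abs_nonneg _).trans (h1 0)
  refine ⟨hφ.comp L.contDiff, C * (1 + ‖L‖), by positivity, fun x => ⟨?_, ?_⟩⟩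
  · exact (h1 _).trans (by nlinarith [norm_nonneg L])
  · have : HasFDerivAt (fun x => φ (L x)) (deriv φ (L x) • L) x :=
      ((hφ.differentiable (by norm_num) (L x)).hasDerivAt).comp_hasFDerivAt x L.hasFDerivAt
    rw [this.fderiv, norm_smul, Real.norm_eq_abs]
    calc |deriv φ (L x)| * ‖L‖ ≤ C * ‖L‖ := by gcongr; exact h2 _
      _ ≤ _ := by nlinarith

lemma conv_C1 {n : ℕ} {F : Set (Euc n)} (hv : volume F ≠ ∞) {h : Euc n → ℝ} (hh : BC1 h) :
    ContDiff ℝ 1 (fun x => ∫ y in F, h (x - y)) ∧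
    ∀ x v, fderiv ℝ (fun x => ∫ y in F, h (x - y)) x v = ∫ y in F, fderiv ℝ h (x - y) v := by
  obtain ⟨h1, C, hC0, hC⟩ := hh
  have : IsFiniteMeasure (volume.restrict F) := ⟨by simpa using hv.lt_top⟩
  have hc := h1.continuous_fderiv (by norm_num)
  have hint : ∀ x, Integrable (fun y => fderiv ℝ h (x - y)) (volume.restrict F) := fun x =>
    Integrable.of_bound (C := C) ((hc.comp (by fun_prop)).aestronglyMeasurable)
      (Eventually.of_forall fun y => (hC _).2)
  have hd : ∀ x, HasFDerivAt (fun x => ∫ y in F, h (x - y)) (∫ y in F, fderiv ℝ h (x - y)) x := by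
    intro x
    refine hasFDerivAt_integral_of_dominated_of_fderiv_le (F := fun x y => h (x - y))
      (F' := fun x y => fderiv ℝ h (x - y)) (bound := fun _ => C) (univ_mem) ?_ ?_ ?_ ?_ ?_ ?_
    · exact Eventually.of_forall fun t => (h1.continuous.comp (by fun_prop)).aestronglyMeasurable
    · exact Integrable.of_bound (C := C) ((h1.continuous.comp (by fun_prop)).aestronglyMeasurable)
        (Eventually.of_forall fun y => (hC _).1)
    · exact (hint x).1
    · exact Eventually.of_forall fun y x _ => (hC _).2
    · exact integrable_const _
    · refine Eventually.of_forall fun y x _ => ?_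
      have := (h1.differentiable (by norm_num) (x - y)).hasFDerivAt.comp x ((hasFDerivAt_id x).sub_const y)
      simpa [Function.comp_def] using this
  refine ⟨?_, fun x v => ?_⟩
  · rw [contDiff_one_iff_fderiv]
    refine ⟨fun x => (hd x).differentiableAt, ?_⟩
    have : fderiv ℝ (fun x => ∫ y in F, h (x - y)) = fun x => ∫ y in F, fderiv ℝ h (x - y) := by
      ext1 x; exact (hd x).fderiv
    rw [this]
    refine continuous_of_dominated (bound := fun _ => C) (fun x => (hint x).1)
      (fun x => Eventually.of_forall fun y => (hC _).2) (integrable_const _) ?_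
    exact Eventually.of_forall fun y => hc.comp (by fun_prop)
  · rw [(hd x).fderiv]
    exact ContinuousLinearMap.integral_apply (hint x) v

def gs (t : ℝ) : ℝ := Real.sigmoid t * (1 - Real.sigmoid t)

def Ge (ε t : ℝ) : ℝ := Real.sigmoid (ε⁻¹ * t)
def ge (ε t : ℝ) : ℝ := ε⁻¹ * gs (ε⁻¹ * t)

lemma gs_pos (t : ℝ) : 0 < gs t := mul_pos (Real.sigmoid_pos t) (by linarith [Real.sigmoid_lt_one t])

lemma ge_pos {ε : ℝ} (hε : 0 < ε) (t : ℝ) : 0 < ge ε t := mul_pos (by positivity) (gs_pos _)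

lemma Ge_pos (ε t : ℝ) : 0 < Ge ε t := Real.sigmoid_pos _
lemma Ge_lt (ε t : ℝ) : Ge ε t < 1 := Real.sigmoid_lt_one _

lemma gs_contDiff : ContDiff ℝ 1 gs := by
  unfold gs
  have : ContDiff ℝ 1 Real.sigmoid := contDiff_sigmoid.of_le le_top
  fun_prop

lemma gs_deriv (t : ℝ) : HasDerivAt gs (gs t * (1 - 2 * Real.sigmoid t)) t := by
  have := Real.hasDerivAt_sigmoid t
  have h2 := this.mul (this.const_sub 1)
  convert! h2 using 1
  unfold gs; ring

lemma Ge_deriv (ε t : ℝ) : HasDerivAt (Ge ε) (ge ε t) t := by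
  have := (Real.hasDerivAt_sigmoid (ε⁻¹ * t)).comp t ((hasDerivAt_id t).const_mul ε⁻¹)
  convert! this using 1
  simp [ge, gs]; ring

lemma gs_le (t : ℝ) : gs t ≤ 1 := by
  have := Real.sigmoid_pos t; have := Real.sigmoid_lt_one t
  unfold gs; nlinarith

lemma ge_BC1 {n : ℕ} {ε : ℝ} (hε : 0 < ε) (L : Euc n →L[ℝ] ℝ) : BC1 (fun x => ge ε (L x)) := by
  refine BC1.comp_lin (φ := ge ε) (C := ε⁻¹ + ε⁻¹ * ε⁻¹) ?_ ?_ ?_ L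
  · unfold ge
    exact contDiff_const.mul (gs_contDiff.comp (by fun_prop))
  · intro t
    rw [abs_of_pos (ge_pos hε t)]
    have := gs_le (ε⁻¹ * t)
    have h0 : 0 < ε⁻¹ := by positivity
    unfold ge; nlinarith
  · intro t
    have h : HasDerivAt (ge ε) (ε⁻¹ * (gs (ε⁻¹ * t) * (1 - 2 * Real.sigmoid (ε⁻¹ * t)) * (ε⁻¹ * 1))) t :=
      ((gs_deriv (ε⁻¹ * t)).comp t ((hasDerivAt_id t).const_mul ε⁻¹)).const_mul ε⁻¹
    rw [h.deriv]
    have h0 : 0 < ε⁻¹ := by positivity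
    have h1 := gs_le (ε⁻¹ * t)
    have h2 := gs_pos (ε⁻¹ * t)
    have h3 := Real.sigmoid_pos (ε⁻¹ * t); have h4 := Real.sigmoid_lt_one (ε⁻¹ * t)
    have h5 : |gs (ε⁻¹ * t) * (1 - 2 * Real.sigmoid (ε⁻¹ * t))| ≤ 1 := by
      rw [abs_mul, abs_of_pos h2]
      refine mul_le_one₀ h1 (abs_nonneg _) ?_
      rw [abs_le]; constructor <;> linarith
    rw [abs_mul, abs_mul, mul_one, abs_of_pos h0]
    nlinarith [mul_pos h0 h0]

lemma Ge_BC1 {n : ℕ} {ε : ℝ} (hε : 0 < ε) (L : Euc n →L[ℝ] ℝ) : BC1 (fun x => Ge ε (L x)) := by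
  have h0 : 0 < ε⁻¹ := by positivity
  refine BC1.comp_lin (φ := Ge ε) (C := 1 + ε⁻¹) ?_ ?_ ?_ L
  · unfold Ge
    have : ContDiff ℝ 1 Real.sigmoid := contDiff_sigmoid.of_le le_top
    exact this.comp (by fun_prop)
  · intro t
    rw [abs_of_pos (Ge_pos ε t)]
    linarith [Ge_lt ε t]
  · intro t
    rw [(Ge_deriv ε t).deriv, abs_of_pos (ge_pos hε t)]
    have := gs_le (ε⁻¹ * t)
    unfold ge; nlinarith

def co {n : ℕ} (i : ℕ) : Euc n →L[ℝ] ℝ := if h : i < n then EuclideanSpace.proj ⟨i, h⟩ else 0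

lemma co_fin {n : ℕ} (i : Fin n) (x : Euc n) : co (i : ℕ) x = x i := by
  simp [co]

def hk {n : ℕ} (ε : ℝ) (k : ℕ) (z : Euc n) : ℝ := ∏ j ∈ Finset.range k, ge ε (co j z)
def nk {n : ℕ} (ε : ℝ) (k : ℕ) (z : Euc n) : ℝ := hk ε k z * Ge ε (co k z)

lemma hk_BC1 {n : ℕ} {ε : ℝ} (hε : 0 < ε) (k : ℕ) : BC1 (hk (n := n) ε k) :=
  BC1.prod (fun i => ge_BC1 hε (co i)) k

lemma nk_BC1 {n : ℕ} {ε : ℝ} (hε : 0 < ε) (k : ℕ) : BC1 (nk (n := n) ε k) :=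
  (hk_BC1 hε k).mul (Ge_BC1 hε (co k))

lemma hk_pos {n : ℕ} {ε : ℝ} (hε : 0 < ε) (k : ℕ) (z : Euc n) : 0 < hk ε k z :=
  Finset.prod_pos fun _ _ => ge_pos hε _

lemma co_single_ne {n : ℕ} {j : ℕ} {i : Fin n} (h : j ≠ i) (z : Euc n) (t : ℝ) :
    co j (z + t • EuclideanSpace.single i (1:ℝ)) = co j z := by
  unfold co
  split_ifs with hj
  · have : (⟨j, hj⟩ : Fin n) ≠ i := fun h' => h (by rw [← h'])
    simp [Pi.single_apply, this]
  · simp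

lemma co_single_eq {n : ℕ} (i : Fin n) (z : Euc n) (t : ℝ) :
    co i (z + t • EuclideanSpace.single i (1:ℝ)) = co i z + t := by
  simp [co]

lemma hk_line {n : ℕ} {ε : ℝ} {k : ℕ} {i : Fin n} (hk' : k ≤ i) (z : Euc n) (t : ℝ) :
    hk ε k (z + t • EuclideanSpace.single i (1:ℝ)) = hk ε k z := by
  unfold hk
  refine Finset.prod_congr rfl fun j hj => ?_
  rw [Finset.mem_range] at hj
  rw [co_single_ne (by omega)]

lemma nk_line {n : ℕ} {ε : ℝ} {k : ℕ} {i : Fin n} (hk' : k < i) (z : Euc n) (t : ℝ) :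
    nk ε k (z + t • EuclideanSpace.single i (1:ℝ)) = nk ε k z := by
  unfold nk
  rw [hk_line hk'.le, co_single_ne (by omega)]

lemma nk_deriv {n : ℕ} {ε : ℝ} (hε : 0 < ε) (i : Fin n) (z : Euc n) :
    fderiv ℝ (nk ε i) z (EuclideanSpace.single i (1:ℝ)) = hk ε (i + 1) z := by
  have h1 : HasDerivAt (fun t : ℝ => nk ε i (z + t • EuclideanSpace.single i (1:ℝ)))
      (fderiv ℝ (nk ε i) z (EuclideanSpace.single i (1:ℝ))) 0 := by
    have h2 : HasDerivAt (fun t : ℝ => z + t • EuclideanSpace.single i (1:ℝ)) (EuclideanSpace.single i (1:ℝ)) 0 := by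
      simpa using ((hasDerivAt_id (0:ℝ)).smul_const (EuclideanSpace.single i (1:ℝ))).const_add z
    have h3 := ((nk_BC1 (n := n) hε i).1.differentiable (by norm_num) z).hasFDerivAt
    exact HasFDerivAt.comp_hasDerivAt_of_eq 0 h3 h2 (by simp)
  have h4 : HasDerivAt (fun t : ℝ => nk ε i (z + t • EuclideanSpace.single i (1:ℝ)))
      (hk ε i z * ge ε (co i z)) 0 := by
    unfold nk
    simp_rw [hk_line (le_refl (i:ℕ)), co_single_eq]
    refine HasDerivAt.const_mul _ ?_
    have := HasDerivAt.comp_const_add (co i z) 0 (Ge_deriv ε (co (i:ℕ) z + 0))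
    simpa using this
  rw [h1.unique h4, hk, hk, Finset.prod_range_succ]

lemma gs_neg (t : ℝ) : gs (-t) = gs t := by
  unfold gs; rw [Real.sigmoid_neg]; ring

lemma gs_integral : ∫ t, gs t = 1 := by
  have hd : ∀ t, HasDerivAt Real.sigmoid (gs t) t := fun t => Real.hasDerivAt_sigmoid t
  have h1 : IntegrableOn gs (Ioi 0) := integrableOn_Ioi_deriv_of_nonneg' (fun x _ => hd x)
    (fun x _ => (gs_pos x).le) Real.tendsto_sigmoid_atTop
  have h2 : IntegrableOn gs (Iio 0) := by
    have := IntegrableOn.comp_neg_Iio (c := 0) (f := gs) (by simpa using h1)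
    simpa [gs_neg] using this
  have h3 : Integrable gs := by
    rw [← integrableOn_univ, ← Set.Iic_union_Ioi (a := (0:ℝ))]
    exact ((integrableOn_Iic_iff_integrableOn_Iio (by simp)).2 h2).union h1
  rw [integral_of_hasDerivAt_of_tendsto hd h3 Real.tendsto_sigmoid_atBot Real.tendsto_sigmoid_atTop]
  norm_num

lemma hk_eq {n : ℕ} (ε : ℝ) (z : Euc n) : hk ε n z = ∏ j : Fin n, ge ε (z j) := by
  unfold hk
  rw [← Fin.prod_univ_eq_prod_range (fun j => ge ε (co j z)) n]
  simp_rw [co_fin]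

lemma hk_integral {n : ℕ} : ∫ z : Euc n, hk 1 n z = 1 := by
  simp_rw [hk_eq]
  rw [← (PiLp.volume_preserving_toLp (Fin n)).integral_comp (MeasurableEquiv.toLp 2 (Fin n → ℝ)).measurableEmbedding]
  have := integral_fintype_prod_volume_eq_prod (ι := Fin n) (E := fun _ => ℝ) (fun _ => ge 1)
  rw [this]
  simp [ge, gs_integral]

lemma hk_continuous {n : ℕ} {ε : ℝ} (hε : 0 < ε) (k : ℕ) : Continuous (hk (n := n) ε k) :=
  (hk_BC1 hε k).1.continuous

lemma hk_lintegral {n : ℕ} : ∫⁻ z : Euc n, ENNReal.ofReal (hk 1 n z) = 1 := by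
  rw [← ofReal_integral_eq_lintegral_ofReal (integrable_of_integral_eq_one hk_integral)
    (Eventually.of_forall fun z => (hk_pos one_pos _ _).le), hk_integral]
  simp

lemma hk_scale {n : ℕ} {ε : ℝ} (hε : 0 < ε) {f : Euc n → ℝ≥0∞} (hf : Measurable f) :
    ∫⁻ z, ENNReal.ofReal (hk ε n z) * f z = ∫⁻ w, ENNReal.ofReal (hk 1 n w) * f (ε • w) := by
  have h1 : ∀ z : Euc n, hk ε n z = (ε ^ n)⁻¹ * hk 1 n (ε⁻¹ • z) := by
    intro z
    simp_rw [hk_eq, ge]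
    rw [Finset.prod_mul_distrib, Finset.prod_mul_distrib]
    simp
  have hm : Measurable fun z : Euc n => ENNReal.ofReal (hk 1 n (ε⁻¹ • z)) * f z := by
    have := (hk_continuous (n := n) one_pos n).measurable
    fun_prop
  have h2 := lintegral_map (μ := (volume : Measure (Euc n))) hm (measurable_const_smul ε)
  rw [Measure.map_addHaar_smul _ hε.ne', lintegral_smul_measure] at h2
  simp only [inv_smul_smul₀ hε.ne'] at h2
  rw [← h2, finrank_euclideanSpace_fin, abs_of_pos (by positivity), smul_eq_mul,
    ← lintegral_const_mul _ hm]
  congr 1; ext z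
  rw [h1, ENNReal.ofReal_mul (by positivity), mul_assoc]

lemma tr_tendsto {n : ℕ} {F : Set (Euc n)} (hF : MeasurableSet F) (hv : volume F ≠ ∞) :
    Tendsto (tr F) (𝓝 0) (𝓝 0) := by
  have h := tendsto_measure_symmDiff_preimage_nhds_zero (μ := (volume : Measure (Euc n)))
    (ν := (volume : Measure (Euc n))) (l := 𝓝 (0 : Euc n))
    (f := fun h => (⟨fun x => x - h, by fun_prop⟩ : C(Euc n, Euc n)))
    (g := ⟨fun x => x, continuous_id⟩) (s := F) ?_ ?_ ?_ hF.nullMeasurableSet hv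
  · refine h.congr fun v => ?_
    rw [tr_eq hF, ← measure_symmDiff_eq _ _]
    · rw [symmDiff_comm]; rfl
    · exact hF.nullMeasurableSet
    · exact (((measurable_sub_const v) hF : MeasurableSet {x | x - v ∈ F})).nullMeasurableSet
  · have hc : Continuous (fun p : Euc n × Euc n => p.2 - p.1) := by fun_prop
    have := (ContinuousMap.curry ⟨_, hc⟩).continuous.tendsto (0 : Euc n)
    convert! this using 2
    ext x; simp
  · refine Eventually.of_forall fun v => ?_
    exact measurePreserving_sub_right volume v
  · exact MeasurePreserving.id _

lemma moll {n : ℕ} {F : Set (Euc n)} (hF : MeasurableSet F) (hv : volume F ≠ ∞) {κ : ℝ} (hκ : 0 < κ) :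
    ∃ ε : ℝ, 0 < ε ∧ (∀ x, ∫ y in F, hk ε n (x - y) ≤ 1) ∧
      ∫ x in F, (1 - ∫ y in F, hk ε n (x - y)) ≤ κ := by
  have hfin : IsFiniteMeasure (volume.restrict F) := ⟨by simpa using hv.lt_top⟩
  have htrm := tr_measurable hF
  have hq : Measurable fun w : Euc n => ENNReal.ofReal (hk 1 n w) := by
    have := (hk_continuous (n := n) one_pos n).measurable
    fun_prop
  have hlim : Tendsto (fun ε : ℝ => ∫⁻ w : Euc n, ENNReal.ofReal (hk 1 n w) * tr F (ε • w)) (𝓝 0) (𝓝 0) := by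
    have := tendsto_lintegral_filter_of_dominated_convergence (μ := (volume : Measure (Euc n)))
      (l := 𝓝 (0:ℝ)) (F := fun (ε : ℝ) w => ENNReal.ofReal (hk 1 n w) * tr F (ε • w)) (f := fun _ => 0)
      (fun w => ENNReal.ofReal (hk 1 n w) * (2 * volume F)) ?_ ?_ ?_ ?_
    · simpa using this
    · exact Eventually.of_forall fun ε => by fun_prop
    · refine Eventually.of_forall fun ε => Eventually.of_forall fun w => ?_
      gcongr; exact tr_le_two hF _
    · rw [lintegral_mul_const _ hq, hk_lintegral, one_mul]
      exact ENNReal.mul_ne_top (by simp) hv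
    · refine Eventually.of_forall fun w => ?_
      have h1 : Tendsto (fun ε : ℝ => ε • w) (𝓝 0) (𝓝 0) := by
        have : Continuous fun ε : ℝ => ε • w := by fun_prop
        simpa using this.tendsto 0
      have h2 := (tr_tendsto hF hv).comp h1
      have := ENNReal.Tendsto.const_mul (a := ENNReal.ofReal (hk 1 n w)) h2 (Or.inr ENNReal.ofReal_ne_top)
      simpa using this
  have hev : ∀ᶠ ε : ℝ in 𝓝 0, ∫⁻ w : Euc n, ENNReal.ofReal (hk 1 n w) * tr F (ε • w) < ENNReal.ofReal κ :=
    hlim.eventually_lt_const (by simpa using hκ)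
  obtain ⟨ε, h1, hε⟩ := ((hev.filter_mono nhdsWithin_le_nhds).and (self_mem_nhdsWithin : Ioi (0:ℝ) ∈ 𝓝[>] (0:ℝ))).exists
  have hε : 0 < ε := hε
  rw [← hk_scale hε htrm] at h1
  have hqc := hk_continuous (n := n) hε n
  have hqε : Measurable fun w : Euc n => ENNReal.ofReal (hk ε n w) := by
    have := hqc.measurable
    fun_prop
  have htot : ∀ x : Euc n, ∫⁻ y, ENNReal.ofReal (hk ε n (x - y)) = 1 := by
    intro x
    rw [lintegral_sub_left_eq_self (fun y => ENNReal.ofReal (hk ε n y)) x]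
    have := hk_scale hε (f := fun _ : Euc n => 1) measurable_const
    simpa [hk_lintegral] using this
  have hint : ∀ x : Euc n, Integrable (fun y => hk ε n (x - y)) := by
    intro x
    refine ⟨(hqc.comp (by fun_prop)).aestronglyMeasurable, ?_⟩
    rw [hasFiniteIntegral_iff_ofReal (Eventually.of_forall fun y => (hk_pos hε _ _).le), htot]
    simp
  have hrho : ∀ x : Euc n, ENNReal.ofReal (∫ y in F, hk ε n (x - y)) = ∫⁻ y in F, ENNReal.ofReal (hk ε n (x - y)) := by
    intro x
    exact ofReal_integral_eq_lintegral_ofReal (hint x).integrableOn (Eventually.of_forall fun y => (hk_pos hε _ _).le)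
  have hle : ∀ x, ∫ y in F, hk ε n (x - y) ≤ 1 := by
    intro x
    rw [← ENNReal.ofReal_le_one, hrho, ← htot x]
    exact setLIntegral_le_lintegral _ _
  refine ⟨ε, hε, hle, ?_⟩
  have hρc : Continuous fun x => ∫ y in F, hk ε n (x - y) := (conv_C1 hv (hk_BC1 hε n)).1.continuous
  have h0 : ∀ x, 0 ≤ 1 - ∫ y in F, hk ε n (x - y) := fun x => by linarith [hle x]
  rw [integral_eq_lintegral_of_nonneg_ae (Eventually.of_forall h0) (continuous_const.sub hρc).aestronglyMeasurable]
  refine ENNReal.toReal_le_of_le_ofReal hκ.le (le_trans ?_ h1.le)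
  have h4 : ∀ x, ENNReal.ofReal (1 - ∫ y in F, hk ε n (x - y)) = 
      ∫⁻ z, ENNReal.ofReal (hk ε n z) * {z | x - z ∉ F}.indicator 1 z := by
    intro x
    have h5 : ∫⁻ y in Fᶜ, ENNReal.ofReal (hk ε n (x - y)) = ENNReal.ofReal (1 - ∫ y in F, hk ε n (x - y)) := by
      rw [ENNReal.ofReal_sub _ (integral_nonneg fun y => (hk_pos hε _ _).le), hrho, ENNReal.ofReal_one, ← htot x]
      have h6 := lintegral_add_compl (μ := (volume : Measure (Euc n))) (fun y => ENNReal.ofReal (hk ε n (x - y))) hF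
      rw [← h6, ENNReal.add_sub_cancel_left]
      rw [← hrho]; exact ENNReal.ofReal_ne_top
    rw [← h5, ← lintegral_indicator hF.compl, ← lintegral_sub_left_eq_self _ x]
    congr 1; ext z
    by_cases hz : x - z ∈ F <;> simp [indicator, hz]
  simp_rw [h4]
  have hmS : Measurable fun p : Euc n × Euc n => ({z : Euc n | p.1 - z ∉ F}.indicator 1 p.2 : ℝ≥0∞) := by
    have : MeasurableSet {p : Euc n × Euc n | p.1 - p.2 ∉ F} := by
      have h : Measurable fun p : Euc n × Euc n => p.1 - p.2 := by fun_prop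
      exact h hF.compl
    have h7 : (fun p : Euc n × Euc n => ({z : Euc n | p.1 - z ∉ F}.indicator 1 p.2 : ℝ≥0∞)) =
      {p : Euc n × Euc n | p.1 - p.2 ∉ F}.indicator 1 := by
      ext p; simp [indicator]
    rw [h7]; exact measurable_one.indicator this
  rw [lintegral_lintegral_swap ((hqε.comp measurable_snd).mul hmS).aemeasurable]
  refine lintegral_mono fun z => ?_
  have hmz : Measurable fun x : Euc n => ({z : Euc n | x - z ∉ F}.indicator 1 z : ℝ≥0∞) :=
    hmS.comp (measurable_id.prodMk measurable_const)
  rw [lintegral_const_mul _ hmz]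
  gcongr
  have hms : MeasurableSet {x : Euc n | x - z ∉ F} := (measurable_sub_const z) hF.compl
  have h8 : (fun x => ({z : Euc n | x - z ∉ F}.indicator 1 z : ℝ≥0∞)) = {x : Euc n | x - z ∉ F}.indicator 1 := by
    ext x; simp [indicator]
  rw [h8, lintegral_indicator_one hms, Measure.restrict_apply hms, tr_eq hF]
  refine le_trans (measure_mono ?_) le_self_add
  rintro x ⟨h9, h10⟩
  exact ⟨h10, h9⟩

lemma prod_tri (s : ℕ → ℝ) (n : ℕ) :
    ∏ i ∈ Finset.range n, ∏ j ∈ Finset.range (i + 1), s j = ∏ i ∈ Finset.range n, s i ^ (n - i) := by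
  induction n with
  | zero => simp
  | succ n ih =>
    rw [Finset.prod_range_succ, ih]
    have : ∏ i ∈ Finset.range (n + 1), s i ^ (n + 1 - i) = ∏ i ∈ Finset.range (n + 1), (s i ^ (n - i) * s i) := by
      refine Finset.prod_congr rfl fun i hi => ?_
      rw [Finset.mem_range] at hi
      rw [← pow_succ]; congr 1; omega
    rw [this, Finset.prod_mul_distrib, Finset.prod_range_succ (fun i => s i ^ (n - i))]
    simp

lemma line_hasDerivAt {n : ℕ} {f : Euc n → ℝ} (hf : ContDiff ℝ 1 f) (x v : Euc n) :
    HasDerivAt (fun t : ℝ => f (x + t • v)) (fderiv ℝ f x v) 0 := by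
  have h2 : HasDerivAt (fun t : ℝ => x + t • v) v 0 := by
    simpa using ((hasDerivAt_id (0:ℝ)).smul_const v).const_add x
  exact HasFDerivAt.comp_hasDerivAt_of_eq 0 (hf.differentiable (by norm_num) x).hasFDerivAt h2 (by simp)

set_option maxHeartbeats 1000000 in
lemma calib {n : ℕ} (hn : 1 ≤ n) {F : Set (Euc n)} (hF : MeasurableSet F) (hv : volume F ≠ ∞)
    (hv0 : volume F ≠ 0) {κ : ℝ} (hκ : 0 < κ) :
    ∃ (T : Euc n → Euc n) (ρ : Euc n → ℝ) (τ : ℝ → ℝ), ContDiff ℝ 1 T ∧ (∀ x, ‖T x‖ ≤ 1) ∧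
      Continuous ρ ∧ (∀ x, 0 ≤ ρ x ∧ ρ x ≤ 1) ∧ (∫ x in F, (1 - ρ x)) ≤ κ ∧
      (∀ x i, 0 ≤ fderiv ℝ T x (EuclideanSpace.single i 1) i) ∧
      (∀ x, ∏ i, fderiv ℝ T x (EuclideanSpace.single i 1) i = ballVol n / volume.real F * ρ x) ∧
      ContDiff ℝ 1 τ ∧ (∀ x, T x ⟨0, hn⟩ = τ (x ⟨0, hn⟩)) := by
  obtain ⟨ε, hε, hρ1, hρ2⟩ := moll hF hv hκ
  have hfin : IsFiniteMeasure (volume.restrict F) := ⟨by simpa using hv.lt_top⟩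
  set A : ℕ → Euc n → ℝ := fun k x => ∫ y in F, hk ε k (x - y) with hA
  set N : ℕ → Euc n → ℝ := fun k x => ∫ y in F, nk ε k (x - y) with hN
  have bint : ∀ h : Euc n → ℝ, BC1 h → ∀ x, IntegrableOn (fun y => h (x - y)) F := by
    rintro h ⟨h1, C, hC0, hC⟩ x
    exact Integrable.of_bound (C := C) ((h1.continuous.comp (by fun_prop)).aestronglyMeasurable)
        (Eventually.of_forall fun y => (hC _).1)
  have pos_int : ∀ f : Euc n → ℝ, IntegrableOn f F → (∀ x, 0 < f x) → 0 < ∫ y in F, f y := by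
    intro f hf hpos
    rw [setIntegral_pos_iff_support_of_nonneg_ae (Eventually.of_forall fun x => (hpos x).le) hf]
    have : Function.support f = univ := by ext x; simp [(hpos x).ne']
    rw [this, univ_inter]; exact pos_iff_ne_zero.2 hv0
  have hA1 : ∀ k, ContDiff ℝ 1 (A k) := fun k => (conv_C1 hv (hk_BC1 hε k)).1
  have hN1 : ∀ k, ContDiff ℝ 1 (N k) := fun k => (conv_C1 hv (nk_BC1 hε k)).1
  have hA0 : ∀ k x, 0 < A k x := fun k x => pos_int _ (bint _ (hk_BC1 hε k) x) fun y => hk_pos hε _ _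
  have hN0 : ∀ k x, 0 < N k x := fun k x => pos_int _ (bint _ (nk_BC1 hε k) x) fun y =>
    mul_pos (hk_pos hε _ _) (Ge_pos _ _)
  have hNA : ∀ k x, N k x < A k x := by
    intro k x
    have h1 := bint _ (hk_BC1 hε k) x
    have h2 := bint _ (nk_BC1 hε k) x
    have := pos_int _ (h1.sub h2) fun y => by
      have := hk_pos hε k (x - y)
      have := Ge_lt ε (co k (x - y))
      simp only [nk, Pi.sub_apply]
      nlinarith
    simp only [Pi.sub_apply] at this
    rw [integral_sub h1 h2] at this
    linarith
  choose Θ hΘ1 hΘ2 hΘ3 using exists_Theta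
  set R : ℕ → Euc n → ℝ := fun k x => N k x / A k x with hR
  have hRm : ∀ k x, R k x ∈ Ioo (0:ℝ) 1 := fun k x =>
    ⟨div_pos (hN0 k x) (hA0 k x), (div_lt_one (hA0 k x)).2 (hNA k x)⟩
  have hR1 : ∀ k, ContDiff ℝ 1 (R k) := fun k => (hN1 k).div (hA1 k) fun x => (hA0 k x).ne'
  set θ : ℕ → Euc n → ℝ := fun k x => Θ (n - k) (R k x) with hθ
  have hθ1 : ∀ k, ContDiff ℝ 1 (θ k) := fun k => (hΘ3 (n - k)).comp_contDiff (hR1 k) (hRm k)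
  have hsin : ∀ k x, 0 < Real.sin (θ k x) := fun k x => Real.sin_pos_of_mem_Ioo (hΘ1 _ _ (hRm k x))
  set Tc : ℕ → Euc n → ℝ := fun k x => (∏ j ∈ Finset.range k, Real.sin (θ j x)) * (-Real.cos (θ k x)) with hTc
  have hTc1 : ∀ k, ContDiff ℝ 1 (Tc k) := by
    intro k
    refine ContDiff.mul ?_ ?_
    · exact contDiff_prod fun j _ => Real.contDiff_sin.comp (hθ1 j)
    · exact (Real.contDiff_cos.comp (hθ1 k)).neg
  set T : Euc n → Euc n := fun x => WithLp.toLp 2 (fun i : Fin n => Tc i x) with hT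
  have hT1 : ContDiff ℝ 1 T := by
    rw [contDiff_euclidean]; intro i; exact hTc1 i
  have hline : ∀ (k : ℕ) (i : Fin n), k < i → ∀ x (t : ℝ), θ k (x + t • EuclideanSpace.single i (1:ℝ)) = θ k x := by
    intro k i hki x t
    have e : ∀ y : Euc n, x + t • EuclideanSpace.single i (1:ℝ) - y = (x - y) + t • EuclideanSpace.single i (1:ℝ) := by
      intro y; abel
    simp only [hθ, hR, hN, hA, e, hk_line hki.le, nk_line hki]
  have hAline : ∀ (i : Fin n), ∀ x (t : ℝ), A i (x + t • EuclideanSpace.single i (1:ℝ)) = A i x := by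
    intro i x t
    have e : ∀ y : Euc n, x + t • EuclideanSpace.single i (1:ℝ) - y = (x - y) + t • EuclideanSpace.single i (1:ℝ) := by
      intro y; abel
    simp only [hA, e, hk_line le_rfl]
  have hder : ∀ x (i : Fin n), fderiv ℝ T x (EuclideanSpace.single i 1) i =
      (∏ j ∈ Finset.range (i + 1), Real.sin (θ j x)) * (bet (n - i) / Real.sin (θ i x) ^ (n - (i:ℕ)))
        * (A (i + 1) x / A i x) := by
    intro x i
    have h1 : HasDerivAt (fun t : ℝ => Tc i (x + t • EuclideanSpace.single i (1:ℝ)))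
        (fderiv ℝ T x (EuclideanSpace.single i 1) i) 0 := by
      have h3 : fderiv ℝ (Tc i) x (EuclideanSpace.single i 1) = fderiv ℝ T x (EuclideanSpace.single i 1) i := by
        have h4 : HasFDerivAt (Tc i) ((EuclideanSpace.proj i : Euc n →L[ℝ] ℝ).comp (fderiv ℝ T x)) x :=
          ((EuclideanSpace.proj i : Euc n →L[ℝ] ℝ).hasFDerivAt).comp x
            (hT1.differentiable (by norm_num) x).hasFDerivAt
        rw [h4.fderiv]; rfl
      rw [← h3]; exact line_hasDerivAt (hTc1 i) x _
    have h5 : HasDerivAt (fun t : ℝ => N i (x + t • EuclideanSpace.single i (1:ℝ))) (A (i + 1) x) 0 := by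
      have := line_hasDerivAt (hN1 i) x (EuclideanSpace.single i (1:ℝ))
      convert! this using 1
      rw [(conv_C1 hv (nk_BC1 hε i)).2]
      simp only [hA, nk_deriv hε]
    have h6 : HasDerivAt (fun t : ℝ => Tc i (x + t • EuclideanSpace.single i (1:ℝ)))
        ((∏ j ∈ Finset.range i, Real.sin (θ j x)) * (-(-Real.sin (θ i x) * (bet (n - i) / Real.sin (θ i x) ^ (n - (i:ℕ)) *
          (A (i + 1) x / A i x))))) 0 := by
      have e1 : ∀ t : ℝ, (∏ j ∈ Finset.range i, Real.sin (θ j (x + t • EuclideanSpace.single i (1:ℝ)))) =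
          ∏ j ∈ Finset.range i, Real.sin (θ j x) := by
        intro t; refine Finset.prod_congr rfl fun j hj => ?_
        rw [hline j i (Finset.mem_range.1 hj)]
      simp only [hTc, e1]
      refine HasDerivAt.const_mul _ (HasDerivAt.neg ?_)
      have h7 : HasDerivAt (fun t : ℝ => R i (x + t • EuclideanSpace.single i (1:ℝ))) (A (i + 1) x / A i x) 0 := by
        simp only [hR, hAline]
        exact h5.div_const _
      have h8 : HasDerivAt (fun t : ℝ => θ i (x + t • EuclideanSpace.single i (1:ℝ)))
          (bet (n - i) / Real.sin (θ i x) ^ (n - (i:ℕ)) * (A (i + 1) x / A i x)) 0 := by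
        refine HasDerivAt.comp_of_eq (h₂ := Θ (n - i)) 0 (hΘ2 (n - i) (R i x) (hRm i x)) h7 (by simp)
      exact (Real.hasDerivAt_cos (θ i x)).comp_of_eq 0 h8 (by simp)
    rw [h1.unique h6, Finset.prod_range_succ]; ring
  have hAn : ∀ x, A n x = ∫ y in F, hk ε n (x - y) := fun x => rfl
  have hTsum : ∀ x m, ∑ k ∈ Finset.range m, Tc k x ^ 2 = 1 - ∏ j ∈ Finset.range m, Real.sin (θ j x) ^ 2 := by
    intro x m
    induction m with
    | zero => simp
    | succ m ih =>
      rw [Finset.sum_range_succ, ih, Finset.prod_range_succ]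
      simp only [hTc, mul_pow, neg_sq, Finset.prod_pow]
      rw [Real.cos_sq']; ring
  have hτ : ContDiff ℝ 1 (fun t : ℝ => Tc 0 (t • EuclideanSpace.single (⟨0, hn⟩ : Fin n) (1:ℝ))) := by
    have h1 : ContDiff ℝ 1 (fun t : ℝ => (t • EuclideanSpace.single (⟨0, hn⟩ : Fin n) (1:ℝ) : Euc n)) :=
      contDiff_id.smul contDiff_const
    have h2 := hTc1 0
    clear_value Tc
    exact h2.comp h1
  refine ⟨T, A n, fun t => Tc 0 (t • EuclideanSpace.single ⟨0, hn⟩ 1), hT1, ?_, (hA1 n).continuous,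
    fun x => ⟨(hA0 n x).le, hρ1 x⟩, hρ2, ?_, ?_, ?_, ?_⟩
  · intro x
    have h1 : ‖T x‖ ^ 2 ≤ 1 := by
      rw [EuclideanSpace.real_norm_sq_eq]
      have : ∑ i : Fin n, T x i ^ 2 = ∑ k ∈ Finset.range n, Tc k x ^ 2 := by
        rw [← Fin.sum_univ_eq_sum_range (fun k => Tc k x ^ 2)]
      rw [this, hTsum]
      have : 0 ≤ ∏ j ∈ Finset.range n, Real.sin (θ j x) ^ 2 := by positivity
      linarith
    nlinarith [norm_nonneg (T x)]
  · intro x i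
    rw [hder]
    have h1 := hsin i x
    have h2 := bet_pos (n - i)
    have h3 : 0 < ∏ j ∈ Finset.range (i + 1), Real.sin (θ j x) := Finset.prod_pos fun j _ => hsin j x
    exact (mul_pos (mul_pos h3 (div_pos h2 (pow_pos h1 _))) (div_pos (hA0 (i+1) x) (hA0 i x))).le
  · intro x
    have hdiv : ∏ i ∈ Finset.range n, A (i + 1) x / A i x = A n x / A 0 x := by
      have : ∀ m, ∏ i ∈ Finset.range m, A (i + 1) x / A i x = A m x / A 0 x := by
        intro m
        induction m with
        | zero => rw [Finset.prod_range_zero, div_self (hA0 0 x).ne']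
        | succ m ih =>
          rw [Finset.prod_range_succ, ih]
          have := (hA0 m x).ne'
          have := (hA0 0 x).ne'
          field_simp
      exact this n
    simp_rw [hder]
    rw [Fin.prod_univ_eq_prod_range (fun i => (∏ j ∈ Finset.range (i + 1), Real.sin (θ j x)) *
      (bet (n - i) / Real.sin (θ i x) ^ (n - i)) * (A (i + 1) x / A i x)) n]
    rw [Finset.prod_mul_distrib, Finset.prod_mul_distrib, prod_tri (fun j => Real.sin (θ j x)),
      hdiv, Finset.prod_div_distrib, prod_bet n hn]
    have h0 : A 0 x = volume.real F := by simp [hA, hk]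
    have h1 : ∏ i ∈ Finset.range n, Real.sin (θ i x) ^ (n - i) ≠ 0 :=
      (Finset.prod_pos fun j _ => pow_pos (hsin j x) _).ne'
    rw [h0]; field_simp
  · exact hτ
  · intro x
    show Tc 0 x = Tc 0 _
    have hc : ∀ y : Euc n, co 0 (x - y) = co 0 (x ⟨0, hn⟩ • EuclideanSpace.single ⟨0, hn⟩ 1 - y) := by
      intro y
      have h0 : 0 < n := hn
      simp [co, h0]
    simp only [hTc, hθ, hR, hN, hA, nk, hk, Finset.range_zero, Finset.prod_empty, hc]

lemma test_nc {n : ℕ} {F : Set (Euc n)} (hF : HasFinitePerim F) (hv : volume F ≠ ∞)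
    {g : Euc n → Euc n} (hg : ContDiff ℝ 1 g) (h1 : ∀ x, ‖g x‖ ≤ 1) {q : Euc n → ℝ}
    (hq : IntegrableOn q F) (hle : ∀ x, q x ≤ divg g x) : ∫ x in F, q x ≤ perim F := by
  have hfin : IsFiniteMeasure (volume.restrict F) := ⟨by simpa using hv.lt_top⟩
  let f : ContDiffBump (0 : Euc n) := ⟨1, 2, one_pos, one_lt_two⟩
  have hf1 : ContDiff ℝ 1 f := f.contDiff
  obtain ⟨C, hC⟩ : ∃ C, ∀ x, ‖fderiv ℝ f x‖ ≤ C :=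
    (hf1.continuous_fderiv (by norm_num)).bounded_above_of_compact_support
      (f.hasCompactSupport.fderiv (𝕜 := ℝ))
  have hC0 : 0 ≤ C := (norm_nonneg _).trans (hC 0)
  have step : ∀ k : ℕ, ∫ x in F, f (((k:ℝ)+1)⁻¹ • x) * q x ≤
      perim F + C * ((k:ℝ)+1)⁻¹ * volume.real F := by
    intro k
    have hk : (0:ℝ) < ((k:ℝ)+1)⁻¹ := by positivity
    set r : ℝ := ((k:ℝ)+1)⁻¹ with hr
    have hlin : ContDiff ℝ 1 (fun x : Euc n => r • x) := contDiff_const_smul r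
    set χ : Euc n → ℝ := fun x => f (r • x) with hχ
    have hχ1 : ContDiff ℝ 1 χ := hf1.comp hlin
    have hχc : HasCompactSupport χ := f.hasCompactSupport.comp_smul hk.ne'
    have hχd : ∀ x v, |fderiv ℝ χ x v| ≤ C * r * ‖v‖ := by
      intro x v
      have h2 : HasFDerivAt (fun x : Euc n => r • x) (r • ContinuousLinearMap.id ℝ (Euc n)) x :=
        (hasFDerivAt_id x).const_smul r
      have h3 : HasFDerivAt χ ((fderiv ℝ f (r • x)).comp (r • ContinuousLinearMap.id ℝ (Euc n))) x :=
        HasFDerivAt.comp (g := (f : Euc n → ℝ)) x (hf1.differentiable (by norm_num) (r • x)).hasFDerivAt h2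
      rw [h3.fderiv]
      simp only [ContinuousLinearMap.comp_apply, _root_.smul_apply, ContinuousLinearMap.id_apply,
        map_smul, smul_eq_mul, abs_mul, abs_of_pos hk]
      have := ((fderiv ℝ f (r • x)).le_opNorm v).trans (mul_le_mul_of_nonneg_right (hC _) (norm_nonneg v))
      rw [Real.norm_eq_abs] at this
      nlinarith
    have hG : ContDiff ℝ 1 (fun x => χ x • g x) := hχ1.smul hg
    have hGc : HasCompactSupport (fun x => χ x • g x) := hχc.smul_right
    have := le_perim hF hG hGc (fun x => by
      rw [norm_smul, Real.norm_of_nonneg f.nonneg]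
      exact mul_le_one₀ f.le_one (norm_nonneg _) (h1 x))
    have hb : ∫ x in F, (χ x * q x - C * r) ≤ ∫ x in F, divg (fun x => χ x • g x) x := by
      refine setIntegral_mono ?_ (divg_integrable hG hGc).integrableOn ?_
      · refine Integrable.sub ?_ (integrable_const _)
        exact hq.bdd_mul (c := 1) hχ1.continuous.aestronglyMeasurable (Eventually.of_forall fun x => by
          rw [Real.norm_of_nonneg f.nonneg]; exact f.le_one)
      · intro x
        simp only
        rw [divg_smul (hχ1.differentiable (by norm_num) x) (hg.differentiable (by norm_num) x)]
        have a1 := (abs_le.1 (hχd x (g x))).1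
        have a2 := mul_le_mul_of_nonneg_left (hle x) (f.nonneg : 0 ≤ χ x)
        have a3 : C * r * ‖g x‖ ≤ C * r := by nlinarith [h1 x, mul_nonneg hC0 hk.le]
        linarith
    rw [integral_sub _ (integrable_const _)] at hb
    · simp only [integral_const, smul_eq_mul, measureReal_restrict_apply_univ] at hb
      nlinarith
    · exact hq.bdd_mul (c := 1) hχ1.continuous.aestronglyMeasurable (Eventually.of_forall fun x => by
          rw [Real.norm_of_nonneg f.nonneg]; exact f.le_one)
  have t0 : Tendsto (fun k : ℕ => ((k:ℝ)+1)⁻¹) atTop (𝓝 0) := by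
    simpa using tendsto_one_div_add_atTop_nhds_zero_nat (𝕜 := ℝ)
  have lim1 : Tendsto (fun k : ℕ => ∫ x in F, f (((k:ℝ)+1)⁻¹ • x) * q x) atTop (𝓝 (∫ x in F, q x)) := by
    refine tendsto_integral_of_dominated_convergence (fun x => ‖q x‖) ?_ hq.norm ?_ ?_
    · intro k
      exact ((f.continuous.comp (continuous_const_smul _)).aestronglyMeasurable).mul hq.1
    · intro k
      refine Eventually.of_forall fun x => ?_
      rw [norm_mul, Real.norm_of_nonneg f.nonneg]
      exact mul_le_of_le_one_left (norm_nonneg _) f.le_one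
    · refine Eventually.of_forall fun x => ?_
      have : Tendsto (fun k : ℕ => f (((k:ℝ)+1)⁻¹ • x)) atTop (𝓝 (f ((0:ℝ) • x))) :=
        (f.continuous.tendsto _).comp (t0.smul_const x)
      rw [zero_smul, f.one_of_mem_closedBall (by simp [f])] at this
      simpa using this.mul_const (q x)
  have lim2 : Tendsto (fun k : ℕ => perim F + C * ((k:ℝ)+1)⁻¹ * volume.real F) atTop
      (𝓝 (perim F + C * 0 * volume.real F)) :=
    ((t0.const_mul C).mul_const _).const_add _
  have := le_of_tendsto_of_tendsto' lim1 lim2 step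
  simpa using this

lemma amgm {n : ℕ} (hn : 1 ≤ n) (d : Fin n → ℝ) (hd : ∀ i, 0 ≤ d i) :
    n * (∏ i, d i) ^ ((n:ℝ)⁻¹) ≤ ∑ i, d i := by
  have hn' : (0:ℝ) < n := by exact_mod_cast hn
  have := Real.geom_mean_le_arith_mean Finset.univ (fun _ => (1:ℝ)) d (by simp) (by simpa using hn')
    (fun i _ => hd i)
  simp only [Real.rpow_one, one_mul, Finset.sum_const, Finset.card_univ, Fintype.card_fin, nsmul_eq_mul,
    mul_one] at this
  rw [le_div_iff₀ hn'] at this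
  linarith

def iso (n : ℕ) (v : ℝ) : ℝ := n * (ballVol n / v) ^ ((n:ℝ)⁻¹) * v

lemma iso_nonneg (n : ℕ) {v : ℝ} (hv : 0 ≤ v) : 0 ≤ iso n v := by
  have := ballVol_pos n
  unfold iso; positivity

lemma iso_calib {n : ℕ} (hn : 1 ≤ n) {F : Set (Euc n)} (hF : MeasurableSet F) (hv : volume F ≠ ∞)
    {κ : ℝ} (hκ : 0 < κ) :
    ∃ (g : Euc n → Euc n) (q : Euc n → ℝ) (C : ℝ), ContDiff ℝ 1 g ∧ (∀ x, ‖g x‖ ≤ 1) ∧ Continuous q ∧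
      (∀ x, 0 ≤ q x ∧ q x ≤ C) ∧ (∀ x, q x ≤ divg g x) ∧ iso n (volume.real F) - κ ≤ ∫ x in F, q x := by
  have hn' : (0:ℝ) < n := by exact_mod_cast hn
  by_cases hv0 : volume F = 0
  · refine ⟨fun _ => 0, fun _ => 0, 0, contDiff_const, by simp, continuous_const, by simp, ?_, ?_⟩
    · intro x; simp [divg]
    · simp [Measure.real, hv0, iso]; exact hκ.le
  set v := volume.real F with hvdef
  have hvp : 0 < v := ENNReal.toReal_pos hv0 hv
  have hω := ballVol_pos n
  set A : ℝ := n * (ballVol n / v) ^ ((n:ℝ)⁻¹) with hA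
  have hAp : 0 < A := by positivity
  obtain ⟨T, ρ, τ, hT, hT1, hρ, hρ1, hρ2, hd, hprod, -⟩ := calib hn hF hv hv0 (div_pos hκ hAp)
  refine ⟨T, fun x => A * ρ x, A, hT, hT1, by fun_prop, ?_, ?_, ?_⟩
  · intro x
    have := hρ1 x
    exact ⟨mul_nonneg hAp.le this.1, by nlinarith⟩
  · intro x
    refine le_trans ?_ (amgm hn _ (hd x))
    rw [hprod, Real.mul_rpow (by positivity) (hρ1 x).1, ← mul_assoc]
    refine mul_le_mul_of_nonneg_left ?_ hAp.le
    have h := hρ1 x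
    exact Real.self_le_rpow_of_le_one h.1 h.2 (inv_le_one_of_one_le₀ (by exact_mod_cast hn))
  · have hfin : IsFiniteMeasure (volume.restrict F) := ⟨by simpa using hv.lt_top⟩
    have hi : Integrable ρ (volume.restrict F) := Integrable.of_bound (C := 1) hρ.aestronglyMeasurable
      (Eventually.of_forall fun x => by rw [Real.norm_of_nonneg (hρ1 x).1]; exact (hρ1 x).2)
    rw [integral_sub (integrable_const _) hi] at hρ2
    simp only [integral_const, smul_eq_mul, measureReal_restrict_apply_univ, mul_one] at hρ2
    rw [integral_const_mul]
    have : A * (v - ∫ x in F, ρ x) ≤ κ := by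
      have := mul_le_mul_of_nonneg_left hρ2 hAp.le
      rwa [mul_div_cancel₀ _ hAp.ne'] at this
    unfold iso
    linarith

lemma iso_le {n : ℕ} (hn : 1 ≤ n) {F : Set (Euc n)} (hF : HasFinitePerim F) (hm : MeasurableSet F)
    (hv : volume F ≠ ∞) : iso n (volume.real F) ≤ perim F := by
  have hfin : IsFiniteMeasure (volume.restrict F) := ⟨by simpa using hv.lt_top⟩
  refine le_of_forall_pos_le_add fun κ hκ => ?_
  obtain ⟨g, q, C, hg, hg1, hq, hqb, hle, hint⟩ := iso_calib hn hm hv hκ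
  have := test_nc hF hv hg hg1 (q := q) (Integrable.of_bound (C := C) hq.aestronglyMeasurable
      (Eventually.of_forall fun x => by rw [Real.norm_of_nonneg (hqb x).1]; exact (hqb x).2)) hle
  linarith

lemma exists_step : ∃ (σ : ℝ → ℝ) (C : ℝ), 0 < C ∧ ContDiff ℝ 1 σ ∧ (∀ t, 0 ≤ σ t ∧ σ t ≤ 1) ∧
    (∀ t ≤ 0, σ t = 1) ∧ (∀ t, 1 ≤ t → σ t = 0) ∧ (∀ t, |deriv σ t| ≤ C) ∧ (∀ t, deriv σ t ≤ 0) ∧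
    (∀ t, t ≤ 0 ∨ 1 ≤ t → deriv σ t = 0) := by
  have h1 : ContDiff ℝ 1 (fun t => 1 - Real.smoothTransition t) :=
    contDiff_const.sub Real.smoothTransition.contDiff
  have h0 : ∀ t : ℝ, t ≤ 0 ∨ 1 ≤ t → deriv (fun t => 1 - Real.smoothTransition t) t = 0 := by
    rintro t (h | h)
    · refine IsLocalMax.deriv_eq_zero (Eventually.of_forall fun y => ?_)
      simp only [Real.smoothTransition.zero_of_nonpos h]
      linarith [Real.smoothTransition.nonneg y]
    · refine IsLocalMin.deriv_eq_zero (Eventually.of_forall fun y => ?_)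
      simp only [Real.smoothTransition.one_of_one_le h]
      linarith [Real.smoothTransition.le_one y]
  have hc : HasCompactSupport (deriv (fun t => 1 - Real.smoothTransition t)) := by
    refine HasCompactSupport.intro (isCompact_Icc (a := (0:ℝ)) (b := 1)) fun t ht => h0 t ?_
    by_contra hh
    push Not at hh
    exact ht ⟨hh.1.le, hh.2.le⟩
  obtain ⟨C, hC⟩ := (h1.continuous_deriv (by norm_num)).bounded_above_of_compact_support hc
  refine ⟨fun t => 1 - Real.smoothTransition t, |C| + 1, by positivity, h1, ?_, ?_, ?_, ?_, ?_, h0⟩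
  · intro t
    have := Real.smoothTransition.nonneg t
    have := Real.smoothTransition.le_one t
    constructor <;> linarith
  · intro t ht; simp [Real.smoothTransition.zero_of_nonpos ht]
  · intro t ht; simp [Real.smoothTransition.one_of_one_le ht]
  · intro t
    have := hC t
    rw [Real.norm_eq_abs] at this
    linarith [le_abs_self C]
  · intro t
    have : Antitone (fun t => 1 - Real.smoothTransition t) := by
      intro a b hab
      have : Real.smoothTransition a ≤ Real.smoothTransition b := Real.smoothTransition.monotone hab
      simp only
      linarith
    exact this.deriv_nonpos

lemma divg_mix {n : ℕ} {η : Euc n → ℝ} {g1 g2 : Euc n → Euc n} (hη : ContDiff ℝ 1 η)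
    (h1 : ContDiff ℝ 1 g1) (h2 : ContDiff ℝ 1 g2) (x : Euc n) :
    divg (fun y => η y • g1 y + (1 - η y) • g2 y) x =
      η x * divg g1 x + (1 - η x) * divg g2 x + fderiv ℝ η x (g1 x - g2 x) := by
  have e1 := hη.differentiable (by norm_num) x
  have e2 := h1.differentiable (by norm_num) x
  have e3 := h2.differentiable (by norm_num) x
  have e4 : DifferentiableAt ℝ (fun y => 1 - η y) x := (differentiableAt_const _).sub e1
  rw [divg_add (f := fun y => η y • g1 y) (g := fun y => (1 - η y) • g2 y) (e1.smul e2) (e4.smul e3), divg_smul e1 e2, divg_smul e4 e3, fderiv_const_sub, map_sub]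
  simp; ring

lemma mix_norm {n : ℕ} {a : ℝ} {v w : Euc n} (h0 : 0 ≤ a) (h1 : a ≤ 1) (hv : ‖v‖ ≤ 1) (hw : ‖w‖ ≤ 1) :
    ‖a • v + (1 - a) • w‖ ≤ 1 := by
  refine (norm_add_le _ _).trans ?_
  rw [norm_smul, norm_smul, Real.norm_of_nonneg h0, Real.norm_of_nonneg (by linarith)]
  nlinarith

lemma step_fderiv {n : ℕ} {σ : ℝ → ℝ} (hσ : ContDiff ℝ 1 σ) {φ : Euc n → ℝ} (hφ : ContDiff ℝ 1 φ)
    (u ε : ℝ) : ContDiff ℝ 1 (fun x => σ ((φ x - u) / ε)) ∧ ∀ x v,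
      fderiv ℝ (fun x => σ ((φ x - u) / ε)) x v = deriv σ ((φ x - u) / ε) / ε * fderiv ℝ φ x v := by
  refine ⟨hσ.comp ((hφ.sub contDiff_const).div_const _), fun x v => ?_⟩
  have h1 : HasFDerivAt (fun x => (φ x - u) / ε) (ε⁻¹ • fderiv ℝ φ x) x := by
    have := ((hφ.differentiable (by norm_num) x).hasFDerivAt.sub_const u).const_mul ε⁻¹
    refine this.congr_of_eventuallyEq (Eventually.of_forall fun y => ?_)
    simp only; ring
  have h2 := (hσ.differentiable (by norm_num) ((φ x - u) / ε)).hasDerivAt.comp_hasFDerivAt x h1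
  have h3 : HasFDerivAt (fun x => σ ((φ x - u) / ε)) (deriv σ ((φ x - u) / ε) • (ε⁻¹ • fderiv ℝ φ x)) x := h2
  rw [h3.fderiv]
  simp; ring

lemma integral_divg_zero {n : ℕ} {g : Euc n → Euc n} (hg : ContDiff ℝ 1 g) (hc : HasCompactSupport g) :
    ∫ x, divg g x = 0 := by
  have hcont := hg.continuous_fderiv (by norm_num)
  have hi : ∀ i : Fin n, Integrable (fun x => fderiv ℝ g x (EuclideanSpace.single i 1) i) := by
    intro i
    refine Continuous.integrable_of_hasCompactSupport ?_ ?_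
    · have : Continuous fun x => fderiv ℝ g x (EuclideanSpace.single i 1) := hcont.clm_apply continuous_const
      fun_prop
    · refine (hc.fderiv (𝕜 := ℝ)).mono' fun x hx => subset_closure ?_
      intro h0
      apply hx
      simp [h0]
  unfold divg
  rw [integral_finsetSum _ fun i _ => hi i]
  refine Finset.sum_eq_zero fun i _ => ?_
  have hgi : ContDiff ℝ 1 (fun x => g x i) := (contDiff_euclidean.1 hg) i
  have hd : ∀ x v, fderiv ℝ (fun x => g x i) x v = fderiv ℝ g x v i := by
    intro x v
    have h4 : HasFDerivAt (fun x => g x i) ((EuclideanSpace.proj i : Euc n →L[ℝ] ℝ).comp (fderiv ℝ g x)) x :=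
      ((EuclideanSpace.proj i : Euc n →L[ℝ] ℝ).hasFDerivAt).comp x
        (hg.differentiable (by norm_num) x).hasFDerivAt
    rw [h4.fderiv]; rfl
  have := integral_mul_fderiv_eq_neg_fderiv_mul_of_integrable (μ := (volume : Measure (Euc n)))
    (f := fun _ : Euc n => (1:ℝ)) (g := fun x => g x i) (v := EuclideanSpace.single i 1)
    (by simp) (by simp only [hd, one_mul]; exact hi i)
    (by
      simp only [one_mul]
      refine hgi.continuous.integrable_of_hasCompactSupport (hc.mono fun x hx h0 => hx ?_)
      simp [h0]) (fun x _ => differentiableAt_const _) (fun x _ => hgi.differentiable (by norm_num) x)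
  simpa [hd] using this

lemma ball_cut : ∃ C : ℝ, 0 < C ∧ ∀ {n : ℕ} {F : Set (Euc n)}, HasFinitePerim F → MeasurableSet F →
    volume F ≠ ∞ → ∀ {u M : ℝ}, u < 4 →
    (∃ᶠ ε in 𝓝[>] (0:ℝ), volume.real (F ∩ {x | u < ‖x‖ ^ 2 ∧ ‖x‖ ^ 2 < u + ε}) ≤ M * ε) →
    HasFinitePerim (F ∩ {x | ‖x‖ ^ 2 ≤ u}) ∧ HasFinitePerim (F ∩ {x | u < ‖x‖ ^ 2}) ∧
      perim (F ∩ {x | ‖x‖ ^ 2 ≤ u}) + perim (F ∩ {x | u < ‖x‖ ^ 2}) ≤ perim F + C * M := by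
  obtain ⟨σ, C, hC, hσ, hσb, hσ0, hσ1, hσd, -, hσz⟩ := exists_step
  refine ⟨12 * C, by positivity, ?_⟩
  intro n F hF hm hv u M hu hfr
  have hfin : IsFiniteMeasure (volume.restrict F) := ⟨by simpa using hv.lt_top⟩
  have hφ : ContDiff ℝ 1 (fun x : Euc n => ‖x‖ ^ 2) := contDiff_norm_sq ℝ
  have hmE : MeasurableSet {x : Euc n | ‖x‖ ^ 2 ≤ u} := measurableSet_le (by fun_prop) (by fun_prop)
  have hmG : MeasurableSet {x : Euc n | u < ‖x‖ ^ 2} := measurableSet_lt (by fun_prop) (by fun_prop)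
  have key : ∀ g1 g2 : Euc n → Euc n, ContDiff ℝ 1 g1 → HasCompactSupport g1 → (∀ x, ‖g1 x‖ ≤ 1) →
      ContDiff ℝ 1 g2 → HasCompactSupport g2 → (∀ x, ‖g2 x‖ ≤ 1) →
      (∫ x in F ∩ {x | ‖x‖ ^ 2 ≤ u}, divg g1 x) + (∫ x in F ∩ {x | u < ‖x‖ ^ 2}, divg g2 x) ≤
        perim F + 12 * C * M := by
    intro g1 g2 h1 c1 b1 h2 c2 b2
    set η : ℝ → Euc n → ℝ := fun ε x => σ ((‖x‖ ^ 2 - u) / ε) with hη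
    have i1 := divg_integrable h1 c1
    have i2 := divg_integrable h2 c2
    have hη1 : ∀ ε, ContDiff ℝ 1 (η ε) := fun ε => (step_fderiv hσ hφ u ε).1
    have inta : ∀ ε, IntegrableOn (fun x => η ε x * divg g1 x + (1 - η ε x) * divg g2 x) F := by
      intro ε
      refine Integrable.add ?_ ?_
      · exact i1.integrableOn.bdd_mul (c := 1) (hη1 ε).continuous.aestronglyMeasurable
          (Eventually.of_forall fun x => by
            rw [Real.norm_of_nonneg (hσb _).1]; exact (hσb _).2)
      · exact i2.integrableOn.bdd_mul (c := 1) (continuous_const.sub (hη1 ε).continuous).aestronglyMeasurable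
          (Eventually.of_forall fun x => by
            have := hσb ((‖x‖ ^ 2 - u) / ε)
            rw [Real.norm_of_nonneg (by linarith)]; linarith)
    have lim : Tendsto (fun ε => ∫ x in F, (η ε x * divg g1 x + (1 - η ε x) * divg g2 x)) (𝓝[>] 0)
        (𝓝 (∫ x in F, ({x | ‖x‖ ^ 2 ≤ u}.indicator (divg g1) x + {x | u < ‖x‖ ^ 2}.indicator (divg g2) x))) := by
      refine tendsto_integral_filter_of_dominated_convergence (fun x => ‖divg g1 x‖ + ‖divg g2 x‖) ?_ ?_
        (i1.norm.add i2.norm).integrableOn ?_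
      · exact Eventually.of_forall fun ε => (inta ε).1
      · refine Eventually.of_forall fun ε => Eventually.of_forall fun x => ?_
        have := hσb ((‖x‖ ^ 2 - u) / ε)
        refine (norm_add_le _ _).trans ?_
        change 0 ≤ η ε x ∧ η ε x ≤ 1 at this
        rw [norm_mul, norm_mul, Real.norm_of_nonneg this.1,
          Real.norm_of_nonneg (show 0 ≤ 1 - η ε x by linarith)]
        nlinarith [norm_nonneg (divg g1 x), norm_nonneg (divg g2 x)]
      · refine Eventually.of_forall fun x => ?_
        refine tendsto_nhds_of_eventually_eq ?_
        by_cases hx : ‖x‖ ^ 2 ≤ u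
        · filter_upwards [self_mem_nhdsWithin] with ε hε
          have hε : 0 < ε := hε
          have : η ε x = 1 := hσ0 _ (div_nonpos_of_nonpos_of_nonneg (by linarith) hε.le)
          rw [this, indicator_of_mem (by exact hx), indicator_of_notMem (by simpa using hx)]; ring
        · push Not at hx
          have : Ioo (0:ℝ) (‖x‖ ^ 2 - u) ∈ 𝓝[>] (0:ℝ) := Ioo_mem_nhdsGT (by linarith)
          filter_upwards [this] with ε hε
          have : η ε x = 0 := hσ1 _ (by rw [le_div_iff₀ hε.1]; linarith [hε.2])
          rw [this, indicator_of_notMem (show x ∉ {x : Euc n | ‖x‖ ^ 2 ≤ u} by simpa using hx),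
            indicator_of_mem (show x ∈ {x : Euc n | u < ‖x‖ ^ 2} from hx)]; ring
    have hlimval : (∫ x in F, ({x | ‖x‖ ^ 2 ≤ u}.indicator (divg g1) x + {x | u < ‖x‖ ^ 2}.indicator (divg g2) x)) =
        (∫ x in F ∩ {x | ‖x‖ ^ 2 ≤ u}, divg g1 x) + (∫ x in F ∩ {x | u < ‖x‖ ^ 2}, divg g2 x) := by
      rw [integral_add, setIntegral_indicator hmE, setIntegral_indicator hmG]
      · exact (i1.integrableOn).indicator hmE
      · exact (i2.integrableOn).indicator hmG
    rw [← hlimval]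
    refine le_of_tendsto_of_frequently lim ?_
    have hsm : Ioo (0:ℝ) 1 ∈ 𝓝[>] (0:ℝ) := Ioo_mem_nhdsGT one_pos
    refine (hfr.and_eventually hsm).mono ?_
    rintro ε ⟨hM, hε0, hε1⟩
    set S : Set (Euc n) := {x | u < ‖x‖ ^ 2 ∧ ‖x‖ ^ 2 < u + ε} with hS
    have hmS : MeasurableSet S := hmG.inter
      (show MeasurableSet {x : Euc n | ‖x‖ ^ 2 < u + ε} from measurableSet_lt (by fun_prop) (by fun_prop))
    set B : ℝ := 12 * C / ε with hB
    have hG : ContDiff ℝ 1 (fun y => η ε y • g1 y + (1 - η ε y) • g2 y) :=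
      ((hη1 ε).smul h1).add ((contDiff_const.sub (hη1 ε)).smul h2)
    have hGc : HasCompactSupport (fun y => η ε y • g1 y + (1 - η ε y) • g2 y) :=
      by
        refine HasCompactSupport.intro (c1.isCompact.union c2.isCompact) fun x hx => ?_
        have n1 : g1 x = 0 := image_eq_zero_of_notMem_tsupport fun h => hx (Or.inl h)
        have n2 : g2 x = 0 := image_eq_zero_of_notMem_tsupport fun h => hx (Or.inr h)
        rw [n1, n2, smul_zero, smul_zero, add_zero]
    have hp := le_perim hF hG hGc (fun x => mix_norm (hσb _).1 (hσb _).2 (b1 x) (b2 x))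
    have hmono : ∫ x in F, (η ε x * divg g1 x + (1 - η ε x) * divg g2 x) - S.indicator (fun _ => B) x ≤
        ∫ x in F, divg (fun y => η ε y • g1 y + (1 - η ε y) • g2 y) x := by
      refine setIntegral_mono ((inta ε).sub ((integrable_const B).indicator hmS))
        (divg_integrable hG hGc).integrableOn ?_
      intro x
      simp only
      rw [divg_mix (hη1 ε) h1 h2, (step_fderiv hσ hφ u ε).2]
      have hfd : fderiv ℝ (fun x : Euc n => ‖x‖ ^ 2) x (g1 x - g2 x) = 2 * inner ℝ x (g1 x - g2 x) := by
        rw [fderiv_norm_sq_apply]; simp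
      rw [hfd]
      by_cases hx : x ∈ S
      · rw [indicator_of_mem hx]
        have a1 : |inner ℝ x (g1 x - g2 x)| ≤ 3 * 2 := by
          refine (abs_real_inner_le_norm _ _).trans (mul_le_mul ?_ ?_ (norm_nonneg _) (by norm_num))
          · have : ‖x‖ ^ 2 < u + ε := hx.2
            nlinarith [norm_nonneg x]
          · refine (norm_sub_le _ _).trans ?_
            linarith [b1 x, b2 x]
        have a2 : |deriv σ ((‖x‖ ^ 2 - u) / ε) / ε| ≤ C / ε := by
          rw [abs_div, abs_of_pos hε0]
          exact div_le_div_of_nonneg_right (hσd _) hε0.le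
        have a3 : |deriv σ ((‖x‖ ^ 2 - u) / ε) / ε * (2 * inner ℝ x (g1 x - g2 x))| ≤ C / ε * (2 * (3 * 2)) := by
          rw [abs_mul, abs_mul, abs_two]
          exact mul_le_mul a2 (by linarith) (by positivity) (by positivity)
        have : C / ε * (2 * (3 * 2)) = B := by rw [hB]; ring
        linarith [(abs_le.1 a3).1]
      · rw [indicator_of_notMem hx, hσz]
        · simp
        · by_contra hh
          push Not at hh
          apply hx
          rw [lt_div_iff₀ hε0, div_lt_iff₀ hε0] at hh
          exact ⟨by linarith [hh.1], by linarith [hh.2]⟩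
    rw [integral_sub (inta ε) ((integrable_const B).indicator hmS), setIntegral_indicator hmS] at hmono
    simp only [integral_const, smul_eq_mul, measureReal_restrict_apply_univ] at hmono
    have : volume.real (F ∩ S) * B ≤ 12 * C * M := by
      have e : 12 * C * M = (M * ε) * B := by rw [hB]; field_simp
      rw [e]
      exact mul_le_mul_of_nonneg_right hM (by positivity)
    linarith
  have z1 : ContDiff ℝ 1 (fun _ : Euc n => (0 : Euc n)) := contDiff_const
  have z2 : HasCompactSupport (fun _ : Euc n => (0 : Euc n)) := HasCompactSupport.zero
  have z3 : ∀ x, ‖(fun _ : Euc n => (0 : Euc n)) x‖ ≤ 1 := by simp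
  have z4 : ∀ x, divg (fun _ : Euc n => (0 : Euc n)) x = 0 := by intro x; simp [divg]
  have pE : HasFinitePerim (F ∩ {x | ‖x‖ ^ 2 ≤ u}) := (perim_le_of (C := perim F + 12 * C * M) fun g hg hc hb => by
    have := key g _ hg hc hb z1 z2 z3
    simpa [z4] using this).1
  have pG : HasFinitePerim (F ∩ {x | u < ‖x‖ ^ 2}) := (perim_le_of (C := perim F + 12 * C * M) fun g hg hc hb => by
    have := key _ g z1 z2 z3 hg hc hb
    simpa [z4] using this).1
  refine ⟨pE, pG, ?_⟩
  have := (perim_le_of (E := F ∩ {x | u < ‖x‖ ^ 2}) (C := perim F + 12 * C * M - perim (F ∩ {x | ‖x‖ ^ 2 ≤ u}))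
    fun g hg hc hb => by
      have := (perim_le_of (E := F ∩ {x | ‖x‖ ^ 2 ≤ u}) (C := perim F + 12 * C * M - ∫ x in F ∩ {x | u < ‖x‖ ^ 2}, divg g x)
        fun g' hg' hc' hb' => by
          have := key g' g hg' hc' hb' hg hc hb
          linarith).2
      linarith).2
  linarith

lemma plane_cut : ∃ C : ℝ, 0 < C ∧ ∀ {n : ℕ}, 1 ≤ n → ∀ {F : Set (Euc n)}, HasFinitePerim F → MeasurableSet F →
    volume F ≠ ∞ → ∀ (i : Fin n) {s t : ℝ}, s < t →
    iso n (volume.real (F ∩ {x | x i ≤ s})) + iso n (volume.real (F ∩ {x | t ≤ x i})) ≤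
      perim F + C / (t - s) * volume.real (F ∩ {x | s < x i ∧ x i < t}) := by
  obtain ⟨σ, C, hC, hσ, hσb, hσ0, hσ1, hσd, -, hσz⟩ := exists_step
  refine ⟨2 * C, by positivity, ?_⟩
  intro n hn F hF hm hv i s t hst
  have hfin : IsFiniteMeasure (volume.restrict F) := ⟨by simpa using hv.lt_top⟩
  have hε : 0 < t - s := by linarith
  have hci : Continuous (fun x : Euc n => x i) := by fun_prop
  have m1 : MeasurableSet {x : Euc n | x i ≤ s} := measurableSet_le hci.measurable measurable_const
  have m2 : MeasurableSet {x : Euc n | t ≤ x i} := measurableSet_le measurable_const hci.measurable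
  have mS : MeasurableSet {x : Euc n | s < x i ∧ x i < t} :=
    (show MeasurableSet {x : Euc n | s < x i} from measurableSet_lt measurable_const hci.measurable).inter
      (show MeasurableSet {x : Euc n | x i < t} from measurableSet_lt hci.measurable measurable_const)
  set S : Set (Euc n) := {x : Euc n | s < x i ∧ x i < t} with hS
  have hφ : ContDiff ℝ 1 (fun x : Euc n => x i) := (EuclideanSpace.proj i : Euc n →L[ℝ] ℝ).contDiff
  have hφd : ∀ x v, fderiv ℝ (fun x : Euc n => x i) x v = v i := by
    intro x v
    have : HasFDerivAt (fun x : Euc n => x i) (EuclideanSpace.proj i : Euc n →L[ℝ] ℝ) x :=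
      (EuclideanSpace.proj i : Euc n →L[ℝ] ℝ).hasFDerivAt
    rw [this.fderiv]; rfl
  obtain ⟨hη1, hηd⟩ := step_fderiv hσ hφ s (t - s)
  set η : Euc n → ℝ := fun x => σ ((x i - s) / (t - s)) with hη
  have hηb : ∀ x, 0 ≤ η x ∧ η x ≤ 1 := fun x => hσb _
  refine le_of_forall_pos_le_add fun κ hκ => ?_
  obtain ⟨g1, q1, C1, a1, b1, c1, d1, e1, f1⟩ := iso_calib hn (hm.inter m1)
    (measure_ne_top_of_subset inter_subset_left hv) (half_pos hκ)
  obtain ⟨g2, q2, C2, a2, b2, c2, d2, e2, f2⟩ := iso_calib hn (hm.inter m2)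
    (measure_ne_top_of_subset inter_subset_left hv) (half_pos hκ)
  set B : ℝ := 2 * C / (t - s) with hB
  have hBp : 0 < B := by positivity
  have i1 : IntegrableOn q1 F := Integrable.of_bound (C := C1) c1.aestronglyMeasurable
    (Eventually.of_forall fun x => by rw [Real.norm_of_nonneg (d1 x).1]; exact (d1 x).2)
  have i2 : IntegrableOn q2 F := Integrable.of_bound (C := C2) c2.aestronglyMeasurable
    (Eventually.of_forall fun x => by rw [Real.norm_of_nonneg (d2 x).1]; exact (d2 x).2)
  have iB : IntegrableOn (S.indicator (fun _ => B)) F := (integrable_const B).indicator mS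
  have inta : IntegrableOn (fun x => η x * q1 x + (1 - η x) * q2 x) F := by
    refine Integrable.add ?_ ?_
    · exact i1.bdd_mul (c := 1) hη1.continuous.aestronglyMeasurable
        (Eventually.of_forall fun x => by rw [Real.norm_of_nonneg (hηb x).1]; exact (hηb x).2)
    · exact i2.bdd_mul (c := 1) (continuous_const.sub hη1.continuous).aestronglyMeasurable
        (Eventually.of_forall fun x => by
          have := hηb x
          rw [Real.norm_of_nonneg (by linarith)]; linarith)
  have hG : ContDiff ℝ 1 (fun y => η y • g1 y + (1 - η y) • g2 y) :=
      (hη1.smul a1).add ((contDiff_const.sub hη1).smul a2)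
  have hp := test_nc hF hv hG (fun x => mix_norm (hηb x).1 (hηb x).2 (b1 x) (b2 x))
    (q := fun x => (η x * q1 x + (1 - η x) * q2 x) - S.indicator (fun _ => B) x) (inta.sub iB) (by
      intro x
      rw [divg_mix hη1 a1 a2, hηd, hφd]
      have g1' := mul_le_mul_of_nonneg_left (e1 x) (hηb x).1
      have g2' := mul_le_mul_of_nonneg_left (e2 x) (show 0 ≤ 1 - η x by linarith [(hηb x).2])
      by_cases hx : x ∈ S
      · rw [indicator_of_mem hx]
        have z1 : |(g1 x - g2 x) i| ≤ 2 := by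
          have := PiLp.norm_apply_le (g1 x - g2 x) i
          rw [Real.norm_eq_abs] at this
          linarith [norm_sub_le (g1 x) (g2 x), b1 x, b2 x]
        have z2 : |deriv σ ((x i - s) / (t - s)) / (t - s)| ≤ C / (t - s) := by
          rw [abs_div, abs_of_pos hε]
          exact div_le_div_of_nonneg_right (hσd _) hε.le
        have z3 : |deriv σ ((x i - s) / (t - s)) / (t - s) * (g1 x - g2 x) i| ≤ C / (t - s) * 2 := by
          rw [abs_mul]
          exact mul_le_mul z2 z1 (abs_nonneg _) (by positivity)
        have : C / (t - s) * 2 = B := by rw [hB]; ring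
        linarith [(abs_le.1 z3).1]
      · rw [indicator_of_notMem hx, hσz]
        · simp only [zero_div, zero_mul]; linarith
        · by_contra hh
          push Not at hh
          apply hx
          rw [lt_div_iff₀ hε, div_lt_iff₀ hε] at hh
          exact ⟨by linarith [hh.1], by linarith [hh.2]⟩)
  rw [integral_sub inta iB, setIntegral_indicator mS] at hp
  simp only [integral_const, smul_eq_mul, measureReal_restrict_apply_univ] at hp
  have low : (∫ x in F ∩ {x | x i ≤ s}, q1 x) + (∫ x in F ∩ {x | t ≤ x i}, q2 x) ≤
      ∫ x in F, (η x * q1 x + (1 - η x) * q2 x) := by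
    rw [← setIntegral_indicator m1, ← setIntegral_indicator m2, ← integral_add (i1.indicator m1) (i2.indicator m2)]
    refine setIntegral_mono ((i1.indicator m1).add (i2.indicator m2)) inta fun x => ?_
    have hb := hηb x
    have n1 := (d1 x).1
    have n2 := (d2 x).1
    simp only
    refine add_le_add ?_ ?_
    · by_cases hx : x ∈ {x : Euc n | x i ≤ s}
      · have : η x = 1 := hσ0 _ (div_nonpos_of_nonpos_of_nonneg (by have : x i ≤ s := hx; linarith) hε.le)
        rw [indicator_of_mem hx, this, one_mul]
      · rw [indicator_of_notMem hx]; exact mul_nonneg hb.1 n1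
    · by_cases hx : x ∈ {x : Euc n | t ≤ x i}
      · have : η x = 0 := hσ1 _ (by rw [le_div_iff₀ hε]; have : t ≤ x i := hx; linarith)
        rw [indicator_of_mem hx, this, sub_zero, one_mul]
      · rw [indicator_of_notMem hx]; exact mul_nonneg (by linarith) n2
  linarith

lemma perim_ball {n : ℕ} (hn : 1 ≤ n) : HasFinitePerim (ball (0 : Euc n) 1) ∧
    perim (ball (0 : Euc n) 1) ≤ n * ballVol n := by
  have : Nonempty (Fin n) := ⟨⟨0, hn⟩⟩
  obtain ⟨σ, C, hC, hσ, hσb, hσ0, hσ1, hσd, hσn, hσz⟩ := exists_step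
  refine perim_le_of fun g hg hgc hg1 => ?_
  have hφ : ContDiff ℝ 1 (fun x : Euc n => ‖x‖ ^ 2) := contDiff_norm_sq ℝ
  have ig := divg_integrable hg hgc
  have step : ∀ ε : ℝ, 0 < ε → ∫ x, σ ((‖x‖ ^ 2 - 1) / ε) * divg g x ≤ n * ballVol n * (1 + ε) ^ (n - 1) := by
    intro ε hε
    obtain ⟨hη1, hηd⟩ := step_fderiv hσ hφ 1 ε
    have hG : ContDiff ℝ 1 (fun x => σ ((‖x‖ ^ 2 - 1) / ε) • g x) := hη1.smul hg
    have hGc : HasCompactSupport (fun x => σ ((‖x‖ ^ 2 - 1) / ε) • g x) := by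
      refine HasCompactSupport.intro hgc.isCompact fun x hx => ?_
      rw [image_eq_zero_of_notMem_tsupport hx, smul_zero]
    have h0 := integral_divg_zero hG hGc
    set f : ℝ → ℝ := fun r => -(deriv σ ((r ^ 2 - 1) / ε) * (2 * r / ε)) with hf
    have hfc : Continuous f := by
      have := hσ.continuous_deriv (by norm_num)
      simp only [hf]; fun_prop
    have hfz : ∀ r, 1 + ε ≤ r → f r = 0 := by
      intro r hr
      simp only [hf]
      rw [hσz _ (Or.inr _)]
      · simp
      · rw [le_div_iff₀ hε]; nlinarith
    have hfn : ∀ r, 0 ≤ r → 0 ≤ f r := by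
      intro r hr
      have := hσn ((r ^ 2 - 1) / ε)
      have : 0 ≤ 2 * r / ε := by positivity
      simp only [hf]; nlinarith
    have hI : IntegrableOn (fun y : ℝ => y ^ (n - 1) * f |y|) (Ioi 0) := by
      have hc : Continuous (fun y : ℝ => y ^ (n - 1) * f |y|) := by fun_prop
      refine (hc.integrable_of_hasCompactSupport ?_).integrableOn
      refine HasCompactSupport.intro (isCompact_Icc (a := -(1+ε)) (b := 1 + ε)) fun y hy => ?_
      rw [hfz, mul_zero]
      by_contra hh
      push Not at hh
      exact hy ⟨(abs_lt.1 hh).1.le, (abs_lt.1 hh).2.le⟩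
    have hrad := lint_radial hn (f := fun y => f |y|) (fun y => hfn _ (abs_nonneg y)) hI
    have hIle : ∫ y in Ioi (0:ℝ), y ^ (n - 1) * f |y| ≤ (1 + ε) ^ (n - 1) := by
      have e1 : ∫ y in Ioi (0:ℝ), y ^ (n - 1) * f |y| = ∫ y in Ioc (0:ℝ) (1 + ε), y ^ (n - 1) * f |y| := by
        refine setIntegral_eq_of_subset_of_forall_sdiff_eq_zero measurableSet_Ioi Ioc_subset_Ioi_self ?_
        rintro y ⟨hy1, hy2⟩
        have hy1 : 0 < y := hy1
        rw [abs_of_pos hy1, hfz, mul_zero]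
        by_contra hh
        exact hy2 ⟨hy1, by linarith⟩
      have e2 : ∫ y in Ioc (0:ℝ) (1 + ε), y ^ (n - 1) * f |y| ≤ ∫ y in Ioc (0:ℝ) (1 + ε), (1 + ε) ^ (n - 1) * f y := by
        refine setIntegral_mono_on (hI.mono_set Ioc_subset_Ioi_self) ?_ measurableSet_Ioc ?_
        · have hcc : Continuous (fun y => (1 + ε) ^ (n - 1) * f y) := continuous_const.mul hfc
          exact (hcc.integrableOn_Icc (a := 0) (b := 1 + ε)).mono_set Ioc_subset_Icc_self
        · intro y hy
          rw [abs_of_pos hy.1]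
          exact mul_le_mul_of_nonneg_right (pow_le_pow_left₀ hy.1.le hy.2 _) (hfn _ hy.1.le)
      have e3 : ∫ y in (0:ℝ)..(1+ε), f y = -(σ (((1+ε)^2-1)/ε)) - (-(σ ((0^2-1)/ε))) := by
        refine intervalIntegral.integral_eq_sub_of_hasDerivAt (f := fun y => -(σ ((y^2-1)/ε))) ?_ (hfc.intervalIntegrable _ _)
        intro y _
        have h1 : HasDerivAt (fun y : ℝ => (y^2-1)/ε) (2 * y / ε) y := by
          have := ((hasDerivAt_pow 2 y).sub_const 1).div_const ε
          simpa using this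
        exact ((hσ.differentiable (by norm_num) ((y^2-1)/ε)).hasDerivAt.comp y h1).neg
      rw [hσ1 _ (by rw [le_div_iff₀ hε]; nlinarith), hσ0 _ (div_nonpos_of_nonpos_of_nonneg (by norm_num) hε.le)] at e3
      rw [intervalIntegral.integral_of_le (by positivity)] at e3
      rw [integral_const_mul, e3] at e2
      rw [e1]; linarith
    have hIf : Integrable (fun x : Euc n => f ‖x‖) := by
      refine Continuous.integrable_of_hasCompactSupport (by fun_prop) ?_
      refine HasCompactSupport.intro (isCompact_closedBall (0 : Euc n) (1 + ε)) fun x hx => hfz _ ?_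
      rw [mem_closedBall_zero_iff] at hx; linarith
    have hfI : ∫ x : Euc n, f ‖x‖ ≤ n * ballVol n * (1 + ε) ^ (n - 1) := by
      rw [integral_eq_lintegral_of_nonneg_ae (Eventually.of_forall fun x => hfn _ (norm_nonneg x)) hIf.1]
      simp only [abs_norm] at hrad
      rw [hrad]
      have hω := ballVol_pos n
      have hnn : 0 ≤ ∫ y in Ioi (0:ℝ), y ^ (n - 1) * f |y| :=
        setIntegral_nonneg measurableSet_Ioi fun y hy =>
          mul_nonneg (pow_nonneg (le_of_lt hy) _) (hfn _ (abs_nonneg y))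
      rw [ENNReal.toReal_ofReal (by positivity)]
      exact mul_le_mul_of_nonneg_left hIle (by positivity)
    refine le_trans ?_ hfI
    have hmono : ∫ x, (σ ((‖x‖ ^ 2 - 1) / ε) * divg g x - f ‖x‖) ≤ ∫ x, divg (fun x => σ ((‖x‖ ^ 2 - 1) / ε) • g x) x := by
      refine integral_mono ?_ (divg_integrable hG hGc) ?_
      · exact (ig.bdd_mul (c := 1) hη1.continuous.aestronglyMeasurable
          (Eventually.of_forall fun x => by rw [Real.norm_of_nonneg (hσb _).1]; exact (hσb _).2)).sub hIf
      · intro x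
        simp only
        rw [divg_smul (hη1.differentiable (by norm_num) x) (hg.differentiable (by norm_num) x), hηd]
        have hfd : fderiv ℝ (fun x : Euc n => ‖x‖ ^ 2) x (g x) = 2 * inner ℝ x (g x) := by
          rw [fderiv_norm_sq_apply]; simp
        rw [hfd]
        have z1 : inner ℝ x (g x) ≤ ‖x‖ := by
          refine (real_inner_le_norm _ _).trans ?_
          nlinarith [norm_nonneg x, hg1 x]
        have z2 := hσn ((‖x‖ ^ 2 - 1) / ε)
        have z3 : 0 ≤ -deriv σ ((‖x‖ ^ 2 - 1) / ε) / ε := div_nonneg (by linarith) hε.le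
        have z4 := mul_le_mul_of_nonneg_left z1 z3
        have z5 : f ‖x‖ = 2 * (-deriv σ ((‖x‖ ^ 2 - 1) / ε) / ε * ‖x‖) := by simp only [hf]; ring
        have z6 : deriv σ ((‖x‖ ^ 2 - 1) / ε) / ε * (2 * inner ℝ x (g x)) =
          -(2 * (-deriv σ ((‖x‖ ^ 2 - 1) / ε) / ε * inner ℝ x (g x))) := by ring
        rw [z5, z6]; linarith
    rw [h0, integral_sub (ig.bdd_mul (c := 1) hη1.continuous.aestronglyMeasurable
          (Eventually.of_forall fun x => by rw [Real.norm_of_nonneg (hσb _).1]; exact (hσb _).2)) hIf] at hmono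
    linarith
  have hball : ∫ x in ball (0 : Euc n) 1, divg g x = ∫ x in closedBall (0 : Euc n) 1, divg g x := by
    refine setIntegral_congr_set ?_
    have : Nontrivial (Euc n) := inferInstance
    refine (ae_eq_of_subset_of_measure_ge ball_subset_closedBall ?_ measurableSet_ball.nullMeasurableSet ?_)
    · exact (Measure.addHaar_closedBall_eq_addHaar_ball _ _ _).le
    · exact measure_closedBall_lt_top.ne
  have lim : Tendsto (fun ε => ∫ x, σ ((‖x‖ ^ 2 - 1) / ε) * divg g x) (𝓝[>] 0)
      (𝓝 (∫ x, (closedBall (0 : Euc n) 1).indicator (divg g) x)) := by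
    refine tendsto_integral_filter_of_dominated_convergence (fun x => ‖divg g x‖) ?_ ?_ ig.norm ?_
    · refine Eventually.of_forall fun ε => ?_
      exact ((step_fderiv hσ hφ 1 ε).1.continuous.aestronglyMeasurable).mul ig.1
    · refine Eventually.of_forall fun ε => Eventually.of_forall fun x => ?_
      rw [norm_mul, Real.norm_of_nonneg (hσb _).1]
      exact mul_le_of_le_one_left (norm_nonneg _) (hσb _).2
    · refine Eventually.of_forall fun x => tendsto_nhds_of_eventually_eq ?_
      by_cases hx : x ∈ closedBall (0 : Euc n) 1
      · filter_upwards [self_mem_nhdsWithin] with ε hε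
        have hε : 0 < ε := hε
        rw [indicator_of_mem hx, hσ0, one_mul]
        rw [mem_closedBall_zero_iff] at hx
        exact div_nonpos_of_nonpos_of_nonneg (by nlinarith [norm_nonneg x]) hε.le
      · rw [indicator_of_notMem hx]
        rw [mem_closedBall_zero_iff] at hx
        have : Ioo (0:ℝ) (‖x‖ ^ 2 - 1) ∈ 𝓝[>] (0:ℝ) := Ioo_mem_nhdsGT (by nlinarith)
        filter_upwards [this] with ε hε
        rw [hσ1, zero_mul]
        rw [le_div_iff₀ hε.1]; linarith [hε.2]
  rw [integral_indicator measurableSet_closedBall, ← hball] at lim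
  have lim2 : Tendsto (fun ε : ℝ => n * ballVol n * (1 + ε) ^ (n - 1)) (𝓝[>] 0) (𝓝 (n * ballVol n * (1 + 0) ^ (n - 1))) := by
    refine Tendsto.mono_left ?_ nhdsWithin_le_nhds
    exact Continuous.tendsto (by fun_prop) 0
  have := le_of_tendsto_of_tendsto lim lim2 (by
    filter_upwards [self_mem_nhdsWithin] with ε hε using step ε hε)
  simpa using this

lemma iso_gap {n : ℕ} (hn : 1 ≤ n) {e : ℝ} (he : 0 < e) (he' : e < ballVol n) :
    ∃ η u : ℝ, 0 < η ∧ 0 < u ∧ ∀ v w : ℝ, e ≤ v → e ≤ w → v + w ≤ ballVol n → ballVol n - u ≤ v + w →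
      n * ballVol n + 2 * η ≤ iso n v + iso n w := by
  have hω := ballVol_pos n
  set ω := ballVol n with hωd
  have hn' : (0:ℝ) < n := by exact_mod_cast hn
  set θ : ℝ := (ω / (ω - e)) ^ ((n:ℝ)⁻¹) with hθ
  have h1 : 0 < ω - e := by linarith
  have hθ1 : 1 < θ := Real.one_lt_rpow (by rw [lt_div_iff₀ h1]; linarith) (by positivity)
  refine ⟨n * ((θ - 1) * ω) / 4, (θ - 1) * ω / (2 * θ), ?_, ?_, ?_⟩
  · have : 0 < θ - 1 := by linarith
    positivity
  · have : 0 < θ - 1 := by linarith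
    positivity
  · intro v w hv hw hvw hu
    have key : ∀ v, e ≤ v → v ≤ ω - e → n * θ * v ≤ iso n v := by
      intro v hv hv2
      have hv0 : 0 < v := by linarith
      unfold iso
      refine mul_le_mul_of_nonneg_right (mul_le_mul_of_nonneg_left ?_ hn'.le) hv0.le
      refine Real.rpow_le_rpow (by positivity) ?_ (by positivity)
      exact div_le_div_of_nonneg_left hω.le hv0 hv2
    have k1 := key v hv (by linarith)
    have k2 := key w hw (by linarith)
    have k3 : n * θ * (ω - (θ - 1) * ω / (2 * θ)) ≤ n * θ * (v + w) :=
      mul_le_mul_of_nonneg_left hu (by positivity)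
    have k4 : n * θ * (ω - (θ - 1) * ω / (2 * θ)) = n * ω + 2 * (n * ((θ - 1) * ω) / 4) := by
      have : θ ≠ 0 := by linarith
      field_simp; ring
    linarith

lemma density {n : ℕ} (hn : 1 ≤ n) {e : ℝ} (he : 0 < e) (he' : e < ballVol n) :
    ∃ η c : ℝ, 0 < η ∧ 0 < c ∧ ∀ {F : Set (Euc n)}, HasFinitePerim F → MeasurableSet F →
      volume F ≠ ∞ → volume.real F = ballVol n → perim F ≤ n * ballVol n + η → ∀ (i : Fin n) {s t : ℝ}, s ≤ t →
      e ≤ volume.real (F ∩ {x | x i ≤ s}) → e ≤ volume.real (F ∩ {x | t ≤ x i}) →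
      c * (t - s) ≤ volume.real (F ∩ {x | s < x i ∧ x i ≤ t}) := by
  obtain ⟨C, hC, hcut⟩ := plane_cut
  obtain ⟨η, u, hη, hu, hgap⟩ := iso_gap hn he he'
  refine ⟨η, η / C, hη, by positivity, ?_⟩
  intro F hF hm hv hvol hP i
  set c := η / C with hc
  have hcp : 0 < c := by positivity
  have hci : Continuous (fun x : Euc n => x i) := by fun_prop
  have mle : ∀ s, MeasurableSet {x : Euc n | x i ≤ s} := fun s => measurableSet_le hci.measurable measurable_const
  have mlt : ∀ s, MeasurableSet {x : Euc n | x i < s} := fun s => measurableSet_lt hci.measurable measurable_const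
  have mge : ∀ s, MeasurableSet {x : Euc n | s ≤ x i} := fun s => measurableSet_le measurable_const hci.measurable
  have mgt : ∀ s, MeasurableSet {x : Euc n | s < x i} := fun s => measurableSet_lt measurable_const hci.measurable
  have mS : ∀ s t, MeasurableSet {x : Euc n | s < x i ∧ x i < t} := fun s t => (mgt s).inter (mlt t)
  have mS' : ∀ s t, MeasurableSet {x : Euc n | s < x i ∧ x i ≤ t} := fun s t => (mgt s).inter (mle t)
  have fin : ∀ S : Set (Euc n), volume (F ∩ S) ≠ ∞ := fun S => measure_ne_top_of_subset inter_subset_left hv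
  have base : ∀ s t : ℝ, s < t → t - s ≤ u / c → e ≤ volume.real (F ∩ {x | x i ≤ s}) →
      e ≤ volume.real (F ∩ {x | t ≤ x i}) → c * (t - s) ≤ volume.real (F ∩ {x | s < x i ∧ x i < t}) := by
    intro s t hst hts h1 h2
    by_contra hlt
    push Not at hlt
    have hmid : volume.real (F ∩ {x | s < x i ∧ x i < t}) < u := by
      refine hlt.trans_le ?_
      rw [le_div_iff₀ hcp] at hts; linarith
    have hsum : volume.real (F ∩ {x | x i ≤ s}) + volume.real (F ∩ {x | t ≤ x i}) +
        volume.real (F ∩ {x | s < x i ∧ x i < t}) = ballVol n := by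
      rw [← hvol, ← measureReal_union _ (hm.inter (mge t)) (fin _) (fin _), ← measureReal_union _
        (hm.inter (mS s t)) _ (fin _)]
      · congr 1
        ext x
        constructor
        · rintro ((⟨h, -⟩ | ⟨h, -⟩) | ⟨h, -⟩) <;> exact h
        · intro h
          by_cases a : x i ≤ s
          · exact Or.inl (Or.inl ⟨h, a⟩)
          · by_cases b : t ≤ x i
            · exact Or.inl (Or.inr ⟨h, b⟩)
            · exact Or.inr ⟨h, not_le.1 a, not_le.1 b⟩
      · rw [Set.disjoint_left]
        rintro x (⟨-, h⟩ | ⟨-, h⟩) ⟨-, h', h''⟩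
        · exact absurd (show x i ≤ s from h) (not_le.2 h')
        · exact absurd (show t ≤ x i from h) (not_le.2 h'')
      · exact measure_union_ne_top (fin _) (fin _)
      · rw [Set.disjoint_left]
        rintro x ⟨-, h⟩ ⟨-, h'⟩
        have h : x i ≤ s := h
        have h' : t ≤ x i := h'
        linarith
    have hnn : 0 ≤ volume.real (F ∩ {x | s < x i ∧ x i < t}) := measureReal_nonneg
    have g := hgap _ _ h1 h2 (by linarith) (by linarith)
    have k := hcut hn hF hm hv i hst
    have hts0 : 0 < t - s := by linarith
    have : C / (t - s) * volume.real (F ∩ {x | s < x i ∧ x i < t}) < C / (t - s) * (c * (t - s)) :=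
      mul_lt_mul_of_pos_left hlt (by positivity)
    have e2 : C / (t - s) * (c * (t - s)) = η := by rw [hc]; field_simp
    linarith
  have ind : ∀ N : ℕ, ∀ s t : ℝ, s ≤ t → t - s ≤ N * (u / c) → e ≤ volume.real (F ∩ {x | x i ≤ s}) →
      e ≤ volume.real (F ∩ {x | t ≤ x i}) → c * (t - s) ≤ volume.real (F ∩ {x | s < x i ∧ x i ≤ t}) := by
    have hsub : ∀ s t : ℝ, s ≤ t → t - s ≤ u / c → e ≤ volume.real (F ∩ {x | x i ≤ s}) →
      e ≤ volume.real (F ∩ {x | t ≤ x i}) → c * (t - s) ≤ volume.real (F ∩ {x | s < x i ∧ x i ≤ t}) := by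
      intro s t hst hts h1 h2
      rcases hst.eq_or_lt with rfl | hlt
      · simp
      · refine (base s t hlt hts h1 h2).trans (measureReal_mono ?_ (fin _))
        exact inter_subset_inter_right _ fun x hx => ⟨hx.1, hx.2.le⟩
    intro N
    induction N with
    | zero =>
      intro s t hst hts
      have : s = t := by push_cast at hts; linarith
      subst this
      simp
    | succ N ih =>
      intro s t hst hts h1 h2
      by_cases hsm : t - s ≤ u / c
      · exact hsub s t hst hsm h1 h2
      · push Not at hsm
        have huc : 0 < u / c := by positivity
        set m := s + u / c with hmd
        have a1 : e ≤ volume.real (F ∩ {x | x i ≤ m}) := h1.trans (measureReal_mono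
          (inter_subset_inter_right _ fun x hx => le_trans (show x i ≤ s from hx) (by linarith)) (fin _))
        have a2 : e ≤ volume.real (F ∩ {x | m ≤ x i}) := h2.trans (measureReal_mono
          (inter_subset_inter_right _ fun x hx => le_trans (by linarith) (show t ≤ x i from hx)) (fin _))
        have b1 := hsub s m (by linarith) (by linarith) h1 a2
        have b2 := ih m t (by linarith) (by push_cast at hts; linarith) a1 h2
        have : volume.real (F ∩ {x | s < x i ∧ x i ≤ m}) + volume.real (F ∩ {x | m < x i ∧ x i ≤ t}) ≤
            volume.real (F ∩ {x | s < x i ∧ x i ≤ t}) := by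
          rw [← measureReal_union _ (hm.inter (mS' m t)) (fin _) (fin _)]
          · refine measureReal_mono ?_ (fin _)
            rintro x (⟨h, h', h''⟩ | ⟨h, h', h''⟩)
            · exact ⟨h, h', by linarith⟩
            · exact ⟨h, by linarith, h''⟩
          · rw [Set.disjoint_left]
            rintro x ⟨-, -, h⟩ ⟨-, h', -⟩
            linarith
        have : c * (t - s) = c * (m - s) + c * (t - m) := by ring
        linarith
  intro s t hst h1 h2
  obtain ⟨N, hN⟩ := exists_nat_ge ((t - s) / (u / c))
  refine ind N s t hst ?_ h1 h2
  rwa [div_le_iff₀ (by positivity)] at hN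

lemma meas_lower {ν : Measure ℝ} [IsFiniteMeasure ν] {a b c : ℝ} (hab : a ≤ b) (hc : 0 ≤ c)
    (h : ∀ s t, a ≤ s → s ≤ t → t ≤ b → c * (t - s) ≤ ν.real (Ioc s t)) :
    ENNReal.ofReal c • volume.restrict (Ioc a b) ≤ ν := by
  set cl : ℝ → ℝ := fun t => max a (min b t) with hcl
  have hclc : Continuous cl := by fun_prop
  have hclm : Monotone cl := fun s t hst => max_le_max le_rfl (min_le_min le_rfl hst)
  have hdiff : ∀ s t, s ≤ t → ν.real (Iic t) - ν.real (Iic s) = ν.real (Ioc s t) := by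
    intro s t hst
    have : Ioc s t = Iic t \ Iic s := by ext x; simp [and_comm]
    rw [this, measureReal_sdiff (Iic_subset_Iic.2 hst) measurableSet_Iic]
  have hineq : ∀ s t, s ≤ t → c * (cl t - cl s) ≤ ν.real (Ioc s t) := by
    intro s t hst
    rcases (hclm hst).eq_or_lt with heq | hlt
    · rw [heq]; simp
    · have h1 : s ≤ cl s := by
        simp only [hcl] at hlt ⊢
        by_contra hh
        push Not at hh
        rw [max_lt_iff] at hh
        have : b < s := by
          rcases min_lt_iff.1 hh.2 with h | h
          · exact h
          · exact absurd h (lt_irrefl _)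
        rw [min_eq_left this.le, min_eq_left (this.le.trans hst)] at hlt
        exact lt_irrefl _ hlt
      have h2 : cl t ≤ t := by
        simp only [hcl] at hlt ⊢
        rw [max_le_iff]
        refine ⟨?_, min_le_right _ _⟩
        by_contra hh
        push Not at hh
        rw [max_eq_left ((min_le_right _ _).trans hh.le), max_eq_left ((min_le_right _ _).trans (hst.trans hh.le))] at hlt
        exact lt_irrefl _ hlt
      exact (h _ _ (le_max_left _ _) hlt.le (max_le hab (min_le_left _ _))).trans
        (measureReal_mono (Ioc_subset_Ioc h1 h2))
  let G : StieltjesFunction ℝ :=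
    { toFun := fun t => ν.real (Iic t) - c * cl t
      mono' := by
        intro s t hst
        have := hdiff s t hst
        have := hineq s t hst
        simp only
        nlinarith
      right_continuous' := by
        intro t
        refine ContinuousWithinAt.sub ?_ (continuous_const.mul hclc).continuousWithinAt
        have h1 := tendsto_measure_biInter_gt (μ := ν) (s := fun r => Iic r) (a := t)
          (fun r _ => measurableSet_Iic.nullMeasurableSet) (fun i j _ hij => Iic_subset_Iic.2 hij)
          ⟨t + 1, by linarith, measure_ne_top _ _⟩
        have h2 : ⋂ r > t, Iic r = Iic t := by
          ext x; simp only [mem_iInter, mem_Iic]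
          exact ⟨fun hh => le_of_forall_gt_imp_ge_of_dense hh, fun hh r hr => hh.trans (le_of_lt hr)⟩
        rw [h2] at h1
        have h3 : ContinuousWithinAt (fun t => ν.real (Iic t)) (Ioi t) t :=
          (ENNReal.tendsto_toReal (measure_ne_top _ _)).comp h1
        exact continuousWithinAt_Ioi_iff_Ici.1 h3 }
  have hG : ν = ENNReal.ofReal c • volume.restrict (Ioc a b) + G.measure := by
    refine Measure.ext_of_Ioc _ _ fun s t hst => ?_
    rw [Measure.add_apply, Measure.smul_apply, Measure.restrict_apply measurableSet_Ioc, Ioc_inter_Ioc,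
      Real.volume_Ioc, StieltjesFunction.measure_Ioc, smul_eq_mul, ← ENNReal.ofReal_mul hc]
    have e1 : ENNReal.ofReal (c * (min t b - max s a)) = ENNReal.ofReal (c * (cl t - cl s)) := by
      by_cases hp : max s a ≤ min t b
      · congr 2
        have l1 : s ≤ b := (le_max_left s a).trans (hp.trans (min_le_right _ _))
        have l2 : a ≤ t := (le_max_right s a).trans (hp.trans (min_le_left _ _))
        simp only [hcl]
        rw [min_eq_right l1, max_eq_right (le_min hab l2), max_comm a s, min_comm b t]
      · push Not at hp
        rw [ENNReal.ofReal_of_nonpos (mul_nonpos_of_nonneg_of_nonpos hc (by linarith)), eq_comm]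
        have : cl t = cl s := by
          simp only [hcl]
          rcases min_lt_iff.1 hp with h1 | h1
          · rcases lt_max_iff.1 h1 with h2 | h2
            · exact absurd hst (not_lt.2 h2.le)
            · rw [max_eq_left ((min_le_right _ _).trans h2.le), max_eq_left ((min_le_right _ _).trans (hst.le.trans h2.le))]
          · rcases lt_max_iff.1 h1 with h2 | h2
            · rw [min_eq_left h2.le, min_eq_left (h2.le.trans hst.le)]
            · exact absurd hab (not_le.2 h2)
        rw [this]; simp
    rw [e1, ← ENNReal.ofReal_add (mul_nonneg hc (sub_nonneg.2 (hclm hst.le)))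
      (sub_nonneg.2 (G.mono hst.le))]
    have : c * (cl t - cl s) + (G t - G s) = ν.real (Ioc s t) := by
      rw [← hdiff s t hst.le]
      change c * (cl t - cl s) + ((ν.real (Iic t) - c * cl t) - (ν.real (Iic s) - c * cl s)) = _
      ring
    rw [this, Measure.real, ENNReal.ofReal_toReal (measure_ne_top _ _)]
  conv_rhs => rw [hG]
  exact Measure.le_add_right le_rfl

lemma width_test {n : ℕ} (hn : 1 ≤ n) {F : Set (Euc n)} (hF : HasFinitePerim F) (hm : MeasurableSet F)
    (hv : volume F ≠ ∞) (hvol : volume.real F = ballVol n) {κ a b c : ℝ} (hκ : 0 < κ) (hab : a ≤ b) (hc : 0 ≤ c)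
    (h : ENNReal.ofReal c • volume.restrict (Ioc a b) ≤
      (volume.restrict F).map (fun x : Euc n => x ⟨0, hn⟩)) :
    c * (n * κ * (b - a) - 2 * ((1 + κ) ^ n - 1)) ≤ perim F - n * ballVol n := by
  have hn' : (0:ℝ) < n := by exact_mod_cast hn
  have hω := ballVol_pos n
  have hv0 : volume F ≠ 0 := by
    intro h0
    rw [Measure.real, h0] at hvol
    simp at hvol; linarith
  have hfin : IsFiniteMeasure (volume.restrict F) := ⟨by simpa using hv.lt_top⟩
  set i0 : Fin n := ⟨0, hn⟩ with hi0
  set B : ℝ := (1 + κ) ^ n - 1 with hB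
  have hB0 : 0 ≤ B := by
    have : 1 ≤ (1 + κ) ^ n := one_le_pow₀ (by linarith)
    linarith
  refine le_of_forall_pos_le_add fun e he => ?_
  have hnk : 0 < n * (1 + κ) := by positivity
  obtain ⟨T, ρ, τ, hT, hT1, hρ, hρ1, hρ2, hd, hprod, hτ, hTτ⟩ := calib hn hm hv hv0 (div_pos he hnk)
  rw [hvol, div_self hω.ne'] at hprod
  have hder : ∀ x, fderiv ℝ T x (EuclideanSpace.single i0 1) i0 = deriv τ (x i0) := by
    intro x
    have hf : ContDiff ℝ 1 (fun y => T y i0) := by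
      exact (contDiff_euclidean.1 hT) i0
    have h1 := line_hasDerivAt hf x (EuclideanSpace.single i0 1)
    have h2 : (fun t : ℝ => T (x + t • EuclideanSpace.single i0 1) i0) = fun t => τ (x i0 + t) := by
      funext t
      rw [hTτ]; simp [hi0]
    rw [h2] at h1
    have h3 : HasDerivAt (fun t : ℝ => τ (x i0 + t)) (deriv τ (x i0)) 0 := by
      have := (hτ.differentiable (by norm_num) (x i0 + 0)).hasDerivAt.comp_const_add (x i0) 0
      simpa using this
    have h4 := h1.unique h3
    rw [← h4]
    have hTx : HasFDerivAt T (fderiv ℝ T x) x := (hT.differentiable (by norm_num) x).hasFDerivAt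
    have h5 := ((EuclideanSpace.proj i0 : Euc n →L[ℝ] ℝ).hasFDerivAt.comp x hTx).fderiv
    have h6 : fderiv ℝ (fun y => T y i0) x = (EuclideanSpace.proj i0 : Euc n →L[ℝ] ℝ).comp (fderiv ℝ T x) := h5
    rw [h6]; rfl
  have hd0 : ∀ t, 0 ≤ deriv τ t := by
    intro t
    have := hd (EuclideanSpace.single i0 t) i0
    rw [hder] at this
    simpa using this
  have hdc : Continuous (deriv τ) := hτ.continuous_deriv (by norm_num)
  set L : ℝ → ℝ := fun t => max (n * κ - B * deriv τ t) 0 with hL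
  have hLc : Continuous L := by fun_prop
  have hL0 : ∀ t, 0 ≤ L t := fun t => le_max_right _ _
  have hL1 : ∀ t, ‖L t‖ ≤ n * κ := by
    intro t
    rw [Real.norm_of_nonneg (hL0 t)]
    refine max_le ?_ (by positivity)
    have := mul_nonneg hB0 (hd0 t)
    linarith
  have hci : Continuous (fun x : Euc n => x i0) := by fun_prop
  have hLint : IntegrableOn (fun x : Euc n => L (x i0)) F :=
    Integrable.of_bound (C := n * κ) (hLc.comp hci).aestronglyMeasurable (Eventually.of_forall fun x => hL1 _)
  have hρint : IntegrableOn (fun x : Euc n => 1 - ρ x) F :=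
    Integrable.of_bound (C := 1) (continuous_const.sub hρ).aestronglyMeasurable (Eventually.of_forall fun x => by
      rw [Real.norm_eq_abs, abs_le]; constructor <;> linarith [hρ1 x])
  have hin : IntegrableOn (fun x : Euc n => (n:ℝ) - n * (1 + κ) * (1 - ρ x)) F :=
    (integrable_const _).sub (hρint.const_mul _)
  have hq := test_nc hF hv hT hT1 (q := fun x => ((n:ℝ) - n * (1 + κ) * (1 - ρ x)) + L (x i0))
    (hin.add hLint) (by
      intro x
      have hr := hρ1 x
      have hpow : ρ x ≤ (ρ x) ^ ((n:ℝ)⁻¹) := by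
        have := Real.rpow_le_rpow_of_exponent_ge' hr.1 hr.2 (by positivity : (0:ℝ) ≤ (n:ℝ)⁻¹)
          (inv_le_one_of_one_le₀ (by exact_mod_cast hn))
        simpa using this
      change _ ≤ ∑ i, fderiv ℝ T x (EuclideanSpace.single i 1) i
      have hp := hprod x
      have hdx := hd x
      set d : Fin n → ℝ := fun i => fderiv ℝ T x (EuclideanSpace.single i 1) i with hdd
      rw [one_mul] at hp
      have a1 := amgm hn d hdx
      rw [hp] at a1
      have a2 := amgm hn (Function.update d i0 ((1 + κ) ^ n * d i0)) (by
        intro i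
        by_cases hi : i = i0
        · subst hi; simp only [Function.update_self]; exact mul_nonneg (by positivity) (hdx _)
        · rw [Function.update_of_ne hi]; exact hdx i)
      have p2 : ∏ i, Function.update d i0 ((1 + κ) ^ n * d i0) i = (1 + κ) ^ n * ρ x := by
        rw [Finset.prod_update_of_mem (Finset.mem_univ _), ← hp, ← Finset.mul_prod_erase _ _ (Finset.mem_univ i0),
          Finset.sdiff_singleton_eq_erase]
        ring
      have s2 : ∑ i, Function.update d i0 ((1 + κ) ^ n * d i0) i = ∑ i, d i + B * d i0 := by
        rw [Finset.sum_update_of_mem (Finset.mem_univ _), ← Finset.add_sum_erase _ d (Finset.mem_univ i0),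
          Finset.sdiff_singleton_eq_erase]
        rw [hB]; ring
      rw [p2, s2, Real.mul_rpow (by positivity) hr.1, Real.pow_rpow_inv_natCast (by positivity) (by omega)] at a2
      have hdi : d i0 = deriv τ (x i0) := hder x
      rw [hdi] at a2
      change _ ≤ ∑ i, d i
      have m1 : n * ρ x ≤ n * (ρ x) ^ ((n:ℝ)⁻¹) := mul_le_mul_of_nonneg_left hpow hn'.le
      have m2 : n * ((1 + κ) * ρ x) ≤ n * ((1 + κ) * (ρ x) ^ ((n:ℝ)⁻¹)) :=
        mul_le_mul_of_nonneg_left (mul_le_mul_of_nonneg_left hpow (by linarith)) hn'.le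
      have m3 : 0 ≤ n * κ * (1 - ρ x) := mul_nonneg (by positivity) (by linarith)
      simp only [hL]
      rcases max_cases (n * κ - B * deriv τ (x i0)) 0 with ⟨h1, -⟩ | ⟨h1, -⟩ <;> rw [h1] <;> nlinarith)
  rw [integral_add hin hLint,
    integral_sub (integrable_const _) (hρint.const_mul _), integral_const_mul] at hq
  simp only [integral_const, MeasurableSet.univ, measureReal_restrict_apply, univ_inter, smul_eq_mul, hvol] at hq
  have k1 : n * (1 + κ) * ∫ x in F, (1 - ρ x) ≤ e := by
    have := mul_le_mul_of_nonneg_left hρ2 hnk.le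
    rwa [mul_div_cancel₀ _ hnk.ne'] at this
  have k2 : ∫ x in F, L (x i0) = ∫ t, L t ∂((volume.restrict F).map (fun x : Euc n => x i0)) :=
    (integral_map hci.aemeasurable hLc.aestronglyMeasurable).symm
  have hfm : IsFiniteMeasure ((volume.restrict F).map (fun x : Euc n => x i0)) := inferInstance
  have k3 := integral_mono_measure h (f := L) (Eventually.of_forall hL0)
    (Integrable.of_bound (C := n * κ) hLc.aestronglyMeasurable (Eventually.of_forall hL1))
  rw [integral_smul_measure, ENNReal.toReal_ofReal hc, smul_eq_mul] at k3
  have k4 : n * κ * (b - a) - 2 * B ≤ ∫ t in Ioc a b, L t := by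
    rw [← intervalIntegral.integral_of_le hab]
    have i1 : ∫ t in a..b, (n * κ - B * deriv τ t) = n * κ * (b - a) - B * (τ b - τ a) := by
      rw [intervalIntegral.integral_sub intervalIntegrable_const (((hdc.intervalIntegrable a b).const_mul B)),
        intervalIntegral.integral_const_mul B, intervalIntegral.integral_deriv_eq_sub
          (fun t _ => hτ.differentiable (by norm_num) t) (hdc.intervalIntegrable _ _)]
      simp; ring
    have i2 : ∫ t in a..b, (n * κ - B * deriv τ t) ≤ ∫ t in a..b, L t :=
      intervalIntegral.integral_mono_on hab ((continuous_const.sub (continuous_const.mul hdc)).intervalIntegrable _ _)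
        (hLc.intervalIntegrable _ _) fun t _ => le_max_left _ _
    have τ1 : ∀ t, |τ t| ≤ 1 := by
      intro t
      have := hTτ (EuclideanSpace.single i0 t)
      simp only [← hi0, PiLp.single_apply, if_true] at this
      rw [← this, ← Real.norm_eq_abs]
      exact (PiLp.norm_apply_le _ _).trans (hT1 _)
    have := abs_le.1 (τ1 a)
    have := abs_le.1 (τ1 b)
    have : B * (τ b - τ a) ≤ B * 2 := mul_le_mul_of_nonneg_left (by linarith) hB0
    linarith
  have k5 := mul_le_mul_of_nonneg_left k4 hc
  linarith

lemma exists_kappa (n : ℕ) (hn : 1 ≤ n) {ε : ℝ} (hε : 0 < ε) :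
    ∃ κ : ℝ, 0 < κ ∧ (1 + κ) ^ n - 1 ≤ n * κ * (1 + ε) := by
  have hn' : (0:ℝ) < n := by exact_mod_cast hn
  have h1 : HasDerivAt (fun κ : ℝ => (1 + κ) ^ n) n 0 := by
    have := ((hasDerivAt_id' (0:ℝ)).const_add 1).fun_pow n
    simpa using this
  have h2 := h1.tendsto_slope_zero_right
  have h3 := h2.eventually (gt_mem_nhds (show (n:ℝ) < n * (1 + ε) by nlinarith))
  obtain ⟨κ, hκ, hκ0⟩ := (h3.and self_mem_nhdsWithin).exists
  have hκ0 : 0 < κ := hκ0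
  refine ⟨κ, hκ0, ?_⟩
  simp only [zero_add, add_zero, one_pow, smul_eq_mul] at hκ
  rw [inv_mul_lt_iff₀ hκ0] at hκ
  nlinarith

lemma width0 {n : ℕ} (hn : 1 ≤ n) {ε e : ℝ} (hε : 0 < ε) (he : 0 < e) :
    ∃ η : ℝ, 0 < η ∧ ∀ {F : Set (Euc n)}, HasFinitePerim F → MeasurableSet F → volume F ≠ ∞ →
      volume.real F = ballVol n → perim F ≤ n * ballVol n + η →
      ∃ a : ℝ, volume.real (F ∩ {x | ¬ (a ≤ x ⟨0, hn⟩ ∧ x ⟨0, hn⟩ ≤ a + (2 + ε))}) ≤ e := by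
  have hn' : (0:ℝ) < n := by exact_mod_cast hn
  have hω := ballVol_pos n
  set e' : ℝ := min (e / 2) (ballVol n / 2) with he'd
  have he' : 0 < e' := lt_min (by linarith) (by linarith)
  have he'2 : e' < ballVol n := (min_le_right _ _).trans_lt (by linarith)
  have he'3 : e' ≤ e / 2 := min_le_left _ _
  obtain ⟨η, c, hη, hc, hden⟩ := density hn he' he'2
  obtain ⟨κ, hκ, hκ2⟩ := exists_kappa n hn (show 0 < ε / 8 by linarith)
  have hx : 0 < c * (n * κ * (ε / 4)) := by positivity
  refine ⟨min η (c * (n * κ * (ε / 4))), lt_min hη hx, ?_⟩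
  intro F hF hm hv hvol hP
  set i0 : Fin n := ⟨0, hn⟩ with hi0
  have hfin : IsFiniteMeasure (volume.restrict F) := ⟨by simpa using hv.lt_top⟩
  have hci : Continuous (fun x : Euc n => x i0) := by fun_prop
  set ν : Measure ℝ := (volume.restrict F).map (fun x : Euc n => x i0) with hν
  have hνf : IsFiniteMeasure ν := inferInstance
  have hνa : ∀ S : Set ℝ, MeasurableSet S → ν.real S = volume.real (F ∩ {x | x i0 ∈ S}) := by
    intro S hS
    rw [Measure.real, hν, Measure.map_apply hci.measurable hS, Measure.restrict_apply (hci.measurable hS), inter_comm]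
    rfl
  have hνu : ν.real univ = ballVol n := by rw [hνa _ MeasurableSet.univ]; simpa using hvol
  have fin : ∀ S : Set (Euc n), volume (F ∩ S) ≠ ∞ := fun S => measure_ne_top_of_subset inter_subset_left hv
  have r0 : ∀ {f : ℝ → Set ℝ} {l : Filter ℝ} {S : Set ℝ}, Tendsto (fun t => ν (f t)) l (𝓝 (ν S)) →
      Tendsto (fun t => ν.real (f t)) l (𝓝 (ν.real S)) := by
    intro f l S h
    exact (ENNReal.tendsto_toReal (measure_ne_top _ _)).comp h
  have tV1 : Tendsto (fun t => ν.real (Iic t)) atTop (𝓝 (ballVol n)) := by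
    rw [← hνu]; exact r0 (tendsto_measure_Iic_atTop ν)
  have tW1 : Tendsto (fun t => ν.real (Ici t)) atBot (𝓝 (ballVol n)) := by
    rw [← hνu]; exact r0 (tendsto_measure_Ici_atBot ν)
  have hδ : 0 < ε / 8 := by linarith
  have hdis : ∀ t u : ℝ, t < u → ν.real (Iic t) + ν.real (Ici u) ≤ ballVol n := by
    intro t u htu
    rw [← hνu, ← measureReal_union _ measurableSet_Ici]
    · exact measureReal_mono (subset_univ _)
    · rw [Set.disjoint_left]
      intro x h1 h2
      have h1 : x ≤ t := h1
      have h2 : u ≤ x := h2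
      linarith
  have V0 : ∃ t, ν.real (Iic t) < e' := by
    obtain ⟨t, ht⟩ := (tW1.eventually (lt_mem_nhds (show ballVol n - e' < ballVol n by linarith))).exists
    exact ⟨t - 1, by linarith [hdis (t - 1) t (by linarith)]⟩
  have W0 : ∃ t, ν.real (Ici t) < e' := by
    obtain ⟨t, ht⟩ := (tV1.eventually (lt_mem_nhds (show ballVol n - e' < ballVol n by linarith))).exists
    exact ⟨t + 1, by linarith [hdis t (t + 1) (by linarith)]⟩
  obtain ⟨a, ha1, ha2⟩ : ∃ a, e' ≤ ν.real (Iic a) ∧ ν.real (Iic (a - ε / 8)) < e' := by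
    set S := {t | e' ≤ ν.real (Iic t)} with hS
    have ne : S.Nonempty := by
      obtain ⟨t, ht⟩ := (tV1.eventually (lt_mem_nhds he'2)).exists
      exact ⟨t, ht.le⟩
    have bd : BddBelow S := by
      obtain ⟨t, ht⟩ := V0
      refine ⟨t, fun u hu => ?_⟩
      by_contra hut
      push Not at hut
      have : ν.real (Iic u) ≤ ν.real (Iic t) := measureReal_mono (Iic_subset_Iic.2 hut.le)
      exact absurd (show e' ≤ ν.real (Iic u) from hu) (not_le.2 (by linarith))
    obtain ⟨a, ha, hal⟩ := exists_lt_of_csInf_lt ne (show sInf S < sInf S + ε / 8 by linarith)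
    refine ⟨a, ha, ?_⟩
    by_contra hh
    push Not at hh
    have := csInf_le bd (show a - ε / 8 ∈ S from hh)
    linarith
  obtain ⟨b, hb1, hb2⟩ : ∃ b, e' ≤ ν.real (Ici b) ∧ ν.real (Ici (b + ε / 8)) < e' := by
    set S := {t | e' ≤ ν.real (Ici t)} with hS
    have ne : S.Nonempty := by
      obtain ⟨t, ht⟩ := (tW1.eventually (lt_mem_nhds he'2)).exists
      exact ⟨t, ht.le⟩
    have bd : BddAbove S := by
      obtain ⟨t, ht⟩ := W0
      refine ⟨t, fun u hu => ?_⟩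
      by_contra hut
      push Not at hut
      have : ν.real (Ici u) ≤ ν.real (Ici t) := measureReal_mono (Ici_subset_Ici.2 hut.le)
      exact absurd (show e' ≤ ν.real (Ici u) from hu) (not_le.2 (by linarith))
    obtain ⟨a, ha, hal⟩ := exists_lt_of_lt_csSup ne (show sSup S - ε / 8 < sSup S by linarith)
    refine ⟨a, ha, ?_⟩
    by_contra hh
    push Not at hh
    have := le_csSup bd (show a + ε / 8 ∈ S from hh)
    linarith
  have hba : b - a ≤ 2 + ε / 2 := by
    by_cases hab : a ≤ b
    · have hlow : ENNReal.ofReal c • volume.restrict (Ioc a b) ≤ ν := by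
        refine meas_lower hab hc.le fun s t hs hst ht => ?_
        rw [hνa _ measurableSet_Ioc]
        refine hden hF hm hv hvol (hP.trans (by gcongr; exact min_le_left _ _)) i0 hst ?_ ?_
        · have := hνa _ (measurableSet_Iic (a := s))
          refine ha1.trans ((measureReal_mono (Iic_subset_Iic.2 hs)).trans this.le)
        · have := hνa _ (measurableSet_Ici (a := t))
          refine hb1.trans ((measureReal_mono (Ici_subset_Ici.2 ht)).trans this.le)
      have := width_test hn hF hm hv hvol hκ hab hc.le hlow
      have h2 : perim F - n * ballVol n ≤ c * (n * κ * (ε / 4)) := by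
        have := min_le_right η (c * (n * κ * (ε / 4)))
        linarith
      have h3 := le_of_mul_le_mul_left (this.trans h2) hc
      have h4 : n * κ * (b - a) ≤ n * κ * (2 + ε / 2) := by nlinarith
      exact le_of_mul_le_mul_left h4 (by positivity)
    · linarith
  refine ⟨a - ε / 8, ?_⟩
  have hsub : F ∩ {x | ¬ (a - ε / 8 ≤ x i0 ∧ x i0 ≤ a - ε / 8 + (2 + ε))} ⊆
      (F ∩ {x | x i0 ∈ Iic (a - ε / 8)}) ∪ (F ∩ {x | x i0 ∈ Ici (b + ε / 8)}) := by
    rintro x ⟨hxF, hx⟩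
    have hx : ¬ (a - ε / 8 ≤ x i0 ∧ x i0 ≤ a - ε / 8 + (2 + ε)) := hx
    by_cases h1 : a - ε / 8 ≤ x i0
    · refine Or.inr ⟨hxF, ?_⟩
      have : ¬ x i0 ≤ a - ε / 8 + (2 + ε) := fun h => hx ⟨h1, h⟩
      push Not at this
      show b + ε / 8 ≤ x i0
      linarith
    · refine Or.inl ⟨hxF, (not_le.1 h1).le⟩
  refine (measureReal_mono hsub (measure_union_ne_top (fin _) (fin _))).trans ((measureReal_union_le _ _).trans ?_)
  rw [← hνa _ measurableSet_Iic, ← hνa _ measurableSet_Ici]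
  linarith

lemma width_dir {n : ℕ} (hn : 1 ≤ n) {ε e : ℝ} (hε : 0 < ε) (he : 0 < e) :
    ∃ η : ℝ, 0 < η ∧ ∀ {F : Set (Euc n)}, HasFinitePerim F → MeasurableSet F → volume F ≠ ∞ →
      volume.real F = ballVol n → perim F ≤ n * ballVol n + η → ∀ v : Euc n, ‖v‖ = 1 →
      ∃ a : ℝ, volume.real (F ∩ {x | ¬ (a ≤ inner ℝ v x ∧ inner ℝ v x ≤ a + (2 + ε))}) ≤ e := by
  obtain ⟨η, hη, h⟩ := width0 hn hε he
  refine ⟨η, hη, ?_⟩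
  intro F hF hm hv hvol hP v hv1
  set i0 : Fin n := ⟨0, hn⟩ with hi0
  obtain ⟨U, hU⟩ : ∃ U : Euc n ≃ₗᵢ[ℝ] Euc n, U (EuclideanSpace.single i0 1) = v :=
    ⟨_, Submodule.reflection_sub (v := (EuclideanSpace.single i0 1 : Euc n)) (w := v) (by simp [hv1])⟩
  have hmp : MeasurePreserving U volume volume := U.measurePreserving
  obtain ⟨p1, p2⟩ := perim_affine hF hm U one_pos 0
  have hset : ((fun x => (1:ℝ) • U x + 0) ⁻¹' F) = U ⁻¹' F := by
    ext x; simp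
  rw [hset] at p1 p2
  have hvolU : ∀ S : Set (Euc n), MeasurableSet S → volume.real (U ⁻¹' S) = volume.real S := by
    intro S hS
    rw [Measure.real, hmp.measure_preimage hS.nullMeasurableSet]; rfl
  obtain ⟨a, ha⟩ := h p1 (hmp.measurable hm) (by rw [hmp.measure_preimage hm.nullMeasurableSet]; exact hv)
    ((hvolU F hm).trans hvol) (p2.trans (by simpa using hP))
  refine ⟨a, ?_⟩
  have hci : Continuous (fun x : Euc n => inner ℝ v x) := by fun_prop
  have hmS : MeasurableSet {x : Euc n | ¬ (a ≤ inner ℝ v x ∧ inner ℝ v x ≤ a + (2 + ε))} :=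
    ((measurableSet_le measurable_const hci.measurable).inter
      (measurableSet_le hci.measurable measurable_const)).compl
  rw [← hvolU _ (hm.inter hmS)]
  refine le_of_eq_of_le ?_ ha
  congr 1
  ext x
  have : inner ℝ v (U x) = x i0 := by
    rw [← hU, U.inner_map_map]
    simp [EuclideanSpace.inner_single_left]
  simp only [mem_preimage, mem_inter_iff, mem_ofPred_eq, this]

lemma concentration {n : ℕ} (hn : 2 ≤ n) {δ : ℝ} (hδ : 0 < δ) :
    ∃ η : ℝ, 0 < η ∧ ∀ {F : Set (Euc n)}, HasFinitePerim F → MeasurableSet F → volume F ≠ ∞ →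
      volume.real F = ballVol n → perim F ≤ n * ballVol n + η →
      ∃ c : Euc n, volume.real (F ∩ {x | 1.96 < ‖x - c‖}) ≤ δ := by
  have hω := ballVol_pos n
  obtain ⟨t, ht1, htf, ht2⟩ := (isCompact_sphere (0 : Euc n) 1).finite_cover_balls (show (0:ℝ) < 1/1000 by norm_num)
  obtain ⟨t, rfl⟩ := htf.exists_finset_coe
  set e : ℝ := min δ (ballVol n / 10) / (t.card + 1) with he
  have hmin : 0 < min δ (ballVol n / 10) := lt_min hδ (by linarith)
  have hep : 0 < e := by positivity
  obtain ⟨η, hη, hw⟩ := width_dir (n := n) (by omega) (show (0:ℝ) < 1/1000 by norm_num) hep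
  refine ⟨η, hη, ?_⟩
  intro F hF hm hv hvol hP
  have fin : ∀ S : Set (Euc n), volume (F ∩ S) ≠ ∞ := fun S => measure_ne_top_of_subset inter_subset_left hv
  have hw' : ∀ v : Euc n, ∃ a : ℝ, ‖v‖ = 1 →
      volume.real (F ∩ {x | ¬ (a ≤ inner ℝ v x ∧ inner ℝ v x ≤ a + (2 + 1/1000))}) ≤ e := by
    intro v
    by_cases h1 : ‖v‖ = 1
    · obtain ⟨a, ha⟩ := hw hF hm hv hvol hP v h1
      exact ⟨a, fun _ => ha⟩
    · exact ⟨0, fun h => absurd h h1⟩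
  choose a ha using hw'
  set Bad : Set (Euc n) := ⋃ v ∈ t, F ∩ {x | ¬ (a v ≤ inner ℝ v x ∧ inner ℝ v x ≤ a v + (2 + 1/1000))} with hBad
  have hbad : volume.real Bad ≤ min δ (ballVol n / 10) := by
    refine (measureReal_biUnion_finset_le _ _).trans ?_
    refine (Finset.sum_le_sum (g := fun _ => e) fun v hv => ha v ?_).trans ?_
    · have := ht1 hv
      simpa using this
    · rw [Finset.sum_const, nsmul_eq_mul, he]
      rw [mul_div_assoc', div_le_iff₀ (by positivity)]
      nlinarith
  have hBF : Bad ⊆ F := by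
    refine iUnion₂_subset fun v _ => inter_subset_left
  have hBfin : volume Bad ≠ ∞ := measure_ne_top_of_subset hBF hv
  have hdiam : ∀ x ∈ F \ Bad, ∀ y ∈ F \ Bad, ‖x - y‖ ≤ 2.01 := by
    intro x hx y hy
    have slab : ∀ x ∈ F \ Bad, ∀ v ∈ t, a v ≤ inner ℝ v x ∧ inner ℝ v x ≤ a v + (2 + 1/1000) := by
      intro x hx v hv
      by_contra hh
      exact hx.2 (mem_iUnion₂.2 ⟨v, hv, hx.1, hh⟩)
    by_cases hxy : x - y = 0
    · rw [hxy]; norm_num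
    have hd : 0 < ‖x - y‖ := norm_pos_iff.2 hxy
    have hmem : (‖x - y‖⁻¹ • (x - y)) ∈ sphere (0 : Euc n) 1 := by
      simp [norm_smul, inv_mul_cancel₀ hd.ne']
    obtain ⟨v, hv, hvd⟩ := mem_iUnion₂.1 (ht2 hmem)
    rw [mem_ball, dist_eq_norm] at hvd
    have s1 := slab x hx v hv
    have s2 := slab y hy v hv
    have i1 : inner ℝ v (x - y) ≤ 2 + 1/1000 := by rw [inner_sub_right]; linarith
    have i2 : inner ℝ (‖x - y‖⁻¹ • (x - y)) (x - y) = ‖x - y‖ := by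
      rw [real_inner_smul_left, real_inner_self_eq_norm_sq]; field_simp
    have i3 : inner ℝ (‖x - y‖⁻¹ • (x - y) - v) (x - y) ≤ 1/1000 * ‖x - y‖ :=
      (real_inner_le_norm _ _).trans (mul_le_mul_of_nonneg_right hvd.le (norm_nonneg _))
    rw [inner_sub_left, i2] at i3
    norm_num at *
    linarith
  have hgood : 0.9 * ballVol n ≤ volume.real (F \ Bad) := by
    have h1 : volume.real F ≤ volume.real (F \ Bad) + volume.real Bad := by
      refine (measureReal_mono (fun x hx => ?_) (measure_union_ne_top (measure_ne_top_of_subset sdiff_subset hv) hBfin)).trans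
        (measureReal_union_le _ _)
      by_cases hb : x ∈ Bad
      · exact Or.inr hb
      · exact Or.inl ⟨hx, hb⟩
    have := min_le_right δ (ballVol n / 10)
    norm_num
    linarith
  obtain ⟨x, hx⟩ : (F \ Bad).Nonempty := by
    by_contra hne
    rw [not_nonempty_iff_eq_empty] at hne
    rw [hne] at hgood
    simp at hgood
    linarith
  obtain ⟨y, hy, hxy⟩ : ∃ y ∈ F \ Bad, 0.9 ≤ ‖y - x‖ := by
    by_contra hh
    push Not at hh
    have hsub : F \ Bad ⊆ ball x 0.9 := fun y hy => by
      rw [mem_ball, dist_eq_norm]; exact hh y hy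
    have h1 := measureReal_mono hsub (measure_ball_lt_top (μ := volume)).ne
    have hnt : Nontrivial (Euc n) := by
      have : Nonempty (Fin n) := ⟨⟨0, by omega⟩⟩
      infer_instance
    have h2 : volume.real (ball x 0.9) = 0.9 ^ n * ballVol n := by
      rw [Measure.real, Measure.addHaar_ball volume x (by norm_num), ENNReal.toReal_mul, ENNReal.toReal_ofReal (by positivity)]
      simp [ballVol]
    have h3 : (0.9 : ℝ) ^ n ≤ 0.9 ^ 2 := pow_le_pow_of_le_one (by norm_num) (by norm_num) hn
    have h4 := mul_le_mul_of_nonneg_right h3 hω.le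
    rw [h2] at h1
    have h5 : (0.9 : ℝ) ^ 2 * ballVol n < 0.9 * ballVol n := mul_lt_mul_of_pos_right (by norm_num) hω
    linarith
  refine ⟨(1/2 : ℝ) • (x + y), (measureReal_mono (fun z hz => ?_) hBfin).trans (hbad.trans (min_le_left _ _))⟩
  by_contra hzb
  have d1 := hdiam z ⟨hz.1, hzb⟩ x hx
  have d2 := hdiam z ⟨hz.1, hzb⟩ y hy
  have hz2 : 1.96 < ‖z - (1/2 : ℝ) • (x + y)‖ := hz.2
  have par := parallelogram_law_with_norm ℝ (z - x) (z - y)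
  have e1 : z - x + (z - y) = (2:ℝ) • (z - (1/2 : ℝ) • (x + y)) := by module
  have e2 : z - x - (z - y) = y - x := by abel
  rw [e1, e2, norm_smul] at par
  norm_num at *
  nlinarith [norm_nonneg (z - x), norm_nonneg (z - y)]

lemma PK_bound {n : ℕ} (hn : 1 ≤ n) {s : ℝ} (hs : s ∈ Ioo (0:ℝ) 1) {K : Euc n → ℝ} (hKm : Measurable K)
    (hK0 : ∀ x, 0 ≤ K x) (hK : ∀ x : Euc n, x ≠ 0 → K x ≤ ‖x‖ ^ (-((n : ℝ) + s))) {E : Set (Euc n)}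
    (hE : HasFinitePerim E) (hm : MeasurableSet E) (hv : volume E ≠ ∞) {α : ℝ} (hα : 0 < α) :
    PKl K E ≠ ∞ ∧ PK K E = (PKl K E).toReal ∧
      α * s * (1 - s) * PK K E ≤ α * (n * ballVol n) * (perim E + 2 * volume.real E) := by
  have h := PKl_le hn hs hK hE hm hv
  have hf : PKl K E ≠ ∞ := (h.trans_lt ENNReal.ofReal_lt_top).ne
  have he := PK_eq hKm hK0 hm hf
  refine ⟨hf, he, ?_⟩
  have hp := perim_nonneg hE
  have hvn : 0 ≤ volume.real E := measureReal_nonneg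
  have hω := ballVol_pos n
  have hs0 := hs.1
  have hs1 : 0 < 1 - s := by linarith [hs.2]
  have h2 : PK K E ≤ n * ballVol n * (perim E / (1 - s) + 2 * volume.real E / s) := by
    rw [he]
    refine ENNReal.toReal_le_of_le_ofReal (by positivity) h
  have h3 := mul_le_mul_of_nonneg_left h2 (show 0 ≤ α * s * (1 - s) by positivity)
  refine h3.trans ?_
  have e1 : α * s * (1 - s) * (n * ballVol n * (perim E / (1 - s) + 2 * volume.real E / s)) =
      α * (n * ballVol n) * (s * perim E + (1 - s) * (2 * volume.real E)) := by
    field_simp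
  rw [e1]
  refine mul_le_mul_of_nonneg_left ?_ (by positivity)
  nlinarith

set_option maxHeartbeats 1000000 in
lemma trunc {n : ℕ} (hn : 1 ≤ n) : ∃ C δ0 : ℝ, 0 < C ∧ 0 < δ0 ∧ ∀ {s : ℝ}, s ∈ Ioo (0:ℝ) 1 → ∀ {K : Euc n → ℝ},
    Measurable K → (∀ x, 0 ≤ K x) → (∀ x : Euc n, x ≠ 0 → K x ≤ ‖x‖ ^ (-((n : ℝ) + s))) →
    ∀ {α : ℝ}, 0 < α → α * (n * ballVol n) ≤ 1/8 → ∀ {F : Set (Euc n)}, HasFinitePerim F → MeasurableSet F →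
    volume F ≠ ∞ → volume.real F = ballVol n → perim F ≤ n * ballVol n + 1 →
    ∀ u : ℝ, u ≤ 1.98 ^ 2 → volume.real (F ∩ {x | u < ‖x‖ ^ 2}) ≤ δ0 →
    (∃ᶠ ε in 𝓝[>] (0:ℝ), volume.real (F ∩ {x | u < ‖x‖ ^ 2 ∧ ‖x‖ ^ 2 < u + ε}) ≤
      iso n (volume.real (F ∩ {x | u < ‖x‖ ^ 2})) / (4 * C) * ε) →
    ∃ Ft : Set (Euc n), MeasurableSet Ft ∧ HasFinitePerim Ft ∧ Ft ⊆ closedBall 0 2 ∧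
      volume Ft = ENNReal.ofReal (ballVol n) ∧ Jen K s α Ft ≤ Jen K s α F := by
  obtain ⟨C, hC, hcut⟩ := ball_cut
  have hω := ballVol_pos n
  have hn' : (0:ℝ) < n := by exact_mod_cast hn
  set ω := ballVol n with hωd
  set D : ℝ := 4 * (n * ω + 1) / ω + 1/4 with hD
  have hDp : 0 < D := by positivity
  have hx : 0 < ω * (n / (2 * D)) ^ n := by positivity
  refine ⟨C, min (ω / 200) (ω * (n / (2 * D)) ^ n), hC, lt_min (by linarith) hx, ?_⟩
  intro s hs K hKm hK0 hK α hα hαn F hF hm hv hvol hP u hu hδ hfr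
  have hs0 := hs.1
  have hs1 : 0 < 1 - s := by linarith [hs.2]
  have hu4 : u < 4 := by norm_num at hu; linarith
  obtain ⟨pE, pG, hsum⟩ := hcut hF hm hv hu4 hfr
  have hcn : Continuous (fun x : Euc n => ‖x‖ ^ 2) := by fun_prop
  have mE : MeasurableSet (F ∩ {x | ‖x‖ ^ 2 ≤ u}) := hm.inter (measurableSet_le hcn.measurable measurable_const)
  have mG : MeasurableSet (F ∩ {x | u < ‖x‖ ^ 2}) := hm.inter (measurableSet_lt measurable_const hcn.measurable)
  set E := F ∩ {x | ‖x‖ ^ 2 ≤ u} with hE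
  set G := F ∩ {x | u < ‖x‖ ^ 2} with hG
  have vE : volume E ≠ ∞ := measure_ne_top_of_subset inter_subset_left hv
  have vG : volume G ≠ ∞ := measure_ne_top_of_subset inter_subset_left hv
  have hun : E ∪ G = F := by
    rw [hE, hG, ← inter_union_distrib_left]
    refine inter_eq_left.2 fun x _ => ?_
    rcases le_or_gt (‖x‖ ^ 2) u with h | h
    · exact Or.inl h
    · exact Or.inr h
  have hdisj : Disjoint E G := by
    rw [Set.disjoint_left]
    rintro x ⟨-, h1⟩ ⟨-, h2⟩
    exact absurd (show ‖x‖ ^ 2 ≤ u from h1) (not_le.2 h2)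
  have hvs : volume.real E + volume.real G = ω := by
    rw [← measureReal_union hdisj mG vE vG, hun, hvol]
  set δ := volume.real G with hδd
  have hδ0 : 0 ≤ δ := measureReal_nonneg
  have hδ1 : δ ≤ ω / 200 := hδ.trans (min_le_left _ _)
  have hδ2 : δ ≤ ω * (n / (2 * D)) ^ n := hδ.trans (min_le_right _ _)
  have hDδ : 2 * D * δ ≤ iso n δ := by
    rcases hδ0.eq_or_lt with h0 | hpos
    · rw [← h0]; simp [iso]
    · unfold iso
      refine mul_le_mul_of_nonneg_right ?_ hδ0
      have : 2 * D / n ≤ (ω / δ) ^ ((n:ℝ)⁻¹) := by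
        rw [← Real.pow_rpow_inv_natCast (show 0 ≤ 2 * D / n by positivity) (show n ≠ 0 by omega)]
        refine Real.rpow_le_rpow (by positivity) ?_ (by positivity)
        rw [le_div_iff₀ hpos]
        refine (mul_le_mul_of_nonneg_left hδ2 (by positivity)).trans (le_of_eq ?_)
        rw [mul_left_comm, ← mul_pow]
        have : 2 * D / n * (n / (2 * D)) = 1 := by field_simp
        rw [this]; simp
      rw [div_le_iff₀ hn'] at this
      linarith
  have hisoG : iso n δ ≤ perim G := iso_le hn pG mG vG
  have hCM : C * (iso n δ / (4 * C)) = iso n δ / 4 := by field_simp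
  rw [hCM] at hsum
  have hEp : 0 < volume.real E := by linarith
  have hisn := iso_nonneg n hδ0
  have pE0 := perim_nonneg pE
  have pEF : perim E ≤ n * ω + 1 := by linarith
  set R : ℝ := ω / volume.real E with hR
  have hR1 : 1 ≤ R := by rw [hR, le_div_iff₀ hEp]; linarith
  have hR2 : R ≤ 1 + 2 * δ / ω := by
    rw [hR, div_le_iff₀ hEp, show volume.real E = ω - δ by linarith]
    have : (1 + 2 * δ / ω) * (ω - δ) = ω + δ - 2 * δ * δ / ω := by field_simp; ring
    rw [this]
    have : 2 * δ * δ / ω ≤ δ := by rw [div_le_iff₀ hω]; nlinarith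
    linarith
  have hR3 : R ≤ 1.01 := by
    have : 2 * δ / ω ≤ 0.01 := by rw [div_le_iff₀ hω]; norm_num; linarith
    norm_num at *; linarith
  set l : ℝ := R ^ ((n:ℝ)⁻¹) with hl
  have hln : l ^ n = R := Real.rpow_inv_natCast_pow (by linarith) (by omega)
  have hl1 : 1 ≤ l := Real.one_le_rpow hR1 (by positivity)
  have hlR : l ≤ R := by rw [← hln]; exact le_self_pow₀ hl1 (by omega)
  have hl0 : 0 < l := by linarith
  have hEsub : E ⊆ closedBall 0 1.98 := by
    rintro x ⟨-, hx⟩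
    have hx : ‖x‖ ^ 2 ≤ u := hx
    rw [mem_closedBall_zero_iff]
    exact le_of_sq_le_sq (hx.trans hu) (by norm_num)
  have hEsub2 : E ⊆ ball 0 2 := hEsub.trans (closedBall_subset_ball (by norm_num))
  obtain ⟨pT, hpT⟩ := perim_affine pE mE (LinearIsometryEquiv.refl ℝ (Euc n)) (inv_pos.2 hl0) 0
  have hset : ((fun x => l⁻¹ • (LinearIsometryEquiv.refl ℝ (Euc n)) x + 0) ⁻¹' E) = (fun x => l⁻¹ • x) ⁻¹' E := by
    ext x; simp
  rw [hset] at pT hpT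
  set T := (fun x : Euc n => l⁻¹ • x) ⁻¹' E with hT
  have mT : MeasurableSet T := (measurable_const_smul l⁻¹) mE
  have volT : volume T = ENNReal.ofReal ω := by
    have h1 := Measure.addHaar_preimage_smul (volume : Measure (Euc n)) (inv_ne_zero hl0.ne') E
    have h2 : volume E = ENNReal.ofReal (volume.real E) := (ENNReal.ofReal_toReal vE).symm
    change volume ((fun x : Euc n => l⁻¹ • x) ⁻¹' E) = _ at h1
    rw [hT, h1, h2, ← ENNReal.ofReal_mul (abs_nonneg _)]
    congr 1
    simp only [finrank_euclideanSpace, Fintype.card_fin, inv_pow, inv_inv]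
    rw [hln, abs_of_pos (by linarith), hR]
    field_simp
  have vT : volume T ≠ ∞ := by rw [volT]; exact ENNReal.ofReal_ne_top
  refine ⟨T, mT, pT, ?_, volT, ?_⟩
  · intro x hx
    have h1 := hEsub hx
    rw [mem_closedBall_zero_iff] at h1 ⊢
    rw [norm_smul, norm_inv, Real.norm_of_nonneg hl0.le, inv_mul_le_iff₀ hl0] at h1
    norm_num at *
    linarith
  · obtain ⟨fF, eF, -⟩ := PK_bound hn hs hKm hK0 hK hF hm hv hα
    obtain ⟨fE, eE, -⟩ := PK_bound hn hs hKm hK0 hK pE mE vE hα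
    obtain ⟨fG, eG, bG⟩ := PK_bound hn hs hKm hK0 hK pG mG vG hα
    obtain ⟨fT, eT, -⟩ := PK_bound hn hs hKm hK0 hK pT mT vT hα
    have k1 : PK K F ≤ PK K E + PK K G := by
      rw [eF, eE, eG, ← ENNReal.toReal_add fE fG]
      refine ENNReal.toReal_mono (ENNReal.add_ne_top.2 ⟨fE, fG⟩) ?_
      have := PKl_union_le hKm (K := K) (G := G) mE
      rwa [hun] at this
    have k2 : PK K E ≤ PK K T + n * ω * (8 / (1 - s)) * ((l - 1) * perim E) := by
      have h0 : 0 ≤ n * ω * (8 / (1 - s)) * ((l - 1) * perim E) :=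
        mul_nonneg (by positivity) (mul_nonneg (by linarith) pE0)
      rw [eE, eT, ← ENNReal.toReal_ofReal h0, ← ENNReal.toReal_add fT ENNReal.ofReal_ne_top]
      exact ENNReal.toReal_mono (ENNReal.add_ne_top.2 ⟨fT, ENNReal.ofReal_ne_top⟩)
        (PKl_dil hn hs hKm hK pE mE hEsub2 hl1 (by norm_num at hR3; linarith))
    have hβ : 0 ≤ α * s * (1 - s) := by positivity
    have k3 := mul_le_mul_of_nonneg_left (show PK K F ≤ PK K T + n * ω * (8 / (1 - s)) * ((l - 1) * perim E) + PK K G by linarith) hβ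
    have hlp : 0 ≤ (R - 1) * perim E := mul_nonneg (by linarith) pE0
    have k4 : α * s * (1 - s) * (n * ω * (8 / (1 - s)) * ((l - 1) * perim E)) ≤ (R - 1) * perim E := by
      have e1 : α * s * (1 - s) * (n * ω * (8 / (1 - s)) * ((l - 1) * perim E)) =
        s * (8 * (α * (n * ω))) * ((l - 1) * perim E) := by field_simp
      rw [e1]
      have h1 : s * (8 * (α * (n * ω))) ≤ 1 := by
        have : 0 ≤ α * (n * ω) := by positivity
        nlinarith [hs.2]
      have h2 : (l - 1) * perim E ≤ (R - 1) * perim E := mul_le_mul_of_nonneg_right (by linarith) pE0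
      have h3 : 0 ≤ (l - 1) * perim E := mul_nonneg (by linarith) pE0
      exact (mul_le_of_le_one_left h3 h1).trans h2
    have k5 : α * (n * ω) * (perim G + 2 * δ) ≤ 1/8 * (perim G + 2 * δ) :=
      mul_le_mul_of_nonneg_right hαn (by linarith)
    have k6 : perim T ≤ R * perim E := by
      refine hpT.trans (mul_le_mul_of_nonneg_right ?_ pE0)
      rw [inv_pow, inv_inv, hln]
      exact mul_le_of_le_one_left (by linarith) (inv_le_one_of_one_le₀ hl1)
    have k7 : (R - 1) * perim E ≤ 2 * δ / ω * (n * ω + 1) :=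
      mul_le_mul (by linarith) pEF pE0 (by positivity)
    have k8 : 2 * (2 * δ / ω * (n * ω + 1)) + δ / 4 = D * δ := by rw [hD]; field_simp; ring
    unfold Jen
    rw [mul_add, mul_add] at k3
    have k9 : R * perim E = perim E + (R - 1) * perim E := by ring
    linarith

lemma tail_cont {n : ℕ} (hn : 1 ≤ n) {F : Set (Euc n)} (hv : volume F ≠ ∞) {u : ℝ} :
    ContinuousAt (fun u : ℝ => volume.real (F ∩ {x | u < ‖x‖ ^ 2})) u := by
  have hfin : IsFiniteMeasure (volume.restrict F) := ⟨by simpa using hv.lt_top⟩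
  have hcn : Continuous (fun x : Euc n => ‖x‖ ^ 2) := by fun_prop
  have mS : ∀ u : ℝ, MeasurableSet {x : Euc n | u < ‖x‖ ^ 2} := fun u => measurableSet_lt measurable_const hcn.measurable
  have heq : (fun u : ℝ => volume.real (F ∩ {x | u < ‖x‖ ^ 2})) =
      fun u => ∫ x in F, ({x : Euc n | u < ‖x‖ ^ 2}.indicator (fun _ => (1:ℝ))) x := by
    funext w
    rw [integral_indicator (mS w)]
    simp [Measure.restrict_restrict (mS w), inter_comm]
  rw [heq]
  refine continuousAt_of_dominated (bound := fun _ => 1) ?_ ?_ (integrable_const _) ?_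
  · exact Eventually.of_forall fun w => (measurable_const.indicator (mS w)).aestronglyMeasurable
  · refine Eventually.of_forall fun w => Eventually.of_forall fun x => ?_
    rw [Set.indicator_apply]; split_ifs <;> simp
  · have hnt : Nontrivial (Euc n) := by
      have : Nonempty (Fin n) := ⟨⟨0, hn⟩⟩
      infer_instance
    have hz : volume (sphere (0 : Euc n) (Real.sqrt u)) = 0 := Measure.addHaar_sphere _ _ _
    have hae : ∀ᵐ x ∂(volume.restrict F), x ∉ sphere (0 : Euc n) (Real.sqrt u) :=
      ae_restrict_of_ae (measure_eq_zero_iff_ae_notMem.1 hz)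
    filter_upwards [hae] with x hx
    have hne : ‖x‖ ^ 2 ≠ u := by
      intro h
      apply hx
      rw [mem_sphere_zero_iff_norm, ← h, Real.sqrt_sq (norm_nonneg _)]
    rcases lt_or_gt_of_ne hne with h | h
    · refine (continuousAt_const (y := (0:ℝ))).congr ?_
      filter_upwards [lt_mem_nhds h] with w hw
      rw [Set.indicator_of_notMem]
      exact not_lt.2 (le_of_lt hw)
    · refine (continuousAt_const (y := (1:ℝ))).congr ?_
      filter_upwards [gt_mem_nhds h] with w hw
      rw [Set.indicator_of_mem]
      exact hw

set_option maxHeartbeats 1000000 in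
lemma centered {n : ℕ} (hn : 1 ≤ n) : ∃ δ1 : ℝ, 0 < δ1 ∧ ∀ {s : ℝ}, s ∈ Ioo (0:ℝ) 1 → ∀ {K : Euc n → ℝ},
    Measurable K → (∀ x, 0 ≤ K x) → (∀ x : Euc n, x ≠ 0 → K x ≤ ‖x‖ ^ (-((n : ℝ) + s))) →
    ∀ {α : ℝ}, 0 < α → α * (n * ballVol n) ≤ 1/8 → ∀ {F : Set (Euc n)}, HasFinitePerim F → MeasurableSet F →
    volume F ≠ ∞ → volume.real F = ballVol n → perim F ≤ n * ballVol n + 1 →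
    volume.real (F ∩ {x | 1.96 < ‖x‖}) ≤ δ1 →
    ∃ Ft : Set (Euc n), MeasurableSet Ft ∧ HasFinitePerim Ft ∧ Ft ⊆ closedBall 0 2 ∧
      volume Ft = ENNReal.ofReal (ballVol n) ∧ Jen K s α Ft ≤ Jen K s α F := by
  obtain ⟨C, δ0, hC, hδ0, htr⟩ := trunc hn
  have hω := ballVol_pos n
  have hn' : (0:ℝ) < n := by exact_mod_cast hn
  set ω := ballVol n with hωd
  set A : ℝ := ω ^ ((n:ℝ)⁻¹) with hA
  have hAp : 0 < A := by positivity
  set κ : ℝ := A / (8 * C) with hκ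
  have hκp : 0 < κ := by positivity
  set u0 : ℝ := 1.96 ^ 2 with hu0
  set u1 : ℝ := 1.98 ^ 2 with hu1
  have h00 : 0 < u0 := by rw [hu0]; norm_num
  have h01 : u0 < u1 := by rw [hu0, hu1]; norm_num
  have hBp : 0 < (κ * (u1 - u0)) ^ n := pow_pos (mul_pos hκp (by linarith)) n
  refine ⟨min δ0 ((κ * (u1 - u0)) ^ n), lt_min hδ0 hBp, ?_⟩
  intro s hs K hKm hK0 hK α hα hαn F hF hm hv hvol hP htail
  have fin : ∀ S : Set (Euc n), volume (F ∩ S) ≠ ∞ := fun S => measure_ne_top_of_subset inter_subset_left hv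
  set f : ℝ → ℝ := fun u => volume.real (F ∩ {x | u < ‖x‖ ^ 2}) with hf
  have hanti : ∀ a b, a ≤ b → f b ≤ f a := fun a b hab => measureReal_mono
    (inter_subset_inter_right _ fun x hx => lt_of_le_of_lt hab hx) (fin _)
  have hf0 : f u0 ≤ min δ0 ((κ * (u1 - u0)) ^ n) := by
    refine le_trans (measureReal_mono (inter_subset_inter_right _ fun x hx => ?_) (fin _)) htail
    have hx : u0 < ‖x‖ ^ 2 := hx
    exact lt_of_pow_lt_pow_left₀ 2 (norm_nonneg _) hx
  by_contra hno
  have hbad : ∀ u, u0 ≤ u → u ≤ u1 → ∀ᶠ ε in 𝓝[>] (0:ℝ),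
      iso n (f u) / (4 * C) * ε < volume.real (F ∩ {x | u < ‖x‖ ^ 2 ∧ ‖x‖ ^ 2 < u + ε}) := by
    intro u h1 h2
    by_contra hh
    apply hno
    refine htr hs hKm hK0 hK hα hαn hF hm hv hvol hP u h2 ((hanti _ _ h1).trans (hf0.trans (min_le_left _ _))) ?_
    rw [Filter.not_eventually] at hh
    exact hh.mono fun ε h => not_lt.1 h
  have hcn : Continuous (fun x : Euc n => ‖x‖ ^ 2) := by fun_prop
  have hstrip : ∀ u ε, 0 < ε → volume.real (F ∩ {x | u < ‖x‖ ^ 2 ∧ ‖x‖ ^ 2 < u + ε}) ≤ f u - f (u + ε) := by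
    intro u ε hε
    have mG : MeasurableSet (F ∩ {x | u + ε < ‖x‖ ^ 2}) := hm.inter (measurableSet_lt measurable_const hcn.measurable)
    rw [le_sub_iff_add_le, ← measureReal_union _ mG (fin _) (fin _)]
    · refine measureReal_mono ?_ (fin _)
      rintro x (⟨h1, h2⟩ | ⟨h1, h2⟩)
      · exact ⟨h1, h2.1⟩
      · have h2 : u + ε < ‖x‖ ^ 2 := h2
        exact ⟨h1, show u < ‖x‖ ^ 2 by linarith⟩
    · rw [Set.disjoint_left]
      rintro x ⟨-, -, h1⟩ ⟨-, h2⟩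
      have h2 : u + ε < ‖x‖ ^ 2 := h2
      linarith
  have hode := image_le_of_liminf_slope_right_lt_deriv_boundary (f := f) (f' := fun u => - (iso n (f u) / (4 * C)))
    (a := u0) (b := u1) (B := fun u => (κ * (u1 - u)) ^ n) (B' := fun u => - (n * κ * (κ * (u1 - u)) ^ (n - 1)))
    (fun u _ => (tail_cont hn hv).continuousWithinAt)
    (by
      intro u hu r hr
      apply Eventually.frequently
      have h1 := hbad u hu.1 hu.2.le
      have hmap : Tendsto (fun z : ℝ => z - u) (𝓝[>] u) (𝓝[>] 0) := by
        refine tendsto_nhdsWithin_iff.2 ⟨?_, ?_⟩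
        · have : Tendsto (fun z : ℝ => z - u) (𝓝 u) (𝓝 (u - u)) := (continuous_id.sub continuous_const).tendsto u
          rw [sub_self] at this
          exact this.mono_left nhdsWithin_le_nhds
        · filter_upwards [self_mem_nhdsWithin] with z hz
          exact sub_pos.2 (show u < z from hz)
      filter_upwards [hmap.eventually h1, self_mem_nhdsWithin] with z hz hzu
      have hzu : u < z := hzu
      have h2 := hstrip u (z - u) (by linarith)
      rw [show u + (z - u) = z by ring] at h2 hz
      rw [slope_def_field]
      refine lt_trans ?_ hr
      rw [div_lt_iff₀ (by linarith)]
      linarith)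
    (hf0.trans (min_le_right _ _))
    (by
      intro u
      have h1 : HasDerivAt (fun u => κ * (u1 - u)) (κ * (-1)) u :=
        ((hasDerivAt_id' u).const_sub u1).const_mul κ
      have h2 := h1.fun_pow n
      convert! h2 using 1
      ring)
    (by
      intro u hu heq
      have hx : 0 < κ * (u1 - u) := mul_pos hκp (by linarith [hu.2])
      simp only [heq]
      set x := κ * (u1 - u) with hxd
      have hiso : iso n (x ^ n) = n * A * x ^ (n - 1) := by
        unfold iso
        rw [← hωd, Real.div_rpow hω.le (by positivity), Real.pow_rpow_inv_natCast hx.le (by omega), ← hA]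
        obtain ⟨k, rfl⟩ : ∃ k, n = k + 1 := ⟨n - 1, by omega⟩
        simp only [Nat.add_sub_cancel, pow_succ]
        field_simp
      rw [hiso, neg_lt_neg_iff, hκ]
      have hp : 0 < n * A * x ^ (n - 1) := by positivity
      rw [lt_div_iff₀ (by positivity)]
      have : n * (A / (8 * C)) * x ^ (n - 1) * (4 * C) = n * A * x ^ (n - 1) / 2 := by field_simp; ring
      rw [this]; linarith)
  have hlast := hode (show u1 ∈ Icc u0 u1 from ⟨h01.le, le_rfl⟩)
  have hz : f u1 = 0 := by
    refine le_antisymm ?_ measureReal_nonneg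
    simpa [show n ≠ 0 by omega] using hlast
  have hb := hbad u1 h01.le le_rfl
  obtain ⟨ε, h1, h2⟩ := (hb.and self_mem_nhdsWithin).exists
  have h3 := hstrip u1 ε h2
  have h4 : 0 ≤ f (u1 + ε) := measureReal_nonneg
  have h5 : 0 ≤ iso n (f u1) / (4 * C) * ε := by
    have h2 : 0 < ε := h2
    rw [hz]; simp [iso]
  have h6 := h5.trans_lt (h1.trans_le h3)
  rw [hz] at h6
  linarith

lemma norm_main {n : ℕ} (hn : 2 ≤ n) : ∃ γ : ℝ, 0 < γ ∧ ∀ {s : ℝ}, s ∈ Ioo (0:ℝ) 1 → ∀ {K : Euc n → ℝ},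
    Measurable K → (∀ x, 0 ≤ K x) → (∀ x : Euc n, x ≠ 0 → K x ≤ ‖x‖ ^ (-((n : ℝ) + s))) →
    ∀ {α : ℝ}, 0 < α → α ≤ γ → ∀ {F : Set (Euc n)}, HasFinitePerim F → MeasurableSet F →
    volume F = ENNReal.ofReal (ballVol n) → Jen K s α F ≤ Jen K s α (ball 0 1) →
    ∃ Ft : Set (Euc n), MeasurableSet Ft ∧ HasFinitePerim Ft ∧ Ft ⊆ closedBall 0 2 ∧
      volume Ft = ENNReal.ofReal (ballVol n) ∧ Jen K s α Ft ≤ Jen K s α F := by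
  have hn1 : 1 ≤ n := by omega
  obtain ⟨δ1, hδ1, hcen⟩ := centered hn1
  obtain ⟨η1, hη1, hconc⟩ := concentration hn hδ1
  have hω := ballVol_pos n
  have hn' : (1:ℝ) ≤ n := by exact_mod_cast hn1
  set ω := ballVol n with hωd
  have hnω : 0 < n * ω := by positivity
  set η := min η1 1 with hη
  have hηp : 0 < η := lt_min hη1 one_pos
  set q : ℝ := 2 * (n * ω) + 3 * ω with hq
  have hqp : 0 < q := by positivity
  refine ⟨min (1/8) (η / q) / (n * ω), div_pos (lt_min (by norm_num) (div_pos hηp hqp)) hnω, ?_⟩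
  intro s hs K hKm hK0 hK α hα hαγ F hF hm hvol hJ
  rw [le_div_iff₀ hnω] at hαγ
  have hθ1 : α * (n * ω) ≤ 1/8 := hαγ.trans (min_le_left _ _)
  have hθ2 : α * (n * ω) * q ≤ η := by
    have := hαγ.trans (min_le_right _ _)
    rwa [le_div_iff₀ hqp] at this
  have hθ0 : 0 < α * (n * ω) := mul_pos hα hnω
  have hv : volume F ≠ ∞ := by rw [hvol]; exact ENNReal.ofReal_ne_top
  have hvr : volume.real F = ω := by rw [Measure.real, hvol, ENNReal.toReal_ofReal hω.le]
  have hs0 := hs.1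
  have hs1 : 0 < 1 - s := by linarith [hs.2]
  obtain ⟨fF, eF, bF⟩ := PK_bound hn1 hs hKm hK0 hK hF hm hv hα
  rw [hvr] at bF
  have hPF : perim F ≤ n * ω + α * (n * ω) * (perim F + 2 * ω) := by
    have h1 : 0 ≤ α * s * (1 - s) * PK K (ball 0 1) := by
      refine mul_nonneg (by positivity) ?_
      unfold PK
      exact integral_nonneg fun x => integral_nonneg fun y => mul_nonneg (hK0 _) (abs_nonneg _)
    unfold Jen at hJ
    have := (perim_ball hn1).2
    linarith
  have hP0 := perim_nonneg hF
  have hPη : perim F ≤ n * ω + η := by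
    have h1 : α * (n * ω) * (perim F + 2 * ω) ≤ 1/8 * (perim F + 2 * ω) :=
      mul_le_mul_of_nonneg_right hθ1 (by linarith)
    have h2 : perim F + 2 * ω ≤ q := by rw [hq]; linarith
    have h3 := mul_le_mul_of_nonneg_left h2 hθ0.le
    linarith
  obtain ⟨c, hc⟩ := hconc hF hm hv hvr (hPη.trans (by gcongr; exact min_le_left _ _))
  obtain ⟨pT, hpT⟩ := perim_affine hF hm (LinearIsometryEquiv.refl ℝ (Euc n)) one_pos c
  have hset : ((fun x => (1:ℝ) • (LinearIsometryEquiv.refl ℝ (Euc n)) x + c) ⁻¹' F) = (fun x => x + c) ⁻¹' F := by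
    ext x; simp
  rw [hset] at pT hpT
  have hpT' : perim ((fun x => x + c) ⁻¹' F) ≤ perim F := by simpa using hpT
  have hmp : MeasurePreserving (fun x : Euc n => x + c) volume volume := measurePreserving_add_right volume c
  have volT := hmp.measure_preimage hm.nullMeasurableSet
  have mT := hmp.measurable hm
  have eT := PKl_transl K F c
  set T := (fun x : Euc n => x + c) ⁻¹' F with hT
  have hvT : volume T ≠ ∞ := by rw [volT]; exact hv
  have htail : volume.real (T ∩ {x | 1.96 < ‖x‖}) ≤ δ1 := by
    refine le_of_eq_of_le ?_ hc
    have mS : MeasurableSet {x : Euc n | 1.96 < ‖x - c‖} :=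
      measurableSet_lt measurable_const (by fun_prop)
    have h1 := hmp.measure_preimage (hm.inter mS).nullMeasurableSet
    have h2 : (fun x : Euc n => x + c) ⁻¹' (F ∩ {x | 1.96 < ‖x - c‖}) = T ∩ {x | 1.96 < ‖x‖} := by
      ext x; simp [hT]
    rw [h2] at h1
    rw [Measure.real, h1]; rfl
  obtain ⟨Ft, a1, a2, a3, a4, a5⟩ := hcen hs hKm hK0 hK hα hθ1 pT mT hvT
    (by rw [Measure.real, volT]; exact hvr) (hpT'.trans (hPη.trans (by gcongr; exact min_le_right _ _))) htail
  refine ⟨Ft, a1, a2, a3, a4, a5.trans ?_⟩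
  have e2 : PK K T = PK K F := by
    rw [eF, PK_eq hKm hK0 mT (by rw [eT]; exact fF), eT]
  unfold Jen
  rw [e2]
  linarith

lemma perim_dil {n : ℕ} {E : Set (Euc n)} (hE : HasFinitePerim E) (hm : MeasurableSet E) {c : ℝ} (hc : 0 < c) :
    HasFinitePerim ((fun x => c • x) ⁻¹' E) ∧ perim ((fun x => c • x) ⁻¹' E) ≤ c * (c ^ n)⁻¹ * perim E := by
  have h := perim_affine hE hm (LinearIsometryEquiv.refl ℝ (Euc n)) hc 0
  have hset : ((fun x => c • (LinearIsometryEquiv.refl ℝ (Euc n)) x + 0) ⁻¹' E) = (fun x => c • x) ⁻¹' E := by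
    ext x; simp
  rwa [hset] at h

lemma preimage_dil {n : ℕ} (E : Set (Euc n)) {c : ℝ} (hc : c ≠ 0) :
    (fun x : Euc n => c⁻¹ • x) ⁻¹' ((fun x : Euc n => c • x) ⁻¹' E) = E := by
  ext x
  simp only [mem_preimage, smul_smul, mul_inv_cancel₀ hc, one_smul]

lemma perim_dil_eq {n : ℕ} {E : Set (Euc n)} (hE : HasFinitePerim E) (hm : MeasurableSet E) {c : ℝ} (hc : 0 < c) :
    perim ((fun x => c • x) ⁻¹' E) = c * (c ^ n)⁻¹ * perim E := by
  obtain ⟨h1, h2⟩ := perim_dil hE hm hc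
  refine le_antisymm h2 ?_
  have h3 := (perim_dil h1 ((measurable_const_smul c) hm) (inv_pos.2 hc)).2
  rw [preimage_dil E hc.ne'] at h3
  have hcn : 0 < c ^ n := pow_pos hc n
  have h4 := mul_le_mul_of_nonneg_left h3 (show 0 ≤ c * (c ^ n)⁻¹ by positivity)
  refine h4.trans (le_of_eq ?_)
  rw [inv_pow]
  field_simp

lemma Jen_scale {n : ℕ} {K : Euc n → ℝ} {s α r : ℝ} (hr : 0 < r) {E : Set (Euc n)} (hE : HasFinitePerim E)
    (hm : MeasurableSet E) :
    Jen (fun x => r ^ ((n:ℝ) + s) * K (r • x)) s (α * r ^ (1 - s)) ((fun x => r • x) ⁻¹' E) =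
      r * (r ^ n)⁻¹ * Jen K s α E := by
  unfold Jen
  rw [PK_scale K E hr, perim_dil_eq hE hm hr]
  have h1 : r ^ (1 - s) * r ^ ((n:ℝ) + s) = r * r ^ n := by
    rw [← Real.rpow_add hr, show 1 - s + ((n:ℝ) + s) = 1 + n by ring, Real.rpow_add hr, Real.rpow_one, Real.rpow_natCast]
  have hrn : r ^ n ≠ 0 := (pow_pos hr n).ne'
  have h2 : α * r ^ (1 - s) * s * (1 - s) * (r ^ ((n:ℝ) + s) * (r ^ n)⁻¹ * (r ^ n)⁻¹ * PK K E) =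
      (r ^ (1 - s) * r ^ ((n:ℝ) + s)) * (r ^ n)⁻¹ * (r ^ n)⁻¹ * (α * s * (1 - s) * PK K E) := by ring
  rw [h2, h1]
  field_simp


/-- for `α m^{(1-s)/n}` small (threshold depending only on `n`), any competitor
`F` with `J_α(F) ≤ J_α(B_{r₀})` can be replaced (up to translation) by a set `F̃ ⊆ B_{2r₀}`
of the same volume and lower energy. -/
theorem stmt_11 (n : ℕ) (hn : 2 ≤ n) :
    ∃ γ₀ : ℝ, 0 < γ₀ ∧
      ∀ s : ℝ, s ∈ Set.Ioo (0 : ℝ) 1 →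
      ∀ K : Euc n → ℝ, Measurable K → (∀ x, 0 ≤ K x) →
        (∀ x : Euc n, x ≠ 0 → K x ≤ ‖x‖ ^ (-((n : ℝ) + s))) →
        (∀ x y : Euc n, ‖x‖ ≤ ‖y‖ → K y ≤ K x) →
      ∀ α m r₀ : ℝ, 0 < α → 0 < m → 0 < r₀ →
        volume (ball (0 : Euc n) r₀) = ENNReal.ofReal m →
        α * m ^ ((1 - s) / n) ≤ γ₀ →
      ∀ F : Set (Euc n), MeasurableSet F → HasFinitePerim F →
        volume F = ENNReal.ofReal m →
        Jen K s α F ≤ Jen K s α (ball (0 : Euc n) r₀) →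
        ∃ Ft : Set (Euc n), MeasurableSet Ft ∧ HasFinitePerim Ft ∧
          Ft ⊆ closedBall (0 : Euc n) (2 * r₀) ∧ volume Ft = ENNReal.ofReal m ∧
          Jen K s α Ft ≤ Jen K s α F := by
  obtain ⟨γ, hγ, hmain⟩ := norm_main hn
  have hω := ballVol_pos n
  have hn1 : 1 ≤ n := by omega
  have hn' : (0:ℝ) < n := by exact_mod_cast hn1
  have hmn : 0 < min 1 (ballVol n) := lt_min one_pos hω
  refine ⟨γ * min 1 (ballVol n), mul_pos hγ hmn, ?_⟩
  intro s hs K hKm hK0 hK _ α m r hα hm hr hball hαm F mF hF vF hJ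
  have hnt : Nontrivial (Euc n) := by
    have : Nonempty (Fin n) := ⟨⟨0, by omega⟩⟩
    infer_instance
  have hs1 : 0 < 1 - s := by linarith [hs.2]
  have hrn : 0 < r ^ n := pow_pos hr n
  have hmr : m = r ^ n * ballVol n := by
    have h1 := Measure.addHaar_ball (volume : Measure (Euc n)) 0 hr.le
    rw [hball] at h1
    have h2 := congrArg ENNReal.toReal h1
    rw [ENNReal.toReal_mul, ENNReal.toReal_ofReal hm.le, ENNReal.toReal_ofReal (by positivity)] at h2
    simpa [ballVol] using h2
  have hα1 : α * r ^ (1 - s) ≤ γ := by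
    have e1 : m ^ ((1 - s) / n) = r ^ (1 - s) * ballVol n ^ ((1 - s) / n) := by
      rw [hmr, Real.mul_rpow hrn.le hω.le, ← Real.rpow_natCast, ← Real.rpow_mul hr.le]
      congr 2
      field_simp
    have e2 : min 1 (ballVol n) ≤ ballVol n ^ ((1 - s) / n) := by
      have p0 : 0 ≤ (1 - s) / n := by positivity
      rcases le_total 1 (ballVol n) with h | h
      · exact (min_le_left _ _).trans (Real.one_le_rpow h p0)
      · refine (min_le_right _ _).trans ?_
        have p1 : (1 - s) / n ≤ 1 := by
          rw [div_le_one hn']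
          have : (1:ℝ) ≤ n := by exact_mod_cast hn1
          linarith [hs.1]
        have := Real.rpow_le_rpow_of_exponent_ge hω h p1
        simpa using this
    rw [e1] at hαm
    have e3 : 0 ≤ α * r ^ (1 - s) := by positivity
    have e4 := mul_le_mul_of_nonneg_left e2 e3
    exact le_of_mul_le_mul_right (by linarith) hmn
  have hvol : ∀ E : Set (Euc n), ∀ c : ℝ, 0 < c → volume ((fun x : Euc n => c • x) ⁻¹' E) =
      ENNReal.ofReal ((c ^ n)⁻¹) * volume E := by
    intro E c hc
    have h1 := Measure.addHaar_preimage_smul (volume : Measure (Euc n)) hc.ne' E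
    change volume ((fun x : Euc n => c • x) ⁻¹' E) = _ at h1
    rw [h1]
    simp only [finrank_euclideanSpace, Fintype.card_fin]
    rw [abs_of_pos (inv_pos.2 (pow_pos hc n))]
  have hbs : (fun x : Euc n => r • x) ⁻¹' (ball 0 r) = ball 0 1 := by
    ext x
    simp only [mem_preimage, mem_ball_zero_iff, norm_smul, Real.norm_of_nonneg hr.le]
    exact mul_lt_iff_lt_one_right hr
  have hbp : HasFinitePerim (ball (0 : Euc n) r) := by
    have h1 := (perim_dil (perim_ball hn1).1 measurableSet_ball (inv_pos.2 hr)).1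
    rwa [← hbs, preimage_dil _ hr.ne'] at h1
  have hk : 0 < r * (r ^ n)⁻¹ := by positivity
  have hJ1 : Jen (fun x => r ^ ((n:ℝ) + s) * K (r • x)) s (α * r ^ (1 - s)) ((fun x => r • x) ⁻¹' F) ≤
      Jen (fun x => r ^ ((n:ℝ) + s) * K (r • x)) s (α * r ^ (1 - s)) (ball 0 1) := by
    rw [← hbs, Jen_scale hr hF mF, Jen_scale hr hbp measurableSet_ball]
    exact mul_le_mul_of_nonneg_left hJ hk.le
  obtain ⟨G, mG, pG, sG, vG, jG⟩ := hmain hs (K := fun x => r ^ ((n:ℝ) + s) * K (r • x))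
    (by fun_prop) (fun x => mul_nonneg (by positivity) (hK0 _))
    (by
      intro x hx
      have h1 := hK (r • x) (smul_ne_zero hr.ne' hx)
      rw [norm_smul, Real.norm_of_nonneg hr.le, Real.mul_rpow hr.le (norm_nonneg _)] at h1
      refine (mul_le_mul_of_nonneg_left h1 (Real.rpow_nonneg hr.le _)).trans (le_of_eq ?_)
      rw [← mul_assoc, ← Real.rpow_add hr]
      simp) (by positivity) hα1 (perim_dil hF mF hr).1 ((measurable_const_smul r) mF)
    (by
      rw [hvol F r hr, vF, ← ENNReal.ofReal_mul (by positivity), hmr]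
      congr 1
      field_simp) hJ1
  have pT := (perim_dil pG mG (inv_pos.2 hr)).1
  have mT : MeasurableSet ((fun x : Euc n => r⁻¹ • x) ⁻¹' G) := (measurable_const_smul r⁻¹) mG
  refine ⟨(fun x => r⁻¹ • x) ⁻¹' G, mT, pT, ?_, ?_, ?_⟩
  · intro x hx
    have h1 := sG hx
    rw [mem_closedBall_zero_iff] at h1 ⊢
    rw [norm_smul, norm_inv, Real.norm_of_nonneg hr.le, inv_mul_le_iff₀ hr] at h1
    linarith
  · rw [hvol G _ (inv_pos.2 hr), vG, ← ENNReal.ofReal_mul (by positivity), hmr, inv_pow, inv_inv]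
  · have h1 := Jen_scale (K := K) (s := s) (α := α) hr pT mT
    have h2 : (fun x : Euc n => r • x) ⁻¹' ((fun x : Euc n => r⁻¹ • x) ⁻¹' G) = G := by
      have := preimage_dil G (inv_ne_zero hr.ne')
      rwa [inv_inv] at this
    rw [h2] at h1
    rw [h1, Jen_scale hr hF mF] at jG
    exact le_of_mul_le_mul_left jG hk
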